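/- Let F be an algebraically closed field of characteristic 0 and let g be the simple Lie algebra of type E8 over F (equivalently, a finite-dimensional simple Lie algebra over F with dim g = 248). Then there exists a grading of g by the group (ℤ/5ℤ)^3 such that dim g_α = 2 for every nonzero α ∈ (ℤ/5ℤ)^3 (so necessarily g_0 = 0), and any two such gradings of g are equivalent. -/

import Mathlib

open Module

/-- A grading of the Lie algebra `L` over `F` by the additive group `A`:
a direct sum decomposition into subspaces compatible with the bracket. -/
def IsLieGrading (F : Type*) {A L : Type*} [Field F] [AddCommGroup A] [DecidableEq A]
    [LieRing L] [LieAlgebra F L] (gr : A → Submodule F L) : Prop :=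
  DirectSum.IsInternal gr ∧
    ∀ a b : A, ∀ x ∈ gr a, ∀ y ∈ gr b, ⁅x, y⁆ ∈ gr (a + b)

/-- Two gradings of `L` are equivalent if some automorphism of `L` maps each nonzero
homogeneous component of the first grading onto a homogeneous component of the second. -/
def GradingsEquiv (F : Type*) {A B L : Type*} [Field F] [AddCommGroup A] [AddCommGroup B]
    [LieRing L] [LieAlgebra F L] (gr : A → Submodule F L) (gr' : B → Submodule F L) : Prop :=
  ∃ φ : L ≃ₗ⁅F⁆ L, ∀ a : A, gr a ≠ ⊥ →
    ∃ b : B, (gr a).map φ.toLinearEquiv.toLinearMap = gr' b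

set_option linter.unusedSectionVars false

universe u v

namespace RootPairing

section Counting

variable {ι K M N : Type*} [Fintype ι] [Field K] [CharZero K] [IsAlgClosed K]
  [AddCommGroup M] [Module K M] [AddCommGroup N] [Module K N] [FiniteDimensional K M]
  (P : RootPairing ι K M N)

/-- The operator `∑ j, f j • (x ↦ ⟨x, j^∨⟩ • j)`. -/
noncomputable def weightedSum (f : ι → K) : Module.End K M :=
  ∑ j, f j • (P.coroot' j).smulRight (P.root j)

lemma weightedSum_apply (f : ι → K) (x : M) :
    P.weightedSum f x = ∑ j, (f j * P.coroot' j x) • P.root j := by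
  simp [weightedSum, mul_smul]

lemma trace_weightedSum (f : ι → K) :
    LinearMap.trace K M (P.weightedSum f) = 2 * ∑ j, f j := by
  simp [weightedSum, LinearMap.trace_smulRight, Finset.sum_mul, mul_comm (2 : K)]

lemma weightedSum_reflection (f : ι → K) (hf : ∀ i j, f (P.reflectionPerm i j) = f j) (i : ι)
    (x : M) : P.weightedSum f (P.reflection i x) = P.reflection i (P.weightedSum f x) := by
  rw [weightedSum_apply, weightedSum_apply, map_sum,
    ← Equiv.sum_comp (P.reflectionPerm i)]
  refine Finset.sum_congr rfl fun j _ ↦ ?_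
  rw [hf, P.coroot'_reflectionPerm, map_smul, P.root_reflectionPerm]
  simp

/-- A Weyl group invariant weighted sum of the rank one operators is a scalar. -/
lemma exists_weightedSum_eq [P.IsIrreducible] (f : ι → K)
    (hf : ∀ i j, f (P.reflectionPerm i j) = f j) :
    ∃ μ : K, ∀ x, P.weightedSum f x = μ • x := by
  have := IsIrreducible.nontrivial P
  obtain ⟨μ, hμ⟩ := Module.End.exists_eigenvalue (P.weightedSum f)
  refine ⟨μ, fun x ↦ ?_⟩
  have h : (P.weightedSum f).eigenspace μ = ⊤ := by
    refine IsIrreducible.eq_top_of_invtSubmodule_reflection (P := P) _ (fun i ↦ ?_) hμ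
    intro y hy
    simp only [Submodule.mem_comap, LinearEquiv.coe_coe]
    rw [Module.End.mem_eigenspace_iff] at hy ⊢
    rw [P.weightedSum_reflection f hf, hy, map_smul]
  exact Module.End.mem_eigenspace_iff.mp (h ▸ Submodule.mem_top)

lemma exists_sum_pairing_eq [P.IsIrreducible] (f : ι → K)
    (hf : ∀ i j, f (P.reflectionPerm i j) = f j) :
    ∃ μ : K, (∀ i k, ∑ j, f j * P.pairing i j * P.pairing j k = μ * P.pairing i k) ∧
      2 * ∑ j, f j = μ * finrank K M := by
  obtain ⟨μ, hμ⟩ := P.exists_weightedSum_eq f hf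
  refine ⟨μ, fun i k ↦ ?_, ?_⟩
  · have := congrArg (P.coroot' k) (hμ (P.root i))
    rw [weightedSum_apply] at this
    simpa using this
  · rw [← P.trace_weightedSum, show P.weightedSum f = μ • LinearMap.id from LinearMap.ext hμ]
    simp

/-- Pairwise orthogonal (or opposite) roots are at most twice as many as the rank. -/
lemma card_le_two_mul_finrank [DecidableEq ι] [P.IsCrystallographic] (X : Finset ι)
    (hneg : ∀ i ∈ X, P.reflectionPerm i i ∈ X)
    (hX : ∀ i ∈ X, ∀ j ∈ X, P.pairing i j ≠ 0 → i = j ∨ i = P.reflectionPerm j j) :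
    X.card ≤ 2 * finrank K M := by
  set Q := P.weightedSum (fun j ↦ if j ∈ X then (4⁻¹ : K) else 0) with hQ
  have hfix : ∀ i ∈ X, Q (P.root i) = P.root i := by
    intro i hi
    have hne : i ≠ P.reflectionPerm i i := by
      intro h
      have := congrArg P.root h
      have hM : IsAddTorsionFree M := .of_isTorsionFree K M
      rw [P.root_reflectionPerm, P.reflection_apply_self, self_eq_neg] at this
      exact P.ne_zero i this
    rw [hQ, weightedSum_apply, ← Finset.sum_subset (Finset.subset_univ {i, P.reflectionPerm i i})]
    · rw [Finset.sum_pair hne]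
      simp only [hi, hneg i hi, if_true, root_coroot'_eq_pairing, pairing_same,
        P.root_reflectionPerm, P.reflection_apply_self, pairing_reflectionPerm_self_right]
      rw [smul_neg, ← neg_smul, ← add_smul]
      norm_num
    · intro j _ hj
      by_cases hjX : j ∈ X
      · have : P.pairing i j = 0 := by
          by_contra h
          rcases hX i hi j hjX h with rfl | h'
          · simp at hj
          · apply hj
            rw [h']
            simp only [Finset.mem_insert, Finset.mem_singleton]
            right
            apply P.root.injective
            rw [P.root_reflectionPerm, P.reflection_apply_self, P.root_reflectionPerm,
              P.reflection_apply_self, neg_neg]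
        simp [this]
      · simp [hjX]
  have hid : IsIdempotentElem Q := by
    ext x
    have h1 : ∀ y, Q y = ∑ j, ((if j ∈ X then (4⁻¹ : K) else 0) * P.coroot' j y) • P.root j :=
      fun y ↦ P.weightedSum_apply _ y
    rw [Module.End.mul_apply]
    conv_lhs => rw [h1 x, map_sum]
    conv_rhs => rw [h1 x]
    refine Finset.sum_congr rfl fun j _ ↦ ?_
    by_cases hj : j ∈ X
    · rw [map_smul, hfix j hj]
    · simp [hj]
  have htr := (LinearMap.IsIdempotentElem.isProj_range Q hid).trace
  rw [hQ, trace_weightedSum, Finset.sum_ite_mem, Finset.univ_inter, Finset.sum_const,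
    nsmul_eq_mul, ← hQ] at htr
  have h2 : (X.card : K) = ((2 * finrank K (LinearMap.range Q) : ℕ) : K) := by
    push_cast
    rw [← htr]
    ring
  have h3 := Nat.cast_injective h2
  have := Submodule.finrank_le (LinearMap.range Q)
  omega

end Counting

end RootPairing

namespace RootPairing

section Classification

variable {ι K M N : Type*} [Fintype ι] [DecidableEq ι] [Field K] [CharZero K] [IsAlgClosed K]
  [AddCommGroup M] [Module K M] [AddCommGroup N] [Module K N] [FiniteDimensional K M]
  (P : RootPairing ι K M N) [P.IsCrystallographic]

lemma pairingIn_reflectionPerm_left (i j k : ι) :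
    P.pairingIn ℤ (P.reflectionPerm j i) k =
      P.pairingIn ℤ i k - P.pairingIn ℤ i j * P.pairingIn ℤ j k := by
  have h : P.pairing (P.reflectionPerm j i) k =
      P.pairing i k - P.pairing i j * P.pairing j k := by
    rw [← root_coroot'_eq_pairing, P.root_reflectionPerm, reflection_apply_root]
    simp
  simp only [← P.algebraMap_pairingIn ℤ] at h
  exact_mod_cast h

lemma pairingIn_reflectionPerm_right (i j k : ι) :
    P.pairingIn ℤ k (P.reflectionPerm j i) =
      P.pairingIn ℤ k i - P.pairingIn ℤ k j * P.pairingIn ℤ j i := by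
  rw [P.pairingIn_reflectionPerm, pairingIn_reflectionPerm_left]

lemma root_reflectionPerm_eq (i j : ι) :
    P.root (P.reflectionPerm j i) = P.root i - (P.pairingIn ℤ i j : K) • P.root j := by
  rw [P.root_reflectionPerm, reflection_apply_root, ← P.algebraMap_pairingIn ℤ]
  simp

lemma finrank_mul_sum_pairingIn [P.IsIrreducible] (S : ι → Prop) [DecidablePred S]
    (hS : ∀ i j, S (P.reflectionPerm i j) ↔ S j) (i : ι) :
    (finrank K M : ℤ) * ∑ j with S j, P.pairingIn ℤ i j * P.pairingIn ℤ j i =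
      4 * (Finset.univ.filter S).card := by
  obtain ⟨μ, h1, h2⟩ := P.exists_sum_pairing_eq (fun j ↦ if S j then (1 : K) else 0)
    (fun i j ↦ by simp [hS])
  have h1 := h1 i i
  rw [P.pairing_same] at h1
  simp only [ite_mul, one_mul, zero_mul, ← Finset.sum_filter] at h1 h2
  simp only [← P.algebraMap_pairingIn ℤ] at h1
  have : ((finrank K M : ℤ) * ∑ j with S j, P.pairingIn ℤ i j * P.pairingIn ℤ j i : ℤ) =
      ((4 * (Finset.univ.filter S).card : ℤ) : K) := by
    push_cast
    simp only [eq_intCast, Finset.sum_const, nsmul_eq_mul, mul_one] at h1 h2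
    rw [h1]
    linear_combination (-2) * h2
  exact_mod_cast this

lemma root_reflectionPerm_self (i : ι) : P.root (P.reflectionPerm i i) = -P.root i := by
  rw [P.root_reflectionPerm, P.reflection_apply_self]

lemma reflectionPerm_self_self (i : ι) : P.reflectionPerm (P.reflectionPerm i i)
    (P.reflectionPerm i i) = i := by
  apply P.root.injective
  rw [root_reflectionPerm_self, root_reflectionPerm_self, neg_neg]

lemma reflectionPerm_self_ne (i : ι) : P.reflectionPerm i i ≠ i := by
  intro h
  have := congrArg P.root h
  have hM : IsAddTorsionFree M := .of_isTorsionFree K M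
  rw [P.root_reflectionPerm, P.reflection_apply_self, neg_eq_self] at this
  exact P.ne_zero i this

lemma even_card_of_involution {α : Type*} (s : Finset α) (g : α → α)
    (h1 : ∀ a ∈ s, g a ∈ s) (h2 : ∀ a ∈ s, g (g a) = a) (h3 : ∀ a ∈ s, g a ≠ a) :
    Even s.card := by
  classical
  have : ∑ _a ∈ s, (1 : ZMod 2) = 0 :=
    Finset.sum_involution (fun a _ ↦ g a) (fun a _ ↦ by decide) (fun a ha _ ↦ h3 a ha)
      (fun a ha ↦ h1 a ha) (fun a ha ↦ h2 a ha)
  rw [Finset.sum_const, nsmul_eq_mul, mul_one] at this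
  exact (ZMod.natCast_eq_zero_iff_even).mp this

lemma card_filter_neg (S : ι → Prop) [DecidablePred S]
    (hS : ∀ i j, S (P.reflectionPerm i j) ↔ S j) (i : ι) (a : ℤ) :
    (Finset.univ.filter fun j ↦ S j ∧ P.pairingIn ℤ j i = -a).card =
      (Finset.univ.filter fun j ↦ S j ∧ P.pairingIn ℤ j i = a).card := by
  refine Finset.card_nbij' (fun j ↦ P.reflectionPerm j j) (fun j ↦ P.reflectionPerm j j)
    ?_ ?_ ?_ ?_
  · intro j hj; simp_all
  · intro j hj; simp_all
  · intro j hj; exact P.reflectionPerm_self_self j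
  · intro j hj; exact P.reflectionPerm_self_self j

lemma even_card_filter [P.IsReduced] (S : ι → Prop) [DecidablePred S]
    (hS : ∀ i j, S (P.reflectionPerm i j) ↔ S j) (i : ι) (a : ℤ) (ha : 0 < a)
    (hi : ∀ j, S j → P.pairingIn ℤ j i = a → j ≠ i) :
    Even (Finset.univ.filter fun j ↦ S j ∧ P.pairingIn ℤ j i = a).card := by
  refine even_card_of_involution _
    (fun j ↦ P.reflectionPerm i (P.reflectionPerm j j)) ?_ ?_ ?_
  · intro j hj
    simp only [Finset.mem_filter, Finset.mem_univ, true_and, hS] at hj ⊢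
    refine ⟨hj.1, ?_⟩
    rw [P.pairingIn_reflectionPerm_left, P.pairingIn_reflectionPerm_self_left, hj.2,
      P.pairingIn_same]
    ring
  · intro j hj
    simp only [Finset.mem_filter, Finset.mem_univ, true_and] at hj
    apply P.root.injective
    rw [P.root_reflectionPerm_eq, root_reflectionPerm_self,
      P.pairingIn_reflectionPerm_self_left, P.pairingIn_reflectionPerm_left,
      P.pairingIn_reflectionPerm_self_left, P.root_reflectionPerm_eq, root_reflectionPerm_self,
      P.pairingIn_reflectionPerm_self_left, hj.2, P.pairingIn_same]
    push_cast
    module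
  · intro j hj h
    simp only [Finset.mem_filter, Finset.mem_univ, true_and] at hj
    have h := congrArg P.root h
    rw [P.root_reflectionPerm_eq, P.pairingIn_reflectionPerm_self_left, hj.2,
      P.root_reflectionPerm, P.reflection_apply_self] at h
    have h2 : (-2 : K) • P.root j + (a : K) • P.root i = 0 := by
      rw [← sub_eq_zero] at h
      rw [← h]
      push_cast
      module
    have hne : j ≠ i := hi j hj.1 hj.2
    have hne' : P.root j ≠ - P.root i := by
      intro hh
      rw [hh] at h2
      have : ((2 : K) + a) • P.root i = 0 := by rw [← h2]; module
      rw [smul_eq_zero] at this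
      have h3 := this.resolve_right (P.ne_zero i)
      have h4 : j = P.reflectionPerm i i := by
        apply P.root.injective
        rw [hh, P.root_reflectionPerm, P.reflection_apply_self]
      have := hj.2
      rw [h4] at this
      simp at this
      have : (2 : ℤ) + a = 0 := by exact_mod_cast h3
      omega
    have := IsReduced.linearIndependent P hne hne'
    have := LinearIndependent.pair_iff.mp this _ _ h2
    norm_num at this

end Classification

end RootPairing

namespace RootPairing

section Classification

variable {ι K M N : Type*} [Fintype ι] [DecidableEq ι] [Field K] [CharZero K] [IsAlgClosed K]
  [AddCommGroup M] [Module K M] [AddCommGroup N] [Module K N] [FiniteDimensional K M]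
  (P : RootPairing ι K M N) [P.IsCrystallographic] [P.IsReduced] [P.IsIrreducible]

lemma eq_or_eq_of_even (i j : ι) (h0 : P.pairingIn ℤ i j ≠ 0) (h1 : Even (P.pairingIn ℤ i j))
    (h2 : Even (P.pairingIn ℤ j i)) : i = j ∨ i = P.reflectionPerm j j := by
  have := P.pairingIn_pairingIn_mem_set_of_isCrystal_of_isRed i j
  simp only [Set.mem_insert_iff, Set.mem_singleton_iff, Prod.mk.injEq] at this
  have h3 : (P.pairingIn ℤ i j = 2 ∧ P.pairingIn ℤ j i = 2) ∨
      (P.pairingIn ℤ i j = -2 ∧ P.pairingIn ℤ j i = -2) := by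
    obtain ⟨a, ha⟩ := h1
    obtain ⟨b, hb⟩ := h2
    omega
  have : Module.IsReflexive K M := .of_isPerfPair P.toLinearMap
  rcases h3 with h3 | h3
  · exact .inl ((P.pairingIn_two_two_iff ℤ i j).mp h3)
  · right
    apply P.root.injective
    rw [root_reflectionPerm_self]
    exact (P.pairingIn_neg_two_neg_two_iff ℤ i j).mp h3

/-- The number of long roots in a doubly laced root system. -/
lemma card_long (long : ι → Prop) [DecidablePred long]
    (hinv : ∀ i j, long (P.reflectionPerm i j) ↔ long j)
    (hdiff : ∀ i j, long i → ¬ long j → P.pairingIn ℤ i j = 2 * P.pairingIn ℤ j i)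
    (e : ι) (he : ¬ long e) :
    ∃ p, Even p ∧ (Finset.univ.filter long).card = finrank K M * p ∧ p + 2 ≤ 2 * finrank K M := by
  set X := Finset.univ.filter fun l ↦ long l ∧ P.pairingIn ℤ l e = 2 with hX
  have htab : ∀ l, long l → (P.pairingIn ℤ l e = 0 ∧ P.pairingIn ℤ e l = 0) ∨
      (P.pairingIn ℤ l e = 2 ∧ P.pairingIn ℤ e l = 1) ∨
      (P.pairingIn ℤ l e = -2 ∧ P.pairingIn ℤ e l = -1) := by
    intro l hl
    have := P.pairingIn_pairingIn_mem_set_of_isCrystal_of_isRed l e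
    simp only [Set.mem_insert_iff, Set.mem_singleton_iff, Prod.mk.injEq] at this
    have := hdiff l e hl he
    omega
  have hXe : ∀ l ∈ X, long l ∧ P.pairingIn ℤ l e = 2 ∧ P.pairingIn ℤ e l = 1 := by
    intro l hl
    simp only [hX, Finset.mem_filter, Finset.mem_univ, true_and] at hl
    have := htab l hl.1
    exact ⟨hl.1, hl.2, by omega⟩
  refine ⟨X.card, ?_, ?_, ?_⟩
  · exact P.even_card_filter long hinv e 2 (by norm_num) fun j hj _ h ↦ he (h ▸ hj)
  · have h1 := P.finrank_mul_sum_pairingIn long hinv e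
    have h2 : ∑ j with long j, P.pairingIn ℤ e j * P.pairingIn ℤ j e = 4 * X.card := by
      have h3 := P.card_filter_neg long hinv e 2
      rw [← hX] at h3
      have : ∀ j ∈ Finset.univ.filter long, P.pairingIn ℤ e j * P.pairingIn ℤ j e =
          2 * (if P.pairingIn ℤ j e = 2 then 1 else 0) +
          2 * (if P.pairingIn ℤ j e = -2 then 1 else 0) := by
        intro j hj
        rcases htab j (by simpa using hj) with h | h | h <;> simp [h]
      rw [Finset.sum_congr rfl this, Finset.sum_add_distrib, ← Finset.mul_sum, ← Finset.mul_sum,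
        Finset.sum_boole, Finset.sum_boole, Finset.filter_filter, Finset.filter_filter, h3, ← hX]
      ring
    rw [h2] at h1
    have h4 : ((finrank K M * X.card : ℕ) : ℤ) = (Finset.univ.filter long).card := by
      push_cast
      linarith
    exact_mod_cast h4.symm
  · set Y := X.image (fun l ↦ P.reflectionPerm l e) with hY
    have hroot : ∀ l ∈ X, P.root (P.reflectionPerm l e) = P.root e - P.root l := by
      intro l hl
      rw [root_reflectionPerm_eq, (hXe l hl).2.2]
      simp
    have hYcard : Y.card = X.card := by
      refine Finset.card_image_of_injOn fun l hl l' hl' h ↦ ?_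
      have h := congrArg P.root h
      rw [hroot l hl, hroot l' hl', sub_right_inj] at h
      exact P.root.injective h
    have hYe : ∀ y ∈ Y, P.pairingIn ℤ y e = 0 ∧ P.pairingIn ℤ e y = 0 := by
      intro y hy
      obtain ⟨l, hl, rfl⟩ := Finset.mem_image.mp hy
      rw [pairingIn_reflectionPerm_left, pairingIn_reflectionPerm_right, P.pairingIn_same]
      obtain ⟨-, h1, h2⟩ := hXe l hl
      rw [h1, h2]
      norm_num
    set E : Finset ι := {e, P.reflectionPerm e e} with hE
    have hEY : Disjoint E Y := by
      rw [Finset.disjoint_left]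
      intro y hy hy'
      have := (hYe y hy').1
      simp only [hE, Finset.mem_insert, Finset.mem_singleton] at hy
      rcases hy with rfl | rfl <;> simp at this
    have hEcard : E.card = 2 := Finset.card_pair (P.reflectionPerm_self_ne e).symm
    have key := P.card_le_two_mul_finrank (E ∪ Y) ?_ ?_
    · rw [Finset.card_union_of_disjoint hEY, hEcard, hYcard] at key
      omega
    · intro i hi
      rw [Finset.mem_union] at hi ⊢
      rcases hi with hi | hi
      · left
        simp only [hE, Finset.mem_insert, Finset.mem_singleton] at hi ⊢
        rcases hi with rfl | rfl
        · simp
        · left; exact P.reflectionPerm_self_self e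
      · right
        obtain ⟨l, hl, rfl⟩ := Finset.mem_image.mp hi
        refine Finset.mem_image.mpr ⟨P.reflectionPerm e (P.reflectionPerm l l), ?_, ?_⟩
        · obtain ⟨h0, h1, h2⟩ := hXe l hl
          simp only [hX, Finset.mem_filter, Finset.mem_univ, true_and, hinv]
          refine ⟨h0, ?_⟩
          rw [pairingIn_reflectionPerm_left, P.pairingIn_reflectionPerm_self_left, h1,
            P.pairingIn_same]
          norm_num
        · obtain ⟨h0, h1, h2⟩ := hXe l hl
          apply P.root.injective
          simp only [root_reflectionPerm_self, hroot l hl]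
          rw [root_reflectionPerm_eq, pairingIn_reflectionPerm_right,
            P.pairingIn_reflectionPerm_self_right, root_reflectionPerm_eq,
            P.pairingIn_reflectionPerm_self_left, root_reflectionPerm_self,
            P.pairingIn_same, h1, h2]
          push_cast
          module
    · intro i hi j hj hij
      have hij : P.pairingIn ℤ i j ≠ 0 := by
        intro h
        apply hij
        rw [← P.algebraMap_pairingIn ℤ, h, map_zero]
      rw [Finset.mem_union] at hi hj
      have hEe : ∀ i ∈ E, ∀ j, (P.pairingIn ℤ i j = P.pairingIn ℤ e j ∨
          P.pairingIn ℤ i j = - P.pairingIn ℤ e j) ∧ (P.pairingIn ℤ j i = P.pairingIn ℤ j e ∨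
          P.pairingIn ℤ j i = - P.pairingIn ℤ j e) := by
        intro i hi j
        simp only [hE, Finset.mem_insert, Finset.mem_singleton] at hi
        rcases hi with rfl | rfl <;> simp
      rcases hi with hi | hi <;> rcases hj with hj | hj
      · simp only [hE, Finset.mem_insert, Finset.mem_singleton] at hi hj
        rcases hi with rfl | rfl <;> rcases hj with rfl | rfl
        · simp
        · right; exact (P.reflectionPerm_self_self i).symm
        · simp
        · simp
      · exfalso
        have h1 := (hEe i hi j).1
        have h2 := hYe j hj
        omega
      · exfalso
        have h1 := (hEe j hj i).2
        have h2 := hYe i hi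
        omega
      · have hev : ∀ i ∈ Y, ∀ j ∈ Y, Even (P.pairingIn ℤ i j) := by
          intro i hi j hj
          obtain ⟨l, hl, rfl⟩ := Finset.mem_image.mp hi
          obtain ⟨l', hl', rfl⟩ := Finset.mem_image.mp hj
          obtain ⟨-, h1, h2⟩ := hXe l hl
          obtain ⟨-, h1', h2'⟩ := hXe l' hl'
          simp only [pairingIn_reflectionPerm_left, pairingIn_reflectionPerm_right,
            P.pairingIn_same, h1, h2, h1', h2']
          exact ⟨P.pairingIn ℤ l l' - 1, by ring⟩
        exact P.eq_or_eq_of_even i j hij (hev i hi j hj) (hev j hj i hi)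

lemma finrank_le_card [P.IsRootSystem] : finrank K M ≤ Fintype.card ι := by
  have := finrank_range_le_card (R := K) P.root
  rwa [Set.finrank, IsRootSystem.span_root_eq_top (P := P), finrank_top] at this

lemma pairingIn_flip_int (i j : ι) : P.flip.pairingIn ℤ i j = P.pairingIn ℤ j i := by
  have h : P.flip.pairing i j = P.pairing j i := rfl
  rw [← P.algebraMap_pairingIn ℤ, ← P.flip.algebraMap_pairingIn ℤ] at h
  exact_mod_cast h

lemma not_doubly_laced [P.IsRootSystem]
    (h248 : finrank K M + Fintype.card ι = 248) (i₀ j₀ : ι)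
    (h0 : P.pairingIn ℤ j₀ i₀ ≠ 0) (h2 : P.pairingIn ℤ i₀ j₀ = 2 * P.pairingIn ℤ j₀ i₀) :
    False := by
  classical
  have B := (P.posRootForm ℤ).toInvariantForm
  have hcast : ∀ i j, P.pairing i j = (P.pairingIn ℤ i j : K) := fun i j ↦ by
    rw [← P.algebraMap_pairingIn ℤ]; rfl
  have hB : B.form (P.root i₀) (P.root i₀) = 2 * B.form (P.root j₀) (P.root j₀) := by
    have := B.pairing_mul_eq_pairing_mul_swap i₀ j₀
    rw [hcast, hcast, h2] at this
    have h0' : (P.pairingIn ℤ j₀ i₀ : K) ≠ 0 := by exact_mod_cast h0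
    apply mul_left_cancel₀ h0'
    rw [this]
    push_cast
    ring
  have hj0 := B.ne_zero j₀
  have hne : B.form (P.root i₀) (P.root i₀) ≠ B.form (P.root j₀) (P.root j₀) := by
    intro h
    rw [h] at hB
    apply hj0
    linear_combination -hB
  have hlen := B.apply_eq_or_of_apply_ne hne
  let long : ι → Prop := fun k ↦ B.form (P.root k) (P.root k) = B.form (P.root i₀) (P.root i₀)
  have hinv : ∀ i j, long (P.reflectionPerm i j) ↔ long j := by
    intro i j
    simp only [long]
    rw [P.root_reflectionPerm, B.apply_reflection_reflection]
  have hdiff : ∀ i j, long i → ¬ long j → P.pairingIn ℤ i j = 2 * P.pairingIn ℤ j i := by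
    intro i j hi hj
    have hj' := (hlen j).resolve_left hj
    have := B.pairing_mul_eq_pairing_mul_swap i j
    rw [show _ = _ from hi, hj', hB, hcast, hcast] at this
    have : (P.pairingIn ℤ i j : K) = ((2 * P.pairingIn ℤ j i : ℤ) : K) := by
      apply mul_right_cancel₀ hj0
      rw [← this]
      push_cast
      ring
    exact_mod_cast this
  have hn : finrank K N = finrank K M := by
    have e := (LinearEquiv.finrank_eq P.flip.toPerfPair)
    rw [e, Subspace.dual_finrank_eq]
  have : FiniteDimensional K N := P.flip.toPerfPair.symm.finiteDimensional
  obtain ⟨p, hp, hp1, hp2⟩ := P.card_long long hinv hdiff j₀ hne.symm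
  obtain ⟨q, hq, hq1, hq2⟩ := P.flip.card_long (fun i ↦ ¬ long i)
    (fun i j ↦ not_congr (hinv i j))
    (fun i j hi hj ↦ by
      rw [pairingIn_flip_int, pairingIn_flip_int]
      exact hdiff j i (not_not.mp hj) hi) i₀ (fun h ↦ h rfl)
  rw [hn] at hq1 hq2
  have hcard := Finset.card_filter_add_card_filter_not (s := (Finset.univ : Finset ι)) long
  rw [hp1, hq1, Finset.card_univ] at hcard
  have h3 : finrank K M * (1 + p + q) = 248 := by
    rw [← h248, ← hcard]; ring
  set r := finrank K M
  have hodd : Odd (1 + p + q) := by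
    obtain ⟨a, rfl⟩ := hp
    obtain ⟨b, rfl⟩ := hq
    exact ⟨a + b, by ring⟩
  have hdvd : 1 + p + q ∣ 31 := by
    have h5 : 1 + p + q ∣ 8 * 31 := ⟨r, by rw [mul_comm _ r, h3]⟩
    refine Nat.Coprime.dvd_of_dvd_mul_left ?_ h5
    rw [show (8 : ℕ) = 2 ^ 3 by norm_num]
    exact (Nat.coprime_pow_right_iff (by norm_num) _ _).mpr hodd.coprime_two_right
  rcases (Nat.dvd_prime (by norm_num : Nat.Prime 31)).mp hdvd with h | h
  · have hcard0 : Fintype.card ι = 0 := by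
      rw [← hcard, show p = 0 by omega, show q = 0 by omega]
      simp
    exact (Fintype.card_eq_zero_iff.mp hcard0).elim i₀
  · rw [h] at h3
    omega

lemma pairingIn_symm_of_card [P.IsRootSystem]
    (h248 : finrank K M + Fintype.card ι = 248) (i j : ι) :
    P.pairingIn ℤ i j = P.pairingIn ℤ j i := by
  classical
  have hno3 : ∀ i j, P.pairingIn ℤ i j ≠ -3 := by
    intro i j h
    let _ : P.EmbeddedG2 := ⟨i, j, h⟩
    have := EmbeddedG2.card_index_eq_twelve P
    rw [Nat.card_eq_fintype_card] at this
    have := P.finrank_le_card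
    omega
  have hno3' : ∀ i j, P.pairingIn ℤ i j ≠ 3 := by
    intro i j h
    apply hno3 (P.reflectionPerm i i) j
    simp [h]
  have htab := P.pairingIn_pairingIn_mem_set_of_isCrystal_of_isRed i j
  simp only [Set.mem_insert_iff, Set.mem_singleton_iff, Prod.mk.injEq] at htab
  have h1 := hno3 i j
  have h2 := hno3 j i
  have h3 := hno3' i j
  have h4 := hno3' j i
  by_contra hne
  by_cases h5 : P.pairingIn ℤ i j = 2 * P.pairingIn ℤ j i
  · exact P.not_doubly_laced h248 i j (by omega) h5
  · exact P.not_doubly_laced h248 j i (by omega) (by omega)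

lemma pairingIn_cases (hA : ∀ i j, P.pairingIn ℤ i j = P.pairingIn ℤ j i) (i j : ι) :
    P.pairingIn ℤ i j = 0 ∨ P.pairingIn ℤ i j = 1 ∨ P.pairingIn ℤ i j = -1 ∨
    (P.pairingIn ℤ i j = 2 ∧ i = j) ∨ (P.pairingIn ℤ i j = -2 ∧ i = P.reflectionPerm j j) := by
  have htab := P.pairingIn_pairingIn_mem_set_of_isCrystal_of_isRed i j
  simp only [Set.mem_insert_iff, Set.mem_singleton_iff, Prod.mk.injEq] at htab
  have := hA i j
  have h1 : P.pairingIn ℤ i j = 2 → i = j := fun h ↦ by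
    have : Module.IsReflexive K M := .of_isPerfPair P.toLinearMap
    exact (P.pairingIn_two_two_iff ℤ i j).mp ⟨h, by omega⟩
  have h2 : P.pairingIn ℤ i j = -2 → i = P.reflectionPerm j j := fun h ↦ by
    have : Module.IsReflexive K M := .of_isPerfPair P.toLinearMap
    apply P.root.injective
    rw [root_reflectionPerm_self]
    exact (P.pairingIn_neg_two_neg_two_iff ℤ i j).mp ⟨h, by omega⟩
  have h3 : P.pairingIn ℤ i j = 0 ∨ P.pairingIn ℤ i j = 1 ∨ P.pairingIn ℤ i j = -1 ∨
    P.pairingIn ℤ i j = 2 ∨ P.pairingIn ℤ i j = -2 := by omega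
  tauto

lemma card_pairingIn_eq_one (hA : ∀ i j, P.pairingIn ℤ i j = P.pairingIn ℤ j i) (i : ι) :
    2 * Fintype.card ι =
      finrank K M * (4 + (Finset.univ.filter fun j ↦ P.pairingIn ℤ j i = 1).card) ∧
    Even (Finset.univ.filter fun j ↦ P.pairingIn ℤ j i = 1).card := by
  have hT : ∀ i j : ι, (fun _ ↦ True : ι → Prop) (P.reflectionPerm i j) ↔
      (fun _ ↦ True : ι → Prop) j := fun _ _ ↦ Iff.rfl
  constructor
  · have h1 := P.finrank_mul_sum_pairingIn (fun _ ↦ True) hT i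
    have h3 := P.card_filter_neg (fun _ ↦ True) hT i 1
    simp only [Finset.filter_true, Finset.card_univ, true_and] at h1 h3
    have h2 : ∑ j, P.pairingIn ℤ i j * P.pairingIn ℤ j i =
        8 + 2 * (Finset.univ.filter fun j ↦ P.pairingIn ℤ j i = 1).card := by
      have : ∀ j, P.pairingIn ℤ i j * P.pairingIn ℤ j i =
          4 * (if j = i then 1 else 0) + 4 * (if j = P.reflectionPerm i i then 1 else 0) +
          (if P.pairingIn ℤ j i = 1 then 1 else 0) + (if P.pairingIn ℤ j i = -1 then 1 else 0) := by
        intro j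
        have h0 := P.reflectionPerm_self_ne i
        have h4 : j = i → P.pairingIn ℤ j i = 2 := by rintro rfl; simp
        have h5 : j = P.reflectionPerm i i → P.pairingIn ℤ j i = -2 := by rintro rfl; simp
        rw [hA i j]
        rcases P.pairingIn_cases hA j i with h | h | h | ⟨h, h'⟩ | ⟨h, h'⟩
        · rw [h, if_neg (fun hh ↦ by have := h4 hh; omega),
            if_neg (fun hh ↦ by have := h5 hh; omega)]; norm_num
        · rw [h, if_neg (fun hh ↦ by have := h4 hh; omega),
            if_neg (fun hh ↦ by have := h5 hh; omega)]; norm_num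
        · rw [h, if_neg (fun hh ↦ by have := h4 hh; omega),
            if_neg (fun hh ↦ by have := h5 hh; omega)]; norm_num
        · rw [h, if_pos h', if_neg (fun hh ↦ by have := h5 hh; omega)]; norm_num
        · rw [h, if_pos h', if_neg (fun hh ↦ by have := h4 hh; omega)]; norm_num
      rw [Finset.sum_congr rfl fun j _ ↦ this j, Finset.sum_add_distrib, Finset.sum_add_distrib,
        Finset.sum_add_distrib, ← Finset.mul_sum, ← Finset.mul_sum,
        Finset.sum_boole, Finset.sum_boole, Finset.sum_boole, Finset.sum_boole, h3]
      simp only [Finset.filter_eq', Finset.mem_univ, if_true, Finset.card_singleton]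
      push_cast
      ring
    rw [h2] at h1
    have : ((2 * Fintype.card ι : ℕ) : ℤ) = ((finrank K M *
      (4 + (Finset.univ.filter fun j ↦ P.pairingIn ℤ j i = 1).card) : ℕ) : ℤ) := by
      push_cast
      linarith
    exact_mod_cast this
  · have := P.even_card_filter (fun _ ↦ True) hT i 1 (by norm_num)
      (by rintro j - h rfl; simp at h)
    simpa using this

lemma even_card (P : RootPairing ι K M N) [P.IsCrystallographic] [P.IsReduced]
    [P.IsIrreducible] : Even (Fintype.card ι) :=
  even_card_of_involution Finset.univ (fun i ↦ P.reflectionPerm i i) (fun _ _ ↦ Finset.mem_univ _)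
    (fun i _ ↦ P.reflectionPerm_self_self i) (fun i _ ↦ P.reflectionPerm_self_ne i)

/-- A root is determined by its pairings with a basis consisting of roots. -/
lemma card_le_three_pow [P.IsRootSystem] (hA : ∀ i j, P.pairingIn ℤ i j = P.pairingIn ℤ j i) :
    Fintype.card ι ≤ 3 ^ finrank K M + 2 * finrank K M := by
  classical
  obtain ⟨b, hb, hspan, hli⟩ := exists_linearIndependent K (Set.range P.root)
  rw [IsRootSystem.span_root_eq_top (P := P)] at hspan
  have hbfin : b.Finite := (Set.finite_range _).subset hb
  let B : Finset ι := Finset.univ.filter fun i ↦ P.root i ∈ b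
  have hBcard : B.card = finrank K M := by
    have h1 : (B.map ⟨P.root, P.root.injective⟩ : Set M) = b := by
      ext x
      simp only [B, Finset.coe_map, Set.mem_image, Finset.coe_filter, Finset.mem_univ, true_and,
        Set.mem_ofPred_eq, Function.Embedding.coeFn_mk]
      constructor
      · rintro ⟨i, hi, rfl⟩; exact hi
      · intro hx
        obtain ⟨i, rfl⟩ := hb hx
        exact ⟨i, hx, rfl⟩
    have : Fintype b := hbfin.fintype
    have h2 := finrank_span_set_eq_card (R := K) (s := b) hli
    rw [hspan, finrank_top] at h2
    rw [h2, ← Finset.card_map ⟨P.root, P.root.injective⟩]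
    congr 1
    ext x
    rw [← Finset.mem_coe, h1]
    simp
  let C := B ∪ B.image fun i ↦ P.reflectionPerm i i
  have hC : C.card ≤ 2 * finrank K M := by
    refine (Finset.card_union_le _ _).trans ?_
    have := Finset.card_image_le (s := B) (f := fun i ↦ P.reflectionPerm i i)
    omega
  have hD : (Finset.univ \ C).card ≤ 3 ^ finrank K M := by
    have : 3 ^ finrank K M = (Fintype.piFinset fun _ : B ↦ ({-1, 0, 1} : Finset ℤ)).card := by
      rw [Fintype.card_piFinset]
      simp [hBcard]
    rw [this]
    refine Finset.card_le_card_of_injOn (fun i j ↦ P.pairingIn ℤ i j) ?_ ?_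
    · intro i hi
      simp only [Finset.coe_sdiff, Set.mem_sdiff, Finset.mem_coe, C, Finset.mem_union,
        Finset.mem_image, not_or, not_exists, not_and] at hi
      simp only [Finset.mem_coe, Fintype.mem_piFinset]
      intro j
      have h1 := hi.2.1
      have h2 := hi.2.2 j j.2
      rcases P.pairingIn_cases hA i j with h | h | h | ⟨h, h'⟩ | ⟨h, h'⟩
      · simp [h]
      · simp [h]
      · simp [h]
      · exact absurd (h' ▸ j.2) h1
      · exact absurd h'.symm h2
    · intro i _ i' _ h
      apply P.coroot.injective
      apply P.flip.toPerfPair.injective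
      apply LinearMap.ext_on hspan
      intro x hx
      obtain ⟨j, rfl⟩ := hb hx
      have := congrFun h ⟨j, by simpa [B] using hx⟩
      simp only [] at this
      rw [hA i j, hA i' j] at this
      have h2 : P.pairing j i = P.pairing j i' := by
        rw [← P.algebraMap_pairingIn ℤ, ← P.algebraMap_pairingIn ℤ, this]
      exact h2
  have := Finset.card_sdiff_add_card_eq_card (Finset.subset_univ C)
  rw [Finset.card_univ] at this
  omega

/-- If every root has exactly two neighbours at angle `π / 3`, the rank is at most two. -/
lemma finrank_le_two (hA : ∀ i j, P.pairingIn ℤ i j = P.pairingIn ℤ j i) (i : ι)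
    (h : ∀ i, (Finset.univ.filter fun j ↦ P.pairingIn ℤ j i = 1).card = 2) :
    finrank K M ≤ 2 := by
  have hnb : ∀ i j, P.pairingIn ℤ j i = 1 → ∀ k, P.pairingIn ℤ k i = 1 →
      P.root k = P.root j ∨ P.root k = P.root i - P.root j := by
    intro i j hj k hk
    let j' := P.reflectionPerm i (P.reflectionPerm j j)
    have hroot : P.root j' = P.root i - P.root j := by
      rw [root_reflectionPerm_eq, root_reflectionPerm_self,
        P.pairingIn_reflectionPerm_self_left, hj]
      push_cast
      module
    have hj' : P.pairingIn ℤ j' i = 1 := by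
      rw [pairingIn_reflectionPerm_left, P.pairingIn_reflectionPerm_self_left, hj, P.pairingIn_same]
      norm_num
    have hne : j ≠ j' := by
      intro hh
      have h2 := P.pairingIn_same ℤ j
      have h3 : P.pairingIn ℤ j j' = -1 := by
        rw [pairingIn_reflectionPerm_right, P.pairingIn_reflectionPerm_self_right,
          P.pairingIn_reflectionPerm_self_right, P.pairingIn_same, hj, hA i j, hj]
        norm_num
      rw [← hh] at h3
      omega
    have h4 : ({j, j'} : Finset ι) = Finset.univ.filter fun j ↦ P.pairingIn ℤ j i = 1 := by
      apply Finset.eq_of_subset_of_card_le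
      · intro x hx
        simp only [Finset.mem_insert, Finset.mem_singleton] at hx
        rcases hx with rfl | rfl <;> simpa
      · rw [h i, Finset.card_pair hne]
    have h5 : k ∈ ({j, j'} : Finset ι) := by rw [h4]; simpa
    simp only [Finset.mem_insert, Finset.mem_singleton] at h5
    rcases h5 with rfl | rfl
    · exact .inl rfl
    · exact .inr hroot
  have hne : (Finset.univ.filter fun j ↦ P.pairingIn ℤ j i = 1).Nonempty := by
    rw [← Finset.card_pos, h i]; norm_num
  obtain ⟨j, hj⟩ := hne
  simp only [Finset.mem_filter, Finset.mem_univ, true_and] at hj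
  have hspan := P.span_root_image_eq_top_of_forall_orthogonal {i, j} ⟨i, by simp⟩ ?_
  · classical
    have := finrank_span_finset_le_card (R := K) ({P.root i, P.root j} : Finset M)
    rw [Finset.coe_pair, ← Set.image_pair, Set.finrank, hspan, finrank_top] at this
    exact this.trans Finset.card_le_two
  · intro k hk
    set V := Submodule.span K (P.root '' {i, j}) with hV
    have hi' : P.root i ∈ V := Submodule.subset_span ⟨i, by simp, rfl⟩
    have hj' : P.root j ∈ V := Submodule.subset_span ⟨j, by simp, rfl⟩
    have key : ∀ a b, P.root a ∈ V → P.root b ∈ V → P.pairingIn ℤ b a = 1 →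
        P.pairingIn ℤ k a = 0 := by
      intro a b ha hb hab
      by_contra h0
      apply hk
      rcases P.pairingIn_cases hA k a with h | h | h | ⟨h, rfl⟩ | ⟨h, h'⟩
      · exact absurd h h0
      · rcases hnb a b hab k h with h | h <;> rw [h]
        · exact hb
        · exact sub_mem ha hb
      · have h1 : P.pairingIn ℤ (P.reflectionPerm k k) a = 1 := by simp [h]
        have h2 := hnb a b hab _ h1
        rw [root_reflectionPerm_self] at h2
        rw [← Submodule.neg_mem_iff]
        rcases h2 with h | h <;> rw [h]
        · exact hb
        · exact sub_mem ha hb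
      · exact ha
      · rw [h', root_reflectionPerm_self]
        exact neg_mem ha
    have hor : ∀ a, P.pairingIn ℤ k a = 0 → P.IsOrthogonal k a := by
      intro a h
      constructor
      · rw [← P.algebraMap_pairingIn ℤ, h, map_zero]
      · rw [← P.algebraMap_pairingIn ℤ, hA, h, map_zero]
    intro a ha
    simp only [Set.mem_insert_iff, Set.mem_singleton_iff] at ha
    apply hor
    rcases ha with rfl | rfl
    · exact key a j hi' hj' hj
    · exact key a i hj' hi' (by rw [hA, hj])

/-- An irreducible reduced crystallographic root system with `|Φ| + rank = 248` is
numerically that of `E₈`. -/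
theorem numerics_of_card [P.IsRootSystem] (h248 : finrank K M + Fintype.card ι = 248) :
    finrank K M = 8 ∧ Fintype.card ι = 240 ∧
      ∀ i k, ∑ j, P.pairingIn ℤ i j * P.pairingIn ℤ j k = 60 * P.pairingIn ℤ i k := by
  have hA := P.pairingIn_symm_of_card h248
  have hrN := P.finrank_le_card
  have hne : Nonempty ι := Fintype.card_pos_iff.mp (by omega)
  obtain ⟨i⟩ := hne
  have hr : finrank K M = 8 := by
    obtain ⟨m, hm⟩ := (P.card_pairingIn_eq_one hA i).2
    have h1 := (P.card_pairingIn_eq_one hA i).1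
    rw [hm] at h1
    set r := finrank K M with hr
    have h2 : r * (3 + m) = 248 := by
      rw [← h248]
      have : 2 * Fintype.card ι = 2 * (r * (2 + m)) := by rw [h1]; ring
      have := Nat.eq_of_mul_eq_mul_left (by norm_num) this
      rw [this]; ring
    have hdvd : r ∈ Nat.divisors 248 := Nat.mem_divisors.mpr ⟨⟨_, h2.symm⟩, by norm_num⟩
    have hdiv : Nat.divisors 248 = {1, 2, 4, 8, 31, 62, 124, 248} := by decide +kernel
    rw [hdiv] at hdvd
    simp only [Finset.mem_insert, Finset.mem_singleton] at hdvd
    obtain ⟨n, hn⟩ := P.even_card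
    have h3 := P.card_le_three_pow hA
    rw [← hr] at h3
    rcases hdvd with h | h | h | h | h | h | h | h
    · omega
    · rw [h] at h3 h248; omega
    · rw [h] at h3 h248; omega
    · exact h
    · omega
    · exfalso
      have : finrank K M ≤ 2 := P.finrank_le_two hA i fun k ↦ by
        have h4 := (P.card_pairingIn_eq_one hA k).1
        rw [← hr, h] at h4
        omega
      omega
    · rw [h] at h2; omega
    · rw [h] at h2; omega
  refine ⟨hr, by omega, fun i k ↦ ?_⟩
  obtain ⟨μ, h1, h2⟩ := P.exists_sum_pairing_eq (fun _ ↦ (1 : K)) (fun _ _ ↦ rfl)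
  rw [hr, Finset.sum_const, Finset.card_univ, show Fintype.card ι = 240 by omega] at h2
  have hμ : μ = 60 := by
    norm_num at h2
    linear_combination (-1 / 8 : K) * h2
  have := h1 i k
  simp only [one_mul, hμ, ← P.algebraMap_pairingIn ℤ] at this
  rw [← Int.cast_inj (α := K)]
  simpa using this

end Classification

end RootPairing

/-- The numerical properties of the matrix of pairings of the root system `E₈`. -/
structure IsE8Matrix {ι : Type*} [Fintype ι] (A : ι → ι → ℤ) : Prop where
  symm : ∀ i j, A i j = A j i
  diag : ∀ i, A i i = 2
  inj : ∀ i j, A i j = 2 → i = j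
  refl : ∀ i j, ∃ l, ∀ k, A l k = A i k - A i j * A j k
  design : ∀ i j, ∑ k, A i k * A k j = 60 * A i j
  card : Fintype.card ι = 240

namespace IsE8Matrix

variable {ι : Type*} [Fintype ι] {A : ι → ι → ℤ}

lemma sum_sq (hA : IsE8Matrix A) {σ : Type*} [Fintype σ] (n : σ → ℤ) (i : σ → ι) :
    ∑ k, (∑ a, n a * A (i a) k) ^ 2 = 60 * ∑ a, ∑ b, n a * n b * A (i a) (i b) := by
  have h : ∀ a b, n a * n b * (60 * A (i a) (i b)) =
      ∑ k, (n a * A (i a) k) * (n b * A (i b) k) := by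
    intro a b
    rw [← hA.design, Finset.mul_sum]
    refine Finset.sum_congr rfl fun k _ ↦ ?_
    rw [hA.symm k (i b)]
    ring
  have h2 : 60 * ∑ a, ∑ b, n a * n b * A (i a) (i b) =
      ∑ a, ∑ b, n a * n b * (60 * A (i a) (i b)) := by
    simp only [Finset.mul_sum]
    exact Finset.sum_congr rfl fun a _ ↦ Finset.sum_congr rfl fun b _ ↦ by ring
  rw [h2]
  simp_rw [h, sq, Finset.sum_mul_sum]
  rw [Finset.sum_comm]
  refine Finset.sum_congr rfl fun a _ ↦ ?_
  rw [Finset.sum_comm]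

lemma form_nonneg (hA : IsE8Matrix A) {σ : Type*} [Fintype σ] (n : σ → ℤ) (i : σ → ι) :
    0 ≤ ∑ a, ∑ b, n a * n b * A (i a) (i b) := by
  have h := hA.sum_sq n i
  have h2 : 0 ≤ ∑ k, (∑ a, n a * A (i a) k) ^ 2 := Finset.sum_nonneg fun k _ ↦ sq_nonneg _
  omega

lemma eq_zero_of_form_eq_zero (hA : IsE8Matrix A) {σ : Type*} [Fintype σ] (n : σ → ℤ) (i : σ → ι)
    (h0 : ∑ a, ∑ b, n a * n b * A (i a) (i b) = 0) (k : ι) : ∑ a, n a * A (i a) k = 0 := by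
  have h := hA.sum_sq n i
  rw [h0, mul_zero, Finset.sum_eq_zero_iff_of_nonneg fun k _ ↦ sq_nonneg _] at h
  exact pow_eq_zero_iff two_ne_zero |>.mp (h k (Finset.mem_univ k))

lemma le_two (hA : IsE8Matrix A) (i j : ι) : A i j ≤ 2 := by
  have := hA.form_nonneg ![1, -1] ![i, j]
  simp [Fin.sum_univ_two, hA.diag, hA.symm j i] at this
  omega

lemma neg_two_le (hA : IsE8Matrix A) (i j : ι) : -2 ≤ A i j := by
  have := hA.form_nonneg ![1, 1] ![i, j]
  simp [Fin.sum_univ_two, hA.diag, hA.symm j i] at this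
  omega

lemma ext_left (hA : IsE8Matrix A) {i j : ι} (h : ∀ k, A i k = A j k) : i = j :=
  hA.inj i j (by rw [h, hA.diag])

lemma exists_neg (hA : IsE8Matrix A) (i : ι) : ∃ l, ∀ k, A l k = -A i k := by
  obtain ⟨l, hl⟩ := hA.refl i i
  refine ⟨l, fun k ↦ ?_⟩
  rw [hl, hA.diag]
  ring

lemma exists_add (hA : IsE8Matrix A) {i j : ι} (h : A i j = -1) :
    ∃ l, ∀ k, A l k = A i k + A j k := by
  obtain ⟨l, hl⟩ := hA.refl i j
  refine ⟨l, fun k ↦ ?_⟩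
  rw [hl, h]
  ring

lemma exists_sub (hA : IsE8Matrix A) {i j : ι} (h : A i j = 1) :
    ∃ l, ∀ k, A l k = A i k - A j k := by
  obtain ⟨l, hl⟩ := hA.refl i j
  refine ⟨l, fun k ↦ ?_⟩
  rw [hl, h]
  ring

lemma eq_neg_of_eq_neg_two (hA : IsE8Matrix A) {i j : ι} (h : A i j = -2) (k : ι) :
    A i k = -A j k := by
  obtain ⟨l, hl⟩ := hA.exists_neg j
  have : i = l := hA.inj i l (by rw [hA.symm, hl, hA.symm, h]; norm_num)
  rw [this, hl]

end IsE8Matrix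

namespace IsE8Matrix

variable {ι : Type*} [Fintype ι] {A : ι → ι → ℤ}

lemma card_neg_one (hA : IsE8Matrix A) (j : ι) :
    (Finset.univ.filter fun k ↦ A k j = -1).card = 56 := by
  classical
  choose neg hneg using hA.exists_neg
  have hnn : ∀ i, neg (neg i) = i := fun i ↦ hA.ext_left fun k ↦ by simp [hneg]
  have h1 : (Finset.univ.filter fun k ↦ A k j = 1).card =
      (Finset.univ.filter fun k ↦ A k j = -1).card := by
    refine Finset.card_bij' (fun k _ ↦ neg k) (fun k _ ↦ neg k) ?_ ?_ ?_ ?_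
    · intro k hk; simp at hk; simp [hneg, hk]
    · intro k hk; simp at hk; simp [hneg, hk]
    · intro k _; exact hnn k
    · intro k _; exact hnn k
  have h2 : ∀ k, A j k * A k j = 4 * (if k = j then 1 else 0) + 4 * (if k = neg j then 1 else 0) +
      (if A k j = 1 then 1 else 0) + (if A k j = -1 then 1 else 0) := by
    intro k
    have a1 := hA.le_two k j
    have a2 := hA.neg_two_le k j
    have a3 : A k j = 2 → k = j := hA.inj k j
    have a4 : k = j → A k j = 2 := by rintro rfl; exact hA.diag k
    have a5 : A k j = -2 → k = neg j := fun h ↦ hA.inj _ _ (by rw [hA.symm, hneg, hA.symm, h]; rfl)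
    have a6 : k = neg j → A k j = -2 := by rintro rfl; rw [hneg, hA.diag]
    rw [hA.symm j k]
    have a7 : A k j = -2 ∨ A k j = -1 ∨ A k j = 0 ∨ A k j = 1 ∨ A k j = 2 := by omega
    rcases a7 with h | h | h | h | h <;>
      simp only [h] at a3 a4 a5 a6 ⊢ <;> norm_num at a3 a4 a5 a6 ⊢
    · have : neg j ≠ j := fun h ↦ by have := hneg j j; rw [h, hA.diag] at this; omega
      simp [a5, this]
    · simp [a4, a6]
    · simp [a4, a6]
    · simp [a4, a6]
    · have : j ≠ neg j := fun h ↦ by have := hneg j j; rw [← h, hA.diag] at this; omega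
      simp [a3, this]
  have h3 := hA.design j j
  rw [Finset.sum_congr rfl fun k _ ↦ h2 k, Finset.sum_add_distrib, Finset.sum_add_distrib,
    Finset.sum_add_distrib, ← Finset.mul_sum, ← Finset.mul_sum, Finset.sum_boole, Finset.sum_boole,
    Finset.sum_boole, Finset.sum_boole, h1, hA.diag] at h3
  have h4 : ∀ i : ι, (Finset.univ.filter fun k ↦ k = i).card = 1 := fun i ↦
    Finset.card_eq_one.mpr ⟨i, by ext; simp⟩
  rw [h4, h4] at h3
  push_cast at h3
  omega

/-- A chain of four roots with Dynkin diagram `A₄`. -/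
structure IsChain (A : ι → ι → ℤ) (b₀ b₁ b₂ b₃ : ι) : Prop where
  h01 : A b₀ b₁ = -1
  h02 : A b₀ b₂ = 0
  h03 : A b₀ b₃ = 0
  h12 : A b₁ b₂ = -1
  h13 : A b₁ b₃ = 0
  h23 : A b₂ b₃ = -1

lemma exists_chain (hA : IsE8Matrix A) : ∃ b₀ b₁ b₂ b₃, IsChain A b₀ b₁ b₂ b₃ := by
  classical
  obtain ⟨b₀⟩ : Nonempty ι := Fintype.card_pos_iff.mp (by rw [hA.card]; norm_num)
  obtain ⟨b₁, hb₁⟩ : (Finset.univ.filter fun k ↦ A k b₀ = -1).Nonempty := by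
    rw [← Finset.card_pos, hA.card_neg_one]; norm_num
  simp only [Finset.mem_filter, Finset.mem_univ, true_and] at hb₁
  have hb₁' : A b₀ b₁ = -1 := by rw [hA.symm, hb₁]
  have hf : ∀ x, ∃ y, A x b₁ = -1 → ∀ k, A y k = -(A x k + A b₁ k) := by
    intro x
    by_cases h : A x b₁ = -1
    · obtain ⟨z, hz⟩ := hA.exists_add h
      obtain ⟨y, hy⟩ := hA.exists_neg z
      exact ⟨y, fun _ k ↦ by rw [hy, hz]⟩
    · exact ⟨x, fun h' ↦ absurd h' h⟩
  choose f hf using hf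
  have hinj : ∀ x y, A x b₁ = -1 → A y b₁ = -1 → f x = f y → x = y := by
    intro x y hx hy h
    refine hA.ext_left fun k ↦ ?_
    have h1 := hf x hx k
    have h2 := hf y hy k
    rw [h] at h1
    omega
  let X := Finset.univ.filter fun k ↦ A k b₁ = -1 ∧ A k b₀ = 0
  let X' := Finset.univ.filter fun k ↦ A k b₁ = -1 ∧ A k b₀ = 1
  have hX' : X'.card ≤ X.card := by
    refine Finset.card_le_card_of_injOn f ?_ ?_
    · intro x hx
      simp only [X', Finset.coe_filter, Finset.mem_univ, true_and, Set.mem_ofPred_eq] at hx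
      simp only [X, Finset.coe_filter, Finset.mem_univ, true_and, Set.mem_ofPred_eq]
      rw [hf x hx.1, hf x hx.1, hx.1, hx.2, hA.diag, hb₁]
      norm_num
    · intro x hx y hy h
      simp only [X', Finset.coe_filter, Finset.mem_univ, true_and, Set.mem_ofPred_eq] at hx hy
      exact hinj x y hx.1 hy.1 h
  have hsub : (Finset.univ.filter fun k ↦ A k b₁ = -1) ⊆ X ∪ X' ∪ {b₀, f b₀} := by
    intro x hx
    simp only [Finset.mem_filter, Finset.mem_univ, true_and] at hx
    have a1 := hA.le_two x b₀
    have a2 := hA.neg_two_le x b₀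
    have a7 : A x b₀ = -2 ∨ A x b₀ = -1 ∨ A x b₀ = 0 ∨ A x b₀ = 1 ∨ A x b₀ = 2 := by omega
    rcases a7 with h | h | h | h | h
    · have := hA.eq_neg_of_eq_neg_two h b₁
      omega
    · have h0 := hA.eq_zero_of_form_eq_zero ![1, 1, 1] ![x, b₀, b₁] (by
        simp [Fin.sum_univ_three, hA.diag, h, hx, hb₁, hb₁', hA.symm b₀ x, hA.symm b₁ x])
      simp [Fin.sum_univ_three] at h0
      have : x = f b₀ := hA.ext_left fun k ↦ by rw [hf b₀ hb₁']; linarith [h0 k]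
      simp [this]
    · simp [X, hx, h]
    · simp [X', hx, h]
    · simp [hA.inj _ _ h]
  have hX : 4 ≤ X.card := by
    have h1 := Finset.card_le_card hsub
    rw [hA.card_neg_one] at h1
    have h2 := Finset.card_union_le (X ∪ X') {b₀, f b₀}
    have h3 := Finset.card_union_le X X'
    have h4 : ({b₀, f b₀} : Finset ι).card ≤ 2 := Finset.card_le_two
    omega
  obtain ⟨g⟩ := Function.Embedding.nonempty_of_card_le (α := Fin 4) (β := X) (by simpa using hX)
  have hg : ∀ a, A (g a) b₁ = -1 ∧ A (g a) b₀ = 0 := fun a ↦ by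
    have := (g a).2
    simpa only [X, Finset.mem_filter, Finset.mem_univ, true_and] using this
  obtain ⟨a, b, hab⟩ : ∃ a b, A (g a) (g b) = 1 := by
    by_contra! hcon
    have hle : ∀ a b, a ≠ b → A (g a) (g b) ≤ 0 := by
      intro a b hne
      have h1 := hA.le_two (g a) (g b)
      have h2 := hcon a b
      have h3 : A (g a) (g b) ≠ 2 := fun h ↦ hne (g.injective (Subtype.ext (hA.inj _ _ h)))
      omega
    have hpos := hA.form_nonneg ![2, 1, 1, 1, 1, 1] ![b₁, b₀, g 0, g 1, g 2, g 3]
    have h0 := fun a ↦ (hg a).1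
    have h1 := fun a ↦ (hg a).2
    have h0' := fun a ↦ (hA.symm b₁ (g a)).trans (h0 a)
    have h1' := fun a ↦ (hA.symm b₀ (g a)).trans (h1 a)
    simp [Fin.sum_univ_succ, hA.diag, h0, h1, h0', h1', hb₁, hb₁'] at hpos
    have := hle 0 1 (by decide)
    have := hle 0 2 (by decide)
    have := hle 0 3 (by decide)
    have := hle 1 2 (by decide)
    have := hle 1 3 (by decide)
    have := hle 2 3 (by decide)
    have := hle 1 0 (by decide)
    have := hle 2 0 (by decide)
    have := hle 3 0 (by decide)
    have := hle 2 1 (by decide)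
    have := hle 3 1 (by decide)
    have := hle 3 2 (by decide)
    linarith
  obtain ⟨b₃, hb₃⟩ := hA.exists_sub (i := g b) (j := g a) (by rw [hA.symm, hab])
  refine ⟨b₀, b₁, g a, b₃, hb₁', ?_, ?_, ?_, ?_, ?_⟩
  · rw [hA.symm, (hg a).2]
  · rw [hA.symm, hb₃, (hg a).2, (hg b).2]; rfl
  · rw [hA.symm, (hg a).1]
  · rw [hA.symm, hb₃, (hg a).1, (hg b).1]; rfl
  · rw [hA.symm, hb₃, hA.diag, hA.symm, hab]; rfl

end IsE8Matrix

namespace IsE8Matrix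

/-- The box containing the possible pairings of a root with a chain of type `A₄`. -/
def chainBox : Finset (ℤ × ℤ × ℤ × ℤ) :=
  {-2, -1, 0, 1, 2} ×ˢ {-2, -1, 0, 1, 2} ×ˢ {-2, -1, 0, 1, 2} ×ˢ {-2, -1, 0, 1, 2}

/-- Five times the squared length of the projection to the span of a chain of type `A₄`. -/
def chainForm (d : ℤ × ℤ × ℤ × ℤ) : ℤ :=
  4 * d.1 ^ 2 + 6 * d.2.1 ^ 2 + 6 * d.2.2.1 ^ 2 + 4 * d.2.2.2 ^ 2 + 6 * (d.1 * d.2.1) +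
    4 * (d.1 * d.2.2.1) + 2 * (d.1 * d.2.2.2) + 8 * (d.2.1 * d.2.2.1) + 4 * (d.2.1 * d.2.2.2) +
    6 * (d.2.2.1 * d.2.2.2)

/-- Invariance under the Weyl group of type `A₄` and negation. -/
structure WeylInvariant (n : ℤ × ℤ × ℤ × ℤ → ℕ) : Prop where
  refl0 : ∀ a b c e, n (-a, b + a, c, e) = n (a, b, c, e)
  refl1 : ∀ a b c e, n (a + b, -b, c + b, e) = n (a, b, c, e)
  refl2 : ∀ a b c e, n (a, b + c, -c, e + c) = n (a, b, c, e)
  refl3 : ∀ a b c e, n (a, b, c + e, -e) = n (a, b, c, e)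
  neg : ∀ a b c e, n (-a, -b, -c, -e) = n (a, b, c, e)

lemma eq_of_chainForm_eq_six {n : ℤ × ℤ × ℤ × ℤ → ℕ} (hn : WeylInvariant n) (d : ℤ × ℤ × ℤ × ℤ)
    (hd : d ∈ chainBox) (hf : chainForm d = 6) : n d = n (0, -1, 0, 0) := by
  have e0 : n (-1, 1, -1, 0) = n (0, -1, 0, 0) := by
    simpa using hn.refl1 0 (-1) 0 0
  have e1 : n (0, 1, 0, 0) = n (0, -1, 0, 0) := by
    simpa using hn.neg 0 (-1) 0 0
  have e2 : n (1, 0, -1, 0) = n (0, -1, 0, 0) := by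
    simpa [e0] using hn.refl0 (-1) 1 (-1) 0
  have e3 : n (-1, 0, 1, -1) = n (0, -1, 0, 0) := by
    simpa [e0] using hn.refl2 (-1) 1 (-1) 0
  have e4 : n (1, -1, 1, 0) = n (0, -1, 0, 0) := by
    simpa [e0] using hn.neg (-1) 1 (-1) 0
  have e5 : n (1, -1, 1, -1) = n (0, -1, 0, 0) := by
    simpa [e2] using hn.refl2 1 0 (-1) 0
  have e6 : n (-1, 0, 1, 0) = n (0, -1, 0, 0) := by
    simpa [e2] using hn.neg 1 0 (-1) 0
  have e7 : n (-1, 0, 0, 1) = n (0, -1, 0, 0) := by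
    simpa [e3] using hn.refl3 (-1) 0 1 (-1)
  have e8 : n (1, 0, -1, 1) = n (0, -1, 0, 0) := by
    simpa [e3] using hn.neg (-1) 0 1 (-1)
  have e9 : n (0, 1, 0, -1) = n (0, -1, 0, 0) := by
    simpa [e5] using hn.refl1 1 (-1) 1 (-1)
  have e10 : n (1, -1, 0, 1) = n (0, -1, 0, 0) := by
    simpa [e5] using hn.refl3 1 (-1) 1 (-1)
  have e11 : n (-1, 1, -1, 1) = n (0, -1, 0, 0) := by
    simpa [e5] using hn.neg 1 (-1) 1 (-1)
  have e12 : n (1, 0, 0, -1) = n (0, -1, 0, 0) := by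
    simpa [e7] using hn.neg (-1) 0 0 1
  have e13 : n (0, 1, -1, 1) = n (0, -1, 0, 0) := by
    simpa [e9] using hn.refl3 0 1 0 (-1)
  have e14 : n (0, -1, 0, 1) = n (0, -1, 0, 0) := by
    simpa [e9] using hn.neg 0 1 0 (-1)
  have e15 : n (-1, 1, 0, -1) = n (0, -1, 0, 0) := by
    simpa [e10] using hn.neg 1 (-1) 0 1
  have e16 : n (0, 0, 1, 0) = n (0, -1, 0, 0) := by
    simpa [e13] using hn.refl2 0 1 (-1) 1
  have e17 : n (0, -1, 1, -1) = n (0, -1, 0, 0) := by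
    simpa [e13] using hn.neg 0 1 (-1) 1
  have e18 : n (0, 0, -1, 0) = n (0, -1, 0, 0) := by
    simpa [e16] using hn.neg 0 0 1 0
  have key : ∀ d ∈ chainBox, chainForm d = 6 → d ∈
      ([(0, -1, 0, 0), (-1, 1, -1, 0), (0, 1, 0, 0), (1, 0, -1, 0), (-1, 0, 1, -1), (1, -1, 1, 0),
        (1, -1, 1, -1), (-1, 0, 1, 0), (-1, 0, 0, 1), (1, 0, -1, 1), (0, 1, 0, -1), (1, -1, 0, 1),
        (-1, 1, -1, 1), (1, 0, 0, -1), (0, 1, -1, 1), (0, -1, 0, 1), (-1, 1, 0, -1), (0, 0, 1, 0),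
        (0, -1, 1, -1), (0, 0, -1, 0)] :
      List (ℤ × ℤ × ℤ × ℤ)) := by decide +kernel
  have := key d hd hf
  simp only [List.mem_cons, List.not_mem_nil, or_false] at this
  rcases this with rfl | rfl | rfl | rfl | rfl | rfl | rfl | rfl | rfl | rfl | rfl | rfl | rfl |
    rfl | rfl | rfl | rfl | rfl | rfl | rfl <;> first | rfl | assumption

lemma eq_of_chainForm_eq_four {n : ℤ × ℤ × ℤ × ℤ → ℕ} (hn : WeylInvariant n) (d : ℤ × ℤ × ℤ × ℤ)
    (hd : d ∈ chainBox) (hf : chainForm d = 4) : n d = n (1, 0, 0, 0) := by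
  have e0 : n (-1, 1, 0, 0) = n (1, 0, 0, 0) := by
    simpa using hn.refl0 1 0 0 0
  have e1 : n (-1, 0, 0, 0) = n (1, 0, 0, 0) := by
    simpa using hn.neg 1 0 0 0
  have e2 : n (0, -1, 1, 0) = n (1, 0, 0, 0) := by
    simpa [e0] using hn.refl1 (-1) 1 0 0
  have e3 : n (1, -1, 0, 0) = n (1, 0, 0, 0) := by
    simpa [e0] using hn.neg (-1) 1 0 0
  have e4 : n (0, 0, -1, 1) = n (1, 0, 0, 0) := by
    simpa [e2] using hn.refl2 0 (-1) 1 0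
  have e5 : n (0, 1, -1, 0) = n (1, 0, 0, 0) := by
    simpa [e2] using hn.neg 0 (-1) 1 0
  have e6 : n (0, 0, 0, -1) = n (1, 0, 0, 0) := by
    simpa [e4] using hn.refl3 0 0 (-1) 1
  have e7 : n (0, 0, 1, -1) = n (1, 0, 0, 0) := by
    simpa [e4] using hn.neg 0 0 (-1) 1
  have e8 : n (0, 0, 0, 1) = n (1, 0, 0, 0) := by
    simpa [e6] using hn.neg 0 0 0 (-1)
  have key : ∀ d ∈ chainBox, chainForm d = 4 → d ∈
      ([(1, 0, 0, 0), (-1, 1, 0, 0), (-1, 0, 0, 0), (0, -1, 1, 0), (1, -1, 0, 0), (0, 0, -1, 1),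
        (0, 1, -1, 0), (0, 0, 0, -1), (0, 0, 1, -1), (0, 0, 0, 1)] :
      List (ℤ × ℤ × ℤ × ℤ)) := by decide +kernel
  have := key d hd hf
  simp only [List.mem_cons, List.not_mem_nil, or_false] at this
  rcases this with rfl | rfl | rfl | rfl | rfl | rfl | rfl | rfl | rfl | rfl <;> first | rfl |
    assumption

lemma eq_of_chainForm_eq_ten {n : ℤ × ℤ × ℤ × ℤ → ℕ} (hn : WeylInvariant n) (d : ℤ × ℤ × ℤ × ℤ)
    (hd : d ∈ chainBox) (hf : chainForm d = 10) : n d = n (2, -1, 0, 0) := by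
  have e0 : n (-2, 1, 0, 0) = n (2, -1, 0, 0) := by
    simpa using hn.refl0 2 (-1) 0 0
  have e1 : n (1, 1, -1, 0) = n (2, -1, 0, 0) := by
    simpa using hn.refl1 2 (-1) 0 0
  have e2 : n (-1, -1, 1, 0) = n (2, -1, 0, 0) := by
    simpa [e0] using hn.refl1 (-2) 1 0 0
  have e3 : n (-1, 2, -1, 0) = n (2, -1, 0, 0) := by
    simpa [e1] using hn.refl0 1 1 (-1) 0
  have e4 : n (1, 0, 1, -1) = n (2, -1, 0, 0) := by
    simpa [e1] using hn.refl2 1 1 (-1) 0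
  have e5 : n (1, -2, 1, 0) = n (2, -1, 0, 0) := by
    simpa [e2] using hn.refl0 (-1) (-1) 1 0
  have e6 : n (-1, 0, -1, 1) = n (2, -1, 0, 0) := by
    simpa [e2] using hn.refl2 (-1) (-1) 1 0
  have e7 : n (-1, 1, 1, -1) = n (2, -1, 0, 0) := by
    simpa [e3] using hn.refl2 (-1) 2 (-1) 0
  have e8 : n (1, 0, 0, 1) = n (2, -1, 0, 0) := by
    simpa [e4] using hn.refl3 1 0 1 (-1)
  have e9 : n (1, -1, -1, 1) = n (2, -1, 0, 0) := by
    simpa [e5] using hn.refl2 1 (-2) 1 0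
  have e10 : n (-1, 0, 0, -1) = n (2, -1, 0, 0) := by
    simpa [e6] using hn.refl3 (-1) 0 (-1) 1
  have e11 : n (0, -1, 2, -1) = n (2, -1, 0, 0) := by
    simpa [e7] using hn.refl1 (-1) 1 1 (-1)
  have e12 : n (-1, 1, 0, 1) = n (2, -1, 0, 0) := by
    simpa [e7] using hn.refl3 (-1) 1 1 (-1)
  have e13 : n (0, 1, -2, 1) = n (2, -1, 0, 0) := by
    simpa [e9] using hn.refl1 1 (-1) (-1) 1
  have e14 : n (1, -1, 0, -1) = n (2, -1, 0, 0) := by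
    simpa [e9] using hn.refl3 1 (-1) (-1) 1
  have e15 : n (0, -1, 1, 1) = n (2, -1, 0, 0) := by
    simpa [e11] using hn.refl3 0 (-1) 2 (-1)
  have e16 : n (0, 1, -1, -1) = n (2, -1, 0, 0) := by
    simpa [e13] using hn.refl3 0 1 (-2) 1
  have e17 : n (0, 0, -1, 2) = n (2, -1, 0, 0) := by
    simpa [e15] using hn.refl2 0 (-1) 1 1
  have e18 : n (0, 0, 1, -2) = n (2, -1, 0, 0) := by
    simpa [e16] using hn.refl2 0 1 (-1) (-1)
  have key : ∀ d ∈ chainBox, chainForm d = 10 → d ∈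
      ([(2, -1, 0, 0), (-2, 1, 0, 0), (1, 1, -1, 0), (-1, -1, 1, 0), (-1, 2, -1, 0), (1, 0, 1, -1),
        (1, -2, 1, 0), (-1, 0, -1, 1), (-1, 1, 1, -1), (1, 0, 0, 1), (1, -1, -1, 1), (-1, 0, 0, -1),
        (0, -1, 2, -1), (-1, 1, 0, 1), (0, 1, -2, 1), (1, -1, 0, -1), (0, -1, 1, 1), (0, 1, -1, -1),
        (0, 0, -1, 2), (0, 0, 1, -2)] :
      List (ℤ × ℤ × ℤ × ℤ)) := by decide +kernel
  have := key d hd hf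
  simp only [List.mem_cons, List.not_mem_nil, or_false] at this
  rcases this with rfl | rfl | rfl | rfl | rfl | rfl | rfl | rfl | rfl | rfl | rfl | rfl | rfl |
    rfl | rfl | rfl | rfl | rfl | rfl | rfl <;> first | rfl | assumption

end IsE8Matrix

namespace IsE8Matrix

variable {ι : Type*} [Fintype ι] {A : ι → ι → ℤ}

lemma WeylInvariant.of_le {n : ℤ × ℤ × ℤ × ℤ → ℕ}
    (h0 : ∀ a b c e, n (a, b, c, e) ≤ n (-a, b + a, c, e))
    (h1 : ∀ a b c e, n (a, b, c, e) ≤ n (a + b, -b, c + b, e))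
    (h2 : ∀ a b c e, n (a, b, c, e) ≤ n (a, b + c, -c, e + c))
    (h3 : ∀ a b c e, n (a, b, c, e) ≤ n (a, b, c + e, -e))
    (h4 : ∀ a b c e, n (a, b, c, e) ≤ n (-a, -b, -c, -e)) : WeylInvariant n where
  refl0 a b c e := le_antisymm (by simpa using h0 (-a) (b + a) c e) (h0 a b c e)
  refl1 a b c e := le_antisymm (by simpa using h1 (a + b) (-b) (c + b) e) (h1 a b c e)
  refl2 a b c e := le_antisymm (by simpa using h2 a (b + c) (-c) (e + c)) (h2 a b c e)
  refl3 a b c e := le_antisymm (by simpa using h3 a b (c + e) (-e)) (h3 a b c e)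
  neg a b c e := le_antisymm (by simpa using h4 (-a) (-b) (-c) (-e)) (h4 a b c e)

/-- The tuple of pairings of a root with four given roots. -/
def chainPairing (A : ι → ι → ℤ) (b₀ b₁ b₂ b₃ k : ι) : ℤ × ℤ × ℤ × ℤ :=
  (A k b₀, A k b₁, A k b₂, A k b₃)

/-- The number of roots with prescribed pairings with four given roots. -/
def chainCount (A : ι → ι → ℤ) (b₀ b₁ b₂ b₃ : ι) (d : ℤ × ℤ × ℤ × ℤ) : ℕ :=
  (Finset.univ.filter fun k ↦ chainPairing A b₀ b₁ b₂ b₃ k = d).card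

variable {b₀ b₁ b₂ b₃ : ι}

lemma chainCount_le {f : ι → ι} (hf : f.Injective) {d d' : ℤ × ℤ × ℤ × ℤ}
    (h : ∀ k, chainPairing A b₀ b₁ b₂ b₃ k = d → chainPairing A b₀ b₁ b₂ b₃ (f k) = d') :
    chainCount A b₀ b₁ b₂ b₃ d ≤ chainCount A b₀ b₁ b₂ b₃ d' := by
  refine Finset.card_le_card_of_injOn f (fun k hk ↦ ?_) hf.injOn
  simp only [Finset.coe_filter, Finset.mem_univ, true_and, Set.mem_ofPred_eq] at hk ⊢
  exact h k hk

lemma weylInvariant_chainCount (hA : IsE8Matrix A) (hb : IsChain A b₀ b₁ b₂ b₃) :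
    WeylInvariant (chainCount A b₀ b₁ b₂ b₃) := by
  choose r hr using hA.refl
  have hinj : ∀ j, Function.Injective fun i ↦ r i j := by
    intro j i i' h
    have h1 : ∀ k, A i k - A i j * A j k = A i' k - A i' j * A j k := fun k ↦ by
      rw [← hr, ← hr]; exact congrFun (congrArg A h) k
    have h2 := h1 j
    rw [hA.diag] at h2
    refine hA.ext_left fun k ↦ ?_
    have h3 := h1 k
    rw [show A i' j = A i j by linarith] at h3
    linarith
  choose neg hneg using hA.exists_neg
  have hninj : Function.Injective neg := fun i j h ↦ hA.ext_left fun k ↦ by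
    have := congrFun (congrArg A h) k
    rw [hneg, hneg] at this
    omega
  have h10 := (hA.symm b₁ b₀).trans hb.h01
  have h20 := (hA.symm b₂ b₀).trans hb.h02
  have h30 := (hA.symm b₃ b₀).trans hb.h03
  have h21 := (hA.symm b₂ b₁).trans hb.h12
  have h31 := (hA.symm b₃ b₁).trans hb.h13
  have h32 := (hA.symm b₃ b₂).trans hb.h23
  refine .of_le (fun a b c e ↦ chainCount_le (hinj b₀) ?_)
    (fun a b c e ↦ chainCount_le (hinj b₁) ?_) (fun a b c e ↦ chainCount_le (hinj b₂) ?_)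
    (fun a b c e ↦ chainCount_le (hinj b₃) ?_) (fun a b c e ↦ chainCount_le hninj ?_) <;>
  · intro k hk
    simp only [chainPairing, Prod.mk.injEq] at hk ⊢
    obtain ⟨rfl, rfl, rfl, rfl⟩ := hk
    simp only [hr, hneg, hA.diag, hb.h01, hb.h02, hb.h03, hb.h12, hb.h13, hb.h23,
      h10, h20, h30, h21, h31, h32]
    refine ⟨?_, ?_, ?_, ?_⟩ <;> first | trivial | ring

lemma chainForm_le (hA : IsE8Matrix A) (hb : IsChain A b₀ b₁ b₂ b₃) (k : ι) :
    chainForm (chainPairing A b₀ b₁ b₂ b₃ k) ≤ 10 := by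
  have h := hA.form_nonneg ![5, -(4 * A k b₀ + 3 * A k b₁ + 2 * A k b₂ + A k b₃),
    -(3 * A k b₀ + 6 * A k b₁ + 4 * A k b₂ + 2 * A k b₃),
    -(2 * A k b₀ + 4 * A k b₁ + 6 * A k b₂ + 3 * A k b₃),
    -(A k b₀ + 2 * A k b₁ + 3 * A k b₂ + 4 * A k b₃)] ![k, b₀, b₁, b₂, b₃]
  simp only [Fin.sum_univ_five, Matrix.cons_val, hA.diag, hb.h01, hb.h02, hb.h03, hb.h12, hb.h13,
    hb.h23, (hA.symm b₁ b₀).trans hb.h01, (hA.symm b₂ b₀).trans hb.h02,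
    (hA.symm b₃ b₀).trans hb.h03, (hA.symm b₂ b₁).trans hb.h12,
    (hA.symm b₃ b₁).trans hb.h13, (hA.symm b₃ b₂).trans hb.h23, hA.symm b₀ k, hA.symm b₁ k,
    hA.symm b₂ k, hA.symm b₃ k] at h
  simp only [chainForm, chainPairing]
  nlinarith

lemma chainPairing_mem (hA : IsE8Matrix A) (k : ι) :
    chainPairing A b₀ b₁ b₂ b₃ k ∈ chainBox := by
  have h : ∀ i j, A i j ∈ ({-2, -1, 0, 1, 2} : Finset ℤ) := by
    intro i j
    have h1 := hA.le_two i j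
    have h2 := hA.neg_two_le i j
    simp only [Finset.mem_insert, Finset.mem_singleton]
    omega
  simp only [chainBox, chainPairing, Finset.mem_product]
  exact ⟨h _ _, h _ _, h _ _, h _ _⟩

lemma sum_chainForm (hA : IsE8Matrix A) (hb : IsChain A b₀ b₁ b₂ b₃) :
    ∑ k, chainForm (chainPairing A b₀ b₁ b₂ b₃ k) = 1200 := by
  have h : ∀ i j, ∑ k, A k i * A k j = 60 * A i j := fun i j ↦ by
    rw [← hA.design]
    exact Finset.sum_congr rfl fun k _ ↦ by rw [hA.symm k i]
  simp only [chainForm, chainPairing, Finset.sum_add_distrib, ← Finset.mul_sum, h, sq,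
    hA.diag, hb.h01, hb.h02, hb.h03, hb.h12, hb.h13, hb.h23]
  norm_num

lemma chainCount_numerics (hA : IsE8Matrix A) (hb : IsChain A b₀ b₁ b₂ b₃) :
    chainCount A b₀ b₁ b₂ b₃ (0, 0, 0, 0) + 10 * chainCount A b₀ b₁ b₂ b₃ (1, 0, 0, 0) +
      20 * chainCount A b₀ b₁ b₂ b₃ (0, -1, 0, 0) = 220 ∧
    40 * chainCount A b₀ b₁ b₂ b₃ (1, 0, 0, 0) +
      120 * chainCount A b₀ b₁ b₂ b₃ (0, -1, 0, 0) = 1000 := by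
  classical
  set n := chainCount A b₀ b₁ b₂ b₃ with hn
  have hW := hA.weylInvariant_chainCount hb
  rw [← hn] at hW
  have h10 : n (2, -1, 0, 0) = 1 := by
    rw [hn, chainCount, Finset.card_eq_one]
    refine ⟨b₀, ?_⟩
    ext k
    simp only [chainPairing, Finset.mem_filter, Finset.mem_univ, true_and, Finset.mem_singleton,
      Prod.mk.injEq]
    constructor
    · rintro ⟨h, -⟩
      exact hA.inj _ _ h
    · rintro rfl
      exact ⟨hA.diag _, hb.h01, hb.h02, hb.h03⟩
  have hval : ∀ d ∈ chainBox, chainForm d ≤ 10 →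
      chainForm d = 0 ∨ chainForm d = 4 ∨ chainForm d = 6 ∨ chainForm d = 10 := by
    decide +kernel
  have hzero : ∀ d ∈ chainBox, chainForm d = 0 → d = (0, 0, 0, 0) := by decide +kernel
  have hnd : ∀ d ∈ chainBox, n d = (if chainForm d = 0 then 1 else 0) * n (0, 0, 0, 0) +
      (if chainForm d = 4 then 1 else 0) * n (1, 0, 0, 0) +
      (if chainForm d = 6 then 1 else 0) * n (0, -1, 0, 0) +
      (if chainForm d = 10 then 1 else 0) := by
    intro d hd
    by_cases hle : chainForm d ≤ 10
    · rcases hval d hd hle with h | h | h | h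
      · simp [hzero d hd h, show chainForm (0, 0, 0, 0) = 0 from rfl]
      · simp [h, eq_of_chainForm_eq_four hW d hd h]
      · simp [h, eq_of_chainForm_eq_six hW d hd h]
      · simp [h, eq_of_chainForm_eq_ten hW d hd h, h10]
    · have h1 : n d = 0 := by
        rw [hn, chainCount, Finset.card_eq_zero, Finset.filter_eq_empty_iff]
        rintro k - rfl
        exact hle (hA.chainForm_le hb k)
      rw [h1, if_neg (by omega), if_neg (by omega), if_neg (by omega), if_neg (by omega)]
      simp
  constructor
  · have h1 : ∑ d ∈ chainBox, n d = 240 := by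
      rw [← hA.card, ← Finset.card_univ]
      exact (Finset.card_eq_sum_card_fiberwise fun k _ ↦ hA.chainPairing_mem k).symm
    rw [Finset.sum_congr rfl hnd] at h1
    simp only [Finset.sum_add_distrib, ← Finset.sum_mul] at h1
    rw [show ∑ d ∈ chainBox, (if chainForm d = 0 then 1 else 0) = 1 by decide +kernel,
      show ∑ d ∈ chainBox, (if chainForm d = 4 then 1 else 0) = 10 by decide +kernel,
      show ∑ d ∈ chainBox, (if chainForm d = 6 then 1 else 0) = 20 by decide +kernel,
      show ∑ d ∈ chainBox, (if chainForm d = 10 then 1 else 0) = 20 by decide +kernel] at h1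
    omega
  · have h1 : ∑ d ∈ chainBox, chainForm d * (n d : ℤ) = 1200 := by
      rw [← hA.sum_chainForm hb,
        ← Finset.sum_fiberwise_of_maps_to (fun k _ ↦ hA.chainPairing_mem k)]
      refine Finset.sum_congr rfl fun d _ ↦ ?_
      rw [Finset.sum_congr rfl (g := fun _ ↦ chainForm d)
        (fun k hk ↦ by rw [(Finset.mem_filter.mp hk).2]), Finset.sum_const, hn, chainCount,
        nsmul_eq_mul, mul_comm]
    have h2 : ∀ d ∈ chainBox, chainForm d * (n d : ℤ) =
      (if chainForm d = 4 then 4 else 0) * (n (1, 0, 0, 0) : ℤ) +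
      (if chainForm d = 6 then 6 else 0) * (n (0, -1, 0, 0) : ℤ) +
      (if chainForm d = 10 then 10 else 0) := by
      intro d hd
      rw [hnd d hd]
      push_cast
      by_cases a4 : chainForm d = 4
      · simp [a4]
      by_cases a6 : chainForm d = 6
      · simp [a6]
      by_cases a10 : chainForm d = 10
      · simp [a10]
      by_cases a0 : chainForm d = 0
      · simp [a0]
      simp [a0, a4, a6, a10]
    rw [Finset.sum_congr rfl h2] at h1
    simp only [Finset.sum_add_distrib, ← Finset.sum_mul] at h1
    rw [show ∑ d ∈ chainBox, (if chainForm d = 4 then 4 else 0 : ℤ) = 40 by decide +kernel,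
      show ∑ d ∈ chainBox, (if chainForm d = 6 then 6 else 0 : ℤ) = 120 by decide +kernel,
      show ∑ d ∈ chainBox, (if chainForm d = 10 then 10 else 0 : ℤ) = 200 by decide +kernel] at h1
    omega

/-- Two roots attached to the second root of a chain of type `A₄` are equal or at angle
`π / 3`. -/
lemma one_le_of_chainPairing (hA : IsE8Matrix A) (hb : IsChain A b₀ b₁ b₂ b₃) {k l : ι}
    (hk : chainPairing A b₀ b₁ b₂ b₃ k = (0, -1, 0, 0))
    (hl : chainPairing A b₀ b₁ b₂ b₃ l = (0, -1, 0, 0)) : 1 ≤ A k l := by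
  simp only [chainPairing, Prod.mk.injEq] at hk hl
  obtain ⟨k0, k1, k2, k3⟩ := hk
  obtain ⟨l0, l1, l2, l3⟩ := hl
  have h := hA.form_nonneg ![5, 5, 6, 12, 8, 4] ![k, l, b₀, b₁, b₂, b₃]
  simp [Fin.sum_univ_six, hA.diag, hb.h01, hb.h02, hb.h03, hb.h12, hb.h13, hb.h23,
    (hA.symm b₁ b₀).trans hb.h01, (hA.symm b₂ b₀).trans hb.h02,
    (hA.symm b₃ b₀).trans hb.h03, (hA.symm b₂ b₁).trans hb.h12,
    (hA.symm b₃ b₁).trans hb.h13, (hA.symm b₃ b₂).trans hb.h23, hA.symm b₀ k, hA.symm b₁ k,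
    hA.symm b₂ k, hA.symm b₃ k, hA.symm b₀ l, hA.symm b₁ l,
    hA.symm b₂ l, hA.symm b₃ l, hA.symm l k, k0, k1, k2, k3, l0, l1, l2, l3] at h
  omega

/-- There are at least four roots pairing with a chain of type `A₄` as an additional node
attached to the second root of the chain. -/
lemma four_le_chainCount (hA : IsE8Matrix A) (hb : IsChain A b₀ b₁ b₂ b₃) :
    4 ≤ chainCount A b₀ b₁ b₂ b₃ (0, -1, 0, 0) := by
  obtain ⟨h1, h2⟩ := hA.chainCount_numerics hb
  by_contra hlt
  have h3 : chainCount A b₀ b₁ b₂ b₃ (0, -1, 0, 0) = 3 := by omega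
  have h0 : chainCount A b₀ b₁ b₂ b₃ (0, 0, 0, 0) = 0 := by omega
  obtain ⟨k, hk, l, hl, hkl⟩ := Finset.one_lt_card.mp (h3 ▸ by norm_num :
    1 < chainCount A b₀ b₁ b₂ b₃ (0, -1, 0, 0))
  simp only [Finset.mem_filter, Finset.mem_univ, true_and] at hk hl
  have h4 := hA.one_le_of_chainPairing hb hk hl
  have h5 := hA.le_two k l
  have h6 : A k l ≠ 2 := fun h ↦ hkl (hA.inj _ _ h)
  obtain ⟨m, hm⟩ := hA.exists_sub (show A k l = 1 by omega)
  rw [chainCount, Finset.card_eq_zero, Finset.filter_eq_empty_iff] at h0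
  apply h0 (Finset.mem_univ m)
  simp only [chainPairing, Prod.mk.injEq] at hk hl ⊢
  simp only [hm, hk, hl]
  norm_num

end IsE8Matrix

/-- The Cartan matrix of type `E₈`. -/
def e8Gram : Matrix (Fin 8) (Fin 8) ℤ :=
  !![2, -1, 0, 0, 0, 0, 0, 0;
    -1, 2, -1, 0, -1, 0, 0, 0;
    0, -1, 2, -1, 0, 0, 0, 0;
    0, 0, -1, 2, 0, 0, 0, 0;
    0, -1, 0, 0, 2, -1, 0, 0;
    0, 0, 0, 0, -1, 2, -1, 0;
    0, 0, 0, 0, 0, -1, 2, -1;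
    0, 0, 0, 0, 0, 0, -1, 2]

/-- An isometry of order five of the `E₈` lattice without nonzero fixed points; its rows are
the images of the basis vectors. -/
def e8Rot : Matrix (Fin 8) (Fin 8) ℤ :=
  !![0, 1, 0, 0, 0, 0, 0, 0;
    0, 0, 1, 0, 0, 0, 0, 0;
    0, 0, 0, 1, 0, 0, 0, 0;
    -1, -1, -1, -1, 0, 0, 0, 0;
    1, 1, 0, 0, 1, 1, 0, 0;
    0, 0, 0, 0, 0, 0, 1, 0;
    0, 0, 0, 0, 0, 0, 0, 1;
    -3, -6, -4, -2, -5, -4, -3, -2]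

namespace IsE8Matrix

variable {ι : Type*} [Fintype ι] {A : ι → ι → ℤ}

/-- Eight roots with Dynkin diagram `E₈`. -/
def IsFrame (A : ι → ι → ℤ) (α : Fin 8 → ι) : Prop := ∀ i j, A (α i) (α j) = e8Gram i j

variable {b₀ b₁ b₂ b₃ : ι}

lemma isFrame_of_chain (hA : IsE8Matrix A) (hb : IsChain A b₀ b₁ b₂ b₃) {d₀ d₁ d₂ d₃ : ι}
    (hd₀ : chainPairing A b₀ b₁ b₂ b₃ d₀ = (0, -1, 0, 0))
    (hd₁ : chainPairing A b₀ b₁ b₂ b₃ d₁ = (0, -1, 0, 0))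
    (hd₂ : chainPairing A b₀ b₁ b₂ b₃ d₂ = (0, -1, 0, 0))
    (hd₃ : chainPairing A b₀ b₁ b₂ b₃ d₃ = (0, -1, 0, 0))
    (h01 : A d₀ d₁ = 1) (h02 : A d₀ d₂ = 1) (h03 : A d₀ d₃ = 1) (h12 : A d₁ d₂ = 1)
    (h13 : A d₁ d₃ = 1) (h23 : A d₂ d₃ = 1) {g₀ g₁ g₂ : ι} (hg₀ : ∀ k, A g₀ k = A d₁ k - A d₀ k)
    (hg₁ : ∀ k, A g₁ k = A d₂ k - A d₁ k) (hg₂ : ∀ k, A g₂ k = A d₃ k - A d₂ k) :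
    IsFrame A ![b₀, b₁, b₂, b₃, d₀, g₀, g₁, g₂] := by
  simp only [chainPairing, Prod.mk.injEq] at hd₀ hd₁ hd₂ hd₃
  obtain ⟨a1, a2, a3, a4⟩ := hd₀
  obtain ⟨c1, c2, c3, c4⟩ := hd₁
  obtain ⟨e1, e2, e3, e4⟩ := hd₂
  obtain ⟨f1, f2, f3, f4⟩ := hd₃
  have hg₀' : ∀ k, A k g₀ = A k d₁ - A k d₀ := fun k ↦ by
    rw [hA.symm, hg₀, hA.symm k, hA.symm k]
  have hg₁' : ∀ k, A k g₁ = A k d₂ - A k d₁ := fun k ↦ by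
    rw [hA.symm, hg₁, hA.symm k, hA.symm k]
  have hg₂' : ∀ k, A k g₂ = A k d₃ - A k d₂ := fun k ↦ by
    rw [hA.symm, hg₂, hA.symm k, hA.symm k]
  intro i j
  fin_cases i <;> fin_cases j <;>
  simp [e8Gram, hg₀, hg₁, hg₂, hg₀', hg₁', hg₂', hA.diag, hb.h01, hb.h02, hb.h03, hb.h12, hb.h13,
    hb.h23, (hA.symm b₁ b₀).trans hb.h01, (hA.symm b₂ b₀).trans hb.h02,
    (hA.symm b₃ b₀).trans hb.h03, (hA.symm b₂ b₁).trans hb.h12,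
    (hA.symm b₃ b₁).trans hb.h13, (hA.symm b₃ b₂).trans hb.h23, a1, a2, a3, a4, c1, c2, c3, c4,
    e1, e2, e3, e4, f1, f2, f3, f4, (hA.symm _ _).trans a1, (hA.symm _ _).trans a2,
    (hA.symm _ _).trans a3, (hA.symm _ _).trans a4, (hA.symm _ _).trans c1,
    (hA.symm _ _).trans c2, (hA.symm _ _).trans c3, (hA.symm _ _).trans c4,
    (hA.symm _ _).trans e1, (hA.symm _ _).trans e2, (hA.symm _ _).trans e3,
    (hA.symm _ _).trans e4, (hA.symm _ _).trans f1, (hA.symm _ _).trans f2,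
    (hA.symm _ _).trans f3, (hA.symm _ _).trans f4, h01, h02, h03, h12, h13, h23,
    (hA.symm _ _).trans h01, (hA.symm _ _).trans h02, (hA.symm _ _).trans h03,
    (hA.symm _ _).trans h12, (hA.symm _ _).trans h13, (hA.symm _ _).trans h23]

lemma exists_isFrame (hA : IsE8Matrix A) : ∃ α, IsFrame A α := by
  classical
  obtain ⟨b₀, b₁, b₂, b₃, hb⟩ := hA.exists_chain
  have h4 := hA.four_le_chainCount hb
  rw [chainCount] at h4
  set X := Finset.univ.filter fun k ↦ chainPairing A b₀ b₁ b₂ b₃ k = (0, -1, 0, 0) with hX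
  obtain ⟨g⟩ := Function.Embedding.nonempty_of_card_le (α := Fin 4) (β := X) (by simpa using h4)
  have hg : ∀ a, chainPairing A b₀ b₁ b₂ b₃ (g a) = (0, -1, 0, 0) := fun a ↦ by
    have := (g a).2
    simpa only [X, Finset.mem_filter, Finset.mem_univ, true_and] using this
  have hg1 : ∀ a b, a ≠ b → A (g a) (g b) = 1 := fun a b hab ↦ by
    have h1 := hA.one_le_of_chainPairing hb (hg a) (hg b)
    have h2 := hA.le_two (g a) (g b)
    have h3 : A (g a) (g b) ≠ 2 := fun h ↦ hab (g.injective (Subtype.ext (hA.inj _ _ h)))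
    omega
  obtain ⟨g₀, hg₀⟩ := hA.exists_sub (hg1 1 0 (by decide))
  obtain ⟨g₁, hg₁⟩ := hA.exists_sub (hg1 2 1 (by decide))
  obtain ⟨g₂, hg₂⟩ := hA.exists_sub (hg1 3 2 (by decide))
  exact ⟨_, hA.isFrame_of_chain hb (hg 0) (hg 1) (hg 2) (hg 3) (hg1 _ _ (by decide))
    (hg1 _ _ (by decide)) (hg1 _ _ (by decide)) (hg1 _ _ (by decide)) (hg1 _ _ (by decide))
    (hg1 _ _ (by decide)) hg₀ hg₁ hg₂⟩

/-- An isometry whose powers sum to zero is represented by `e8Rot` in a suitable frame. -/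
lemma exists_isFrame_of_isometry (hA : IsE8Matrix A) {w : ι → ι}
    (hw : ∀ i j, A (w i) (w j) = A i j)
    (hsum : ∀ i k, A i k + A (w i) k + A (w (w i)) k + A (w (w (w i))) k +
      A (w (w (w (w i)))) k = 0) :
    ∃ α, IsFrame A α ∧ ∀ i k, A (w (α i)) k = ∑ j, e8Rot i j * A (α j) k := by
  have hw5 : ∀ i, w (w (w (w (w i)))) = i := fun i ↦ hA.ext_left fun k ↦ by
    have h1 := hsum i k
    have h2 := hsum (w i) k
    linarith
  have hshift : ∀ i j, A (w i) j = A i (w (w (w (w j)))) := fun i j ↦ by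
    rw [← hw i, hw5]
  have hpq : ∀ i, (A (w i) i = -1 ∧ A (w (w i)) i = 0) ∨
      (A (w i) i = 0 ∧ A (w (w i)) i = -1) := by
    intro i
    have h1 := hsum i i
    have h4 : A (w (w (w (w i)))) i = A (w i) i := by rw [hshift, hw, hw, hw, hA.symm]
    have h3 : A (w (w (w i))) i = A (w (w i)) i := by
      have : A (w (w (w i))) i = A (w (w (w i))) (w (w (w (w (w i))))) := by rw [hw5]
      rw [this, hw, hw, hw, hA.symm]
    rw [hA.diag] at h1
    have h5 : A (w i) i ≠ -2 := fun h ↦ by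
      have e := hA.eq_neg_of_eq_neg_two h
      have e1 := e (w i)
      have e2 := e (w (w i))
      have e3 := e (w (w (w i)))
      rw [hw, hA.symm i] at e2
      rw [hA.diag, hA.symm i] at e1
      rw [hw, hA.symm i, hA.symm i] at e3
      omega
    have h6 : A (w (w i)) i ≠ -2 := fun h ↦ by
      have e := hA.eq_neg_of_eq_neg_two h
      have e1 := e (w i)
      rw [hw, hA.symm i] at e1
      omega
    have h7 := hA.neg_two_le (w i) i
    have h8 := hA.neg_two_le (w (w i)) i
    have h9 := hA.le_two (w i) i
    have h10 := hA.le_two (w (w i)) i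
    omega
  have hswap : ∀ i, A (w (w (w i))) i = A (w (w i)) i := fun i ↦ by
    have : A (w (w (w i))) i = A (w (w (w i))) (w (w (w (w (w i))))) := by rw [hw5]
    rw [this, hw, hw, hw, hA.symm]
  obtain ⟨b, hb1, hb2⟩ : ∃ b, A (w b) b = -1 ∧ A (w (w b)) b = 0 := by
    obtain ⟨i⟩ : Nonempty ι := Fintype.card_pos_iff.mp (by rw [hA.card]; norm_num)
    rcases hpq i with h | ⟨h, h'⟩
    · exact ⟨i, h⟩
    · obtain ⟨b, hb⟩ := hA.exists_add h'
      have : A (w b) b = -1 := by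
        have e1 := hb (w b)
        have e2 := hb (w i)
        have e3 := hb (w (w (w (w i))))
        have e4 := hshift b i
        have e5 := hshift i i
        rw [hw] at e1 e2
        rw [hw, hw] at e3
        linarith [hA.symm (w b) b, hA.symm i (w b), hA.symm b (w i), hA.symm i (w i),
          hA.symm i (w (w i))]
      refine ⟨b, ?_⟩
      have := hpq b
      omega
  have hsum' := hsum b
  set b₁ := w b with hb₁
  set b₂ := w b₁ with hb₂
  set b₃ := w b₂ with hb₃
  set b₄ := w b₃ with hb₄
  have hchain : IsChain A b b₁ b₂ b₃ := by
    refine ⟨?_, ?_, ?_, ?_, ?_, ?_⟩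
    · rw [hA.symm, hb1]
    · rw [hA.symm, hb2]
    · rw [hA.symm, hswap, hb2]
    · rw [hA.symm, hb₂, hb₁, hw, hb1]
    · rw [hA.symm, hb₃, hb₂, hb₁, hw, ← hb₁, ← hb₂, hb2]
    · rw [hA.symm, hb₃, hb₂, hw, hb₁, hw, hb1]
  have hf : ∀ x, ∃ y, chainPairing A b b₁ b₂ b₃ x = (0, -1, 0, 0) →
      chainPairing A b b₁ b₂ b₃ y = (0, -1, 0, 0) ∧
      ∀ k, A y k = A (w x) k - A b k - A b₁ k := by
    intro x
    by_cases hx : chainPairing A b b₁ b₂ b₃ x = (0, -1, 0, 0)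
    swap
    · exact ⟨x, fun h ↦ absurd h hx⟩
    simp only [chainPairing, Prod.mk.injEq] at hx
    obtain ⟨x0, x1, x2, x3⟩ := hx
    have c1 : A (w x) b₁ = 0 := by rw [hb₁, hw, x0]
    have c2 : A (w x) b₂ = -1 := by rw [hb₂, hw, x1]
    have c3 : A (w x) b₃ = 0 := by rw [hb₃, hw, x2]
    have c4 : A (w x) b₄ = 0 := by rw [hb₄, hw, x3]
    have c0 : A (w x) b = 1 := by
      have := hsum' (w x)
      rw [hA.symm b, hA.symm b₁, hA.symm b₂, hA.symm b₃, hA.symm b₄] at this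
      omega
    obtain ⟨y, hy⟩ := hA.exists_sub c0
    obtain ⟨z, hz⟩ := hA.exists_sub (i := y) (j := b₁) (by rw [hy, c1, hchain.h01]; norm_num)
    refine ⟨z, fun _ ↦ ⟨?_, fun k ↦ by rw [hz, hy]⟩⟩
    simp only [chainPairing, hz, hy, c0, c1, c2, c3, hA.diag, hchain.h01, hchain.h02, hchain.h03,
      hchain.h12, hchain.h13, hA.symm b₁ b]
    norm_num
  choose f hf using hf
  obtain ⟨d₀, hd₀⟩ : ∃ d, chainPairing A b b₁ b₂ b₃ d = (0, -1, 0, 0) := by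
    have h4 := hA.four_le_chainCount hchain
    obtain ⟨d, hd⟩ := Finset.card_pos.mp (show 0 < chainCount A b b₁ b₂ b₃ (0, -1, 0, 0) by omega)
    exact ⟨d, by simpa using hd⟩
  obtain ⟨hd₁, hf₀⟩ := hf d₀ hd₀
  set d₁ := f d₀
  obtain ⟨hd₂, hf₁⟩ := hf d₁ hd₁
  set d₂ := f d₁
  obtain ⟨hd₃, hf₂⟩ := hf d₂ hd₂
  set d₃ := f d₂
  obtain ⟨hd₄, hf₃⟩ := hf d₃ hd₃
  set d₄ := f d₃
  -- the orbit of `d₀`, expressed through the roots `dᵢ`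
  have r1 : ∀ k, A (w d₀) k = A d₁ k + A b k + A b₁ k := fun k ↦ by rw [hf₀]; ring
  have r2 : ∀ k, A (w (w d₀)) k = A d₂ k + A b k + 2 * A b₁ k + A b₂ k := fun k ↦ by
    linarith [hf₁ k, hshift (w d₀) k, r1 (w (w (w (w k)))), hshift d₁ k, hshift b k, hshift b₁ k]
  have r3 : ∀ k, A (w (w (w d₀))) k = A d₃ k + A b k + 2 * A b₁ k + 2 * A b₂ k + A b₃ k :=
    fun k ↦ by
      linarith [hf₂ k, hshift (w (w d₀)) k, r2 (w (w (w (w k)))), hshift d₂ k, hshift b k,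
        hshift b₁ k, hshift b₂ k]
  have r4 : ∀ k, A (w (w (w (w d₀)))) k = A d₄ k + A b₁ k + A b₂ k + A b₃ k :=
    fun k ↦ by
      linarith [hf₃ k, hshift (w (w (w d₀))) k, r3 (w (w (w (w k)))), hshift d₃ k, hshift b k,
        hshift b₁ k, hshift b₂ k, hshift b₃ k, hsum' k]
  have hd : ∀ k, A d₀ k + A d₁ k + A d₂ k + A d₃ k + A d₄ k +
      3 * A b k + 6 * A b₁ k + 4 * A b₂ k + 2 * A b₃ k = 0 := fun k ↦ by
    have := hsum d₀ k
    rw [r1, r2, r3, r4] at this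
    linarith
  have hinv : ∀ x y, chainPairing A b b₁ b₂ b₃ x = (0, -1, 0, 0) →
      chainPairing A b b₁ b₂ b₃ y = (0, -1, 0, 0) → A (f x) (f y) = A x y := by
    intro x y hx hy
    obtain ⟨hfx, hfx'⟩ := hf x hx
    obtain ⟨hfy, hfy'⟩ := hf y hy
    have e1 := hfx' (w y)
    have e2 := hfy' (f x)
    have e3 := hfy' b
    have e4 := hfy' b₁
    simp only [chainPairing, Prod.mk.injEq] at hx hy hfx hfy
    rw [hw] at e1
    rw [hA.symm (f y) (f x), hA.symm (w y) (f x), hA.symm b (f x), hA.symm b₁ (f x), hfx.1,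
      hfx.2.1, e1, hA.symm b, hA.symm b₁] at e2
    rw [hfy.1, hA.diag, hA.symm b₁ b, hchain.h01] at e3
    rw [hfy.2.1, hA.diag, hchain.h01] at e4
    omega
  have h01 : A d₀ d₁ = 1 ∧ A d₀ d₂ = 1 ∧ A d₀ d₃ = 1 := by
    have h1 := hA.one_le_of_chainPairing hchain hd₀ hd₁
    have h2 := hA.one_le_of_chainPairing hchain hd₀ hd₂
    have h3 := hA.one_le_of_chainPairing hchain hd₀ hd₃
    have h4 := hA.one_le_of_chainPairing hchain hd₀ hd₄
    have h5 := hd d₀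
    simp only [chainPairing, Prod.mk.injEq] at hd₀
    rw [hA.symm b, hA.symm b₁, hA.symm b₂, hA.symm b₃, hd₀.1, hd₀.2.1, hd₀.2.2.1, hd₀.2.2.2,
      hA.diag, hA.symm d₁, hA.symm d₂, hA.symm d₃, hA.symm d₄] at h5
    omega
  have h12 : A d₁ d₂ = 1 := (hinv _ _ hd₀ hd₁).trans h01.1
  have h13 : A d₁ d₃ = 1 := (hinv _ _ hd₀ hd₂).trans h01.2.1
  have h23 : A d₂ d₃ = 1 := (hinv _ _ hd₁ hd₂).trans h12
  obtain ⟨g₀, hg₀⟩ := hA.exists_sub ((hA.symm _ _).trans h01.1)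
  obtain ⟨g₁, hg₁⟩ := hA.exists_sub ((hA.symm _ _).trans h12)
  obtain ⟨g₂, hg₂⟩ := hA.exists_sub ((hA.symm _ _).trans h23)
  refine ⟨_, hA.isFrame_of_chain hchain hd₀ hd₁ hd₂ hd₃ h01.1 h01.2.1 h01.2.2 h12 h13 h23
    hg₀ hg₁ hg₂, fun i k ↦ ?_⟩
  have s0 := hsum' k
  have s1 := hd k
  have s2 := hf₀ k
  have s3 := hf₁ k
  have s4 := hf₂ k
  have s5 := hf₃ k
  have t0 : A (w g₀) k = A (w d₁) k - A (w d₀) k := by rw [hshift, hg₀, ← hshift, ← hshift]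
  have t1 : A (w g₁) k = A (w d₂) k - A (w d₁) k := by rw [hshift, hg₁, ← hshift, ← hshift]
  have t2 : A (w g₂) k = A (w d₃) k - A (w d₂) k := by rw [hshift, hg₂, ← hshift, ← hshift]
  have u0 := hg₀ k
  have u1 := hg₁ k
  have u2 := hg₂ k
  fin_cases i <;> simp [e8Rot, Fin.sum_univ_succ, ← hb₁, ← hb₂, ← hb₃, ← hb₄] <;> linarith

end IsE8Matrix

/-- The inverse of the Cartan matrix of type `E₈`. -/
def e8Inv : Matrix (Fin 8) (Fin 8) ℤ :=
  !![8, 15, 10, 5, 12, 9, 6, 3;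
    15, 30, 20, 10, 24, 18, 12, 6;
    10, 20, 14, 7, 16, 12, 8, 4;
    5, 10, 7, 4, 8, 6, 4, 2;
    12, 24, 16, 8, 20, 15, 10, 5;
    9, 18, 12, 6, 15, 12, 8, 4;
    6, 12, 8, 4, 10, 8, 6, 3;
    3, 6, 4, 2, 5, 4, 3, 2]

lemma e8Inv_mul_e8Gram : e8Inv * e8Gram = 1 := by decide +kernel

lemma e8Gram_mul_e8Inv : e8Gram * e8Inv = 1 := by decide +kernel

lemma e8Gram_nonpos (i j : Fin 8) (h : i ≠ j) : e8Gram i j ≤ 0 := by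
  fin_cases i <;> fin_cases j <;> first | decide | exact absurd rfl h

lemma e8Gram_symm (i j : Fin 8) : e8Gram i j = e8Gram j i := by
  fin_cases i <;> fin_cases j <;> rfl

namespace IsE8Matrix

variable {ι : Type*} [Fintype ι] {A : ι → ι → ℤ} {α : Fin 8 → ι}

/-- The coordinates of a root in a frame. -/
def coord (A : ι → ι → ℤ) (α : Fin 8 → ι) (k : ι) (i : Fin 8) : ℤ :=
  ∑ j, A k (α j) * e8Inv j i

lemma sum_coord_mul_e8Gram (k : ι) (j : Fin 8) :
    ∑ i, coord A α k i * e8Gram i j = A k (α j) := by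
  have h := congrFun (congrArg (fun M ↦ Matrix.vecMul (fun j ↦ A k (α j)) M) e8Inv_mul_e8Gram) j
  simp only [← Matrix.vecMul_vecMul, Matrix.vecMul_one] at h
  exact h

lemma coord_eq_of_sum (hα : IsFrame A α) {k : ι} {n : Fin 8 → ℤ}
    (h : ∀ l, A k l = ∑ i, n i * A (α i) l) : coord A α k = n := by
  ext i
  have h2 := congrFun (congrArg (fun M ↦ Matrix.vecMul n M) e8Gram_mul_e8Inv) i
  simp only [← Matrix.vecMul_vecMul, Matrix.vecMul_one] at h2
  rw [← h2]
  change ∑ j, A k (α j) * e8Inv j i = ∑ j, (∑ a, n a * e8Gram a j) * e8Inv j i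
  refine Finset.sum_congr rfl fun j _ ↦ ?_
  rw [h]
  congr 1
  exact Finset.sum_congr rfl fun a _ ↦ by rw [hα]

lemma coord_frame (hα : IsFrame A α) (i : Fin 8) : coord A α (α i) = Pi.single i 1 :=
  coord_eq_of_sum hα fun l ↦ by simp [Pi.single_apply]

lemma eq_sum_coord (hA : IsE8Matrix A) (hα : IsFrame A α) (k l : ι) :
    A k l = ∑ i, coord A α k i * A (α i) l := by
  let c := coord A α
  have hc : ∀ k j, ∑ i, c k i * e8Gram i j = A k (α j) := sum_coord_mul_e8Gram
  have hform : ∀ k, ∑ a : Option (Fin 8), ∑ b : Option (Fin 8),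
      (a.elim 1 fun i ↦ -c k i) * (b.elim 1 fun i ↦ -c k i) * A (a.elim k α) (b.elim k α) =
      2 - ∑ i, c k i * A k (α i) := by
    intro k
    simp only [Fintype.sum_option, Option.elim_none, Option.elim_some, hA.diag]
    have h1 : ∀ i, ∑ j, -c k i * -c k j * A (α i) (α j) = c k i * A k (α i) := by
      intro i
      rw [hA.symm k, ← hA.symm k, ← hc, Finset.mul_sum]
      refine Finset.sum_congr rfl fun j _ ↦ ?_
      rw [hA.symm (α i), hα]
      ring
    rw [Finset.sum_add_distrib, Finset.sum_congr rfl fun i _ ↦ h1 i]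
    simp only [one_mul, mul_one, neg_mul, Finset.sum_neg_distrib]
    have : ∑ i, c k i * A (α i) k = ∑ i, c k i * A k (α i) :=
      Finset.sum_congr rfl fun i _ ↦ by rw [hA.symm k]
    rw [this]
    ring
  have hnn : ∀ k, 0 ≤ 2 - ∑ i, c k i * A k (α i) := fun k ↦ by
    rw [← hform]
    exact hA.form_nonneg _ _
  have htot : ∑ k, (2 - ∑ i, c k i * A k (α i)) = 0 := by
    have h1 : ∀ i j, ∑ k, A k (α j) * e8Inv j i * A k (α i) = e8Inv j i * (60 * e8Gram i j) := by
      intro i j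
      rw [← hα, ← hA.design, Finset.mul_sum]
      exact Finset.sum_congr rfl fun k _ ↦ by rw [hA.symm k (α i)]; ring
    rw [Finset.sum_sub_distrib, Finset.sum_comm]
    simp only [c, coord, Finset.sum_mul]
    rw [Finset.sum_congr rfl fun i _ ↦ Finset.sum_comm]
    simp only [h1, Finset.sum_const, Finset.card_univ, hA.card]
    have : ∑ i, ∑ j, e8Inv j i * (60 * e8Gram i j) = 480 := by decide +kernel
    rw [this]
    norm_num
  rw [Finset.sum_eq_zero_iff_of_nonneg fun k _ ↦ hnn k] at htot
  have h0 := hA.eq_zero_of_form_eq_zero _ _ ((hform k).trans (htot k (Finset.mem_univ k))) l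
  simp only [Fintype.sum_option, Option.elim_none, Option.elim_some, one_mul, neg_mul,
    Finset.sum_neg_distrib] at h0
  linarith

lemma coord_injective (hA : IsE8Matrix A) (hα : IsFrame A α) :
    Function.Injective (coord A α) := fun i j h ↦ hA.ext_left fun k ↦ by
  rw [hA.eq_sum_coord hα, hA.eq_sum_coord hα j, h]

lemma coord_add {i j k : ι} (h : ∀ l, A k l = A i l + A j l) :
    coord A α k = coord A α i + coord A α j := by
  ext a
  simp only [coord, h, Pi.add_apply, add_mul, Finset.sum_add_distrib]

lemma coord_neg {i k : ι} (h : ∀ l, A k l = -A i l) : coord A α k = -coord A α i := by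
  ext a
  simp only [coord, h, Pi.neg_apply, neg_mul, Finset.sum_neg_distrib]

/-- The quadratic form of the `E₈` lattice. -/
def e8Form (c d : Fin 8 → ℤ) : ℤ := ∑ i, ∑ j, c i * d j * e8Gram i j

lemma e8Form_coord (hA : IsE8Matrix A) (hα : IsFrame A α) (k l : ι) :
    e8Form (coord A α k) (coord A α l) = A k l := by
  rw [hA.eq_sum_coord hα k l, e8Form]
  refine Finset.sum_congr rfl fun i _ ↦ ?_
  rw [hA.symm, hA.eq_sum_coord hα l (α i), Finset.mul_sum]
  refine Finset.sum_congr rfl fun j _ ↦ ?_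
  rw [hα, ← hα i j, hA.symm, hα]
  ring

lemma two_le_e8Form (hA : IsE8Matrix A) (hα : IsFrame A α) {c : Fin 8 → ℤ} (hc : c ≠ 0) :
    2 ≤ e8Form c c := by
  have h1 : 0 ≤ e8Form c c := by
    have := hA.form_nonneg c α
    unfold e8Form
    simpa only [hα _ _] using this
  have h2 : e8Form c c ≠ 0 := by
    intro h
    apply hc
    have h3 := hA.eq_zero_of_form_eq_zero c α (by
      unfold e8Form at h
      simpa only [hα _ _] using h)
    have h4 : Matrix.vecMul c e8Gram = 0 := by
      ext j
      have := h3 (α j)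
      change ∑ x, c x * e8Gram x j = 0
      simpa only [hα _ _] using this
    have h5 : Matrix.vecMul c (e8Gram * e8Inv) = 0 := by
      rw [← Matrix.vecMul_vecMul, h4, Matrix.zero_vecMul]
    simpa [e8Gram_mul_e8Inv] using h5
  have h3 : ∃ m, e8Form c c = 2 * m := by
    refine ⟨∑ i, c i ^ 2 - (c 0 * c 1 + c 1 * c 2 + c 2 * c 3 + c 1 * c 4 + c 4 * c 5 +
      c 5 * c 6 + c 6 * c 7), ?_⟩
    simp only [e8Form, Fin.sum_univ_eight, e8Gram, Matrix.of_apply, Matrix.cons_val]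
    ring
  omega

lemma coord_nonneg_or_nonpos (hA : IsE8Matrix A) (hα : IsFrame A α) (k : ι) :
    0 ≤ coord A α k ∨ coord A α k ≤ 0 := by
  set c := coord A α k with hc
  by_contra! hcon
  have h0 : e8Form c c = 2 := by rw [hc, hA.e8Form_coord hα, hA.diag]
  have hp : c⁺ ≠ 0 := fun h ↦ hcon.2 (posPart_eq_zero.mp h)
  have hm : c⁻ ≠ 0 := fun h ↦ hcon.1 (negPart_eq_zero.mp h)
  have h1 := hA.two_le_e8Form hα hp
  have h2 := hA.two_le_e8Form hα hm
  have h3 : e8Form c⁺ c⁻ ≤ 0 := by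
    refine Finset.sum_nonpos fun i _ ↦ Finset.sum_nonpos fun j _ ↦ ?_
    by_cases hij : i = j
    · subst hij
      have : c⁺ i * c⁻ i = 0 := by
        rw [Pi.posPart_apply, Pi.negPart_apply]
        rcases le_total (c i) 0 with h | h
        · rw [posPart_eq_zero.mpr h, zero_mul]
        · rw [negPart_eq_zero.mpr h, mul_zero]
      rw [this, zero_mul]
    · exact mul_nonpos_of_nonneg_of_nonpos
        (mul_nonneg (posPart_nonneg c i) (negPart_nonneg c j)) (e8Gram_nonpos i j hij)
  have h4 : e8Form c c = e8Form c⁺ c⁺ + e8Form c⁻ c⁻ - 2 * e8Form c⁺ c⁻ := by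
    have h5 : ∀ i, c i = c⁺ i - c⁻ i := fun i ↦ (congrFun (posPart_sub_negPart c) i).symm
    have h6 : e8Form c⁺ c⁻ = e8Form c⁻ c⁺ := by
      rw [e8Form, Finset.sum_comm]
      exact Finset.sum_congr rfl fun i _ ↦ Finset.sum_congr rfl fun j _ ↦ by rw [e8Gram_symm]; ring
    have h7 : e8Form c c = e8Form c⁺ c⁺ + e8Form c⁻ c⁻ - e8Form c⁺ c⁻ - e8Form c⁻ c⁺ := by
      simp only [e8Form, ← Finset.sum_add_distrib, ← Finset.sum_sub_distrib]
      exact Finset.sum_congr rfl fun i _ ↦ Finset.sum_congr rfl fun j _ ↦ by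
        rw [h5 i, h5 j]; ring
    omega
  omega

/-- Induction on the height of positive roots. -/
theorem pos_induction (hA : IsE8Matrix A) (hα : IsFrame A α) {p : ι → Prop}
    (simple : ∀ i, p (α i))
    (step : ∀ k l i, 0 ≤ coord A α k → p k → A k (α i) = -1 →
      (∀ m, A l m = A k m + A (α i) m) → p l) (k : ι) (hk : 0 ≤ coord A α k) : p k := by
  obtain ⟨n, hn⟩ : ∃ n : ℕ, ∑ i, coord A α k i = n :=
    ⟨_, (Int.toNat_of_nonneg (Finset.sum_nonneg fun i _ ↦ hk i)).symm⟩
  induction n using Nat.strong_induction_on generalizing k with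
  | _ n ih =>
  obtain ⟨i, hi⟩ : ∃ i, 0 < A k (α i) := by
    by_contra! hcon
    have h1 := hA.eq_sum_coord hα k k
    rw [hA.diag] at h1
    have h2 : ∑ i, coord A α k i * A (α i) k ≤ 0 := Finset.sum_nonpos fun i _ ↦
      mul_nonpos_of_nonneg_of_nonpos (hk i) (by rw [hA.symm]; exact hcon i)
    omega
  have h2 := hA.le_two k (α i)
  by_cases h3 : A k (α i) = 2
  · rw [hA.inj _ _ h3]; exact simple i
  obtain ⟨l, hl⟩ := hA.exists_sub (show A k (α i) = 1 by omega)
  have hcl : coord A α k = coord A α l + coord A α (α i) := coord_add fun m ↦ by rw [hl]; ring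
  rw [coord_frame hα] at hcl
  have hsum : ∑ j, coord A α k j = ∑ j, coord A α l j + 1 := by
    rw [hcl]
    simp [Finset.sum_add_distrib]
  have hpos : 0 ≤ coord A α l := by
    rcases hA.coord_nonneg_or_nonpos hα l with h | h
    · exact h
    · exfalso
      apply h3
      have hk' : coord A α k = Pi.single i 1 := by
        have hne : coord A α k i ≠ 0 := by
          intro h0
          have : coord A α k = 0 := by
            ext j
            by_cases hj : j = i
            · rw [hj, h0]; rfl
            · have a1 := congrFun hcl j
              have a2 := hk j
              have a3 := h j
              simp only [Pi.add_apply, Pi.single_eq_of_ne hj, Pi.zero_apply] at a1 a2 a3 ⊢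
              omega
          have h4 := hA.e8Form_coord hα k k
          rw [this, hA.diag] at h4
          simp [e8Form] at h4
        ext j
        have a1 := congrFun hcl j
        have a2 := hk j
        have a3 := h j
        by_cases hj : j = i
        · subst hj
          simp only [Pi.add_apply, Pi.single_eq_same, Pi.zero_apply] at a1 a2 a3 ⊢
          omega
        · simp only [Pi.add_apply, Pi.single_eq_of_ne hj, Pi.zero_apply] at a1 a2 a3 ⊢
          omega
      rw [← coord_frame hα] at hk'
      rw [hA.coord_injective hα hk', hA.diag]
  refine step l k i hpos (ih (∑ j, coord A α l j).toNat ?_ l hpos ?_) ?_ fun m ↦ by rw [hl]; ring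
  · have := Finset.sum_nonneg fun j (_ : j ∈ Finset.univ) ↦ hpos j
    omega
  · exact (Int.toNat_of_nonneg (Finset.sum_nonneg fun i _ ↦ hpos i)).symm
  · rw [hl, hA.diag]; omega

end IsE8Matrix

lemma LieEquiv.apply_symm_apply_eq {K P L₁ L₂ : Type*} [CommRing K] [LieRing P] [LieRing L₁]
    [LieRing L₂] [LieAlgebra K P] [LieAlgebra K L₁] [LieAlgebra K L₂] (l : P ≃ₗ⁅K⁆ L₁)
    (r : P ≃ₗ⁅K⁆ L₂) {x : L₁} {y : L₂} (h : ∃ p, l p = x ∧ r p = y) :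
    (l.symm.trans r) x = y := by
  obtain ⟨p, rfl, rfl⟩ := h
  rw [LieEquiv.trans_apply, LieEquiv.symm_apply_apply]

/-- The isomorphism theorem: Chevalley generators with equal Cartan matrices are conjugate. -/
lemma LieAlgebra.Basis.exists_lieEquiv {ι K L : Type*} [Finite ι] [Field K] [CharZero K] [LieRing L]
    [LieAlgebra K L] [FiniteDimensional K L] [IsSimple K L] {H₁ H₂ : LieSubalgebra K L}
    (b₁ : Basis ι H₁) (b₂ : Basis ι H₂) (hA : b₁.A = b₂.A) :
    ∃ φ : L ≃ₗ⁅K⁆ L, (∀ i, φ (b₁.h i) = b₂.h i) ∧ (∀ i, φ (b₁.e i) = b₂.e i) ∧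
      ∀ i, φ (b₁.f i) = b₂.f i := by
  refine ⟨LieAlgebra.Basis.equivOfReindex (Equiv.refl ι) b₁ b₂ (by simpa using hA), fun i ↦ ?_,
    fun i ↦ ?_, fun i ↦ ?_⟩ <;>
    (unfold LieAlgebra.Basis.equivOfReindex; apply LieEquiv.apply_symm_apply_eq)
  · exact ⟨⟨(b₁.h i, b₂.h i), LieSubalgebra.subset_lieSpan (Or.inl (Or.inl ⟨i, rfl⟩))⟩, rfl, rfl⟩
  · exact ⟨⟨(b₁.e i, b₂.e i), LieSubalgebra.subset_lieSpan (Or.inl (Or.inr ⟨i, rfl⟩))⟩, rfl, rfl⟩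
  · exact ⟨⟨(b₁.f i, b₂.f i), LieSubalgebra.subset_lieSpan (Or.inr ⟨i, rfl⟩)⟩, rfl, rfl⟩

/-- The root-space data of a split simple Lie algebra of type `E₈`: the Cartan integers `A`, the
coroots `h` and the root spaces `V`. -/
structure IsE8Datum (K : Type*) {L R : Type*} [Field K] [LieRing L] [LieAlgebra K L] [Fintype R]
    (A : R → R → ℤ) (h : R → L) (V : R → Submodule K L) : Prop where
  isE8Matrix : IsE8Matrix A
  mem_iff : ∀ k x, x ∈ V k ↔ ∀ l, ⁅h l, x⁆ = (A k l : K) • x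
  lie_h_h : ∀ k l, ⁅h k, h l⁆ = 0
  finrank_eq_one : ∀ k, finrank K (V k) = 1
  span_sup : Submodule.span K (Set.range h) ⊔ ⨆ k, V k = ⊤
  exists_root : ∀ (χ : R → K) (x : L), x ≠ 0 → χ ≠ 0 → (∀ l, ⁅h l, x⁆ = χ l • x) →
    ∃ k, ∀ l, χ l = A k l
  exists_triple : ∀ k, ∃ e f, e ∈ V k ∧ (∀ l, ⁅h l, f⁆ = (-A k l : K) • f) ∧
    IsSl2Triple (h k) e f
  finrank_span : finrank K (Submodule.span K (Set.range h)) = 8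

lemma Submodule.finrank_eq_sum_of_isInternal {ι K L : Type*} [Fintype ι] [DecidableEq ι] [Field K]
    [AddCommGroup L] [Module K L] [FiniteDimensional K L] {V : ι → Submodule K L}
    (hV : DirectSum.IsInternal V) : finrank K L = ∑ i, finrank K (V i) := by
  rw [← Module.finrank_directSum]
  exact (LinearEquiv.ofBijective (DirectSum.coeLinearMap V) hV).finrank_eq.symm

section

open LieAlgebra LieModule IsKilling

variable {K L : Type*} [Field K] [CharZero K] [IsAlgClosed K] [LieRing L] [LieAlgebra K L]
  [FiniteDimensional K L] [IsSimple K L] (H : LieSubalgebra K L) [H.IsCartanSubalgebra]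

lemma finrank_cartan_add_card_root : finrank K H + Fintype.card H.root = finrank K L := by
  classical
  have : Nontrivial L := IsSimple.nontrivial K L
  have h_int : DirectSum.IsInternal
      fun χ : Weight K H L ↦ (genWeightSpace L χ).toSubmodule := by
    rw [DirectSum.isInternal_submodule_iff_iSupIndep_and_iSup_eq_top]
    constructor
    · exact LieSubmodule.iSupIndep_toSubmodule.mpr (iSupIndep_genWeightSpace' K H L)
    · rw [← LieSubmodule.iSup_toSubmodule, iSup_genWeightSpace_eq_top' K H L]; rfl
  rw [Submodule.finrank_eq_sum_of_isInternal h_int, ← Finset.sum_add_sum_compl H.root, add_comm]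
  congr 1
  · rw [Fintype.card_coe, Finset.card_eq_sum_ones]
    refine Finset.sum_congr rfl fun α hα ↦ (finrank_rootSpace_eq_one α ?_).symm
    simpa using hα
  · have : H.rootᶜ = {(0 : Weight K H L)} := by
      ext α
      simp [Weight.IsZero, Weight.IsNonZero]
    rw [this, Finset.sum_singleton]
    change finrank K H = finrank K (rootSpace H (0 : H → K))
    rw [rootSpace_zero_eq]
    rfl

theorem exists_isE8Datum (hL : finrank K L = 248) :
    ∃ (A : H.root → H.root → ℤ) (h : H.root → L) (V : H.root → Submodule K L),
      IsE8Datum K A h V ∧ Submodule.span K (Set.range h) = H.toSubmodule := by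
  classical
  let P := rootSystem H
  have hsum : finrank K (Dual K H) + Fintype.card H.root = 248 := by
    rw [Subspace.dual_finrank_eq, finrank_cartan_add_card_root, hL]
  have hsymm := P.pairingIn_symm_of_card hsum
  obtain ⟨h8, h240, hdes⟩ := P.numerics_of_card hsum
  have hpair : ∀ k l : H.root, (k : Weight K H L) (coroot (l : Weight K H L)) =
      (P.pairingIn ℤ k l : K) := fun k l ↦ by
    have := P.algebraMap_pairingIn ℤ k l
    rw [← rootSystem_pairing_apply]
    exact this.symm
  have hE8 : IsE8Matrix (P.pairingIn ℤ) := by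
    refine ⟨hsymm, fun i ↦ P.pairingIn_same ℤ i, fun i j h ↦ ?_, fun i j ↦ ?_, hdes, h240⟩
    · rcases P.pairingIn_cases hsymm i j with h' | h' | h' | h' | h' <;>
        first | exact h'.2 | (rw [h] at h'; norm_num at h')
    · exact ⟨P.reflectionPerm j i, P.pairingIn_reflectionPerm_left i j⟩
  have hc : Submodule.span K (Set.range fun k : H.root ↦ coroot (k : Weight K H L)) = ⊤ :=
    RootPairing.IsRootSystem.span_coroot_eq_top (P := P)
  have hspan : Submodule.span K (Set.range fun k : H.root ↦ (coroot (k : Weight K H L) : L)) =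
      H.toSubmodule := by
    have h2 := congrArg (Submodule.map H.toSubmodule.subtype) hc
    rw [Submodule.map_span, Submodule.map_subtype_top, ← Set.range_comp] at h2
    exact h2
  have hnz : ∀ k : H.root, (k : Weight K H L).IsNonZero := LieSubalgebra.isNonZero_coe_root
  have hmem : ∀ (k : H.root) (x : L), x ∈ (rootSpace H (k : Weight K H L)).toSubmodule ↔
      ∀ l : H.root, ⁅(coroot (l : Weight K H L) : L), x⁆ = (P.pairingIn ℤ k l : K) • x := by
    refine fun k x ↦ ⟨fun hx l ↦ ?_, fun hx ↦ ?_⟩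
    · rw [← hpair]
      exact lie_eq_smul_of_mem_rootSpace hx (coroot (l : Weight K H L))
    · apply weightSpace_le_genWeightSpace L (k : Weight K H L)
      rw [mem_weightSpace]
      intro y
      have hy : y ∈ Submodule.span K (Set.range fun k : H.root ↦ coroot (k : Weight K H L)) :=
        hc ▸ Submodule.mem_top
      induction hy using Submodule.span_induction with
      | mem y hy => obtain ⟨l, rfl⟩ := hy; rw [hpair]; exact hx l
      | zero => rw [zero_lie, ← Weight.toLinear_apply, map_zero, zero_smul]
      | add y z _ _ hy hz =>
        rw [add_lie, hy, hz, ← Weight.toLinear_apply, ← Weight.toLinear_apply,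
          ← Weight.toLinear_apply, map_add, add_smul]
      | smul t y _ hy =>
        rw [smul_lie, hy, ← Weight.toLinear_apply, ← Weight.toLinear_apply, map_smul, smul_smul,
          smul_eq_mul]
  refine ⟨P.pairingIn ℤ, fun k ↦ coroot (k : Weight K H L),
    fun k ↦ (rootSpace H (k : Weight K H L)).toSubmodule,
    ⟨hE8, hmem, ?_, ?_, ?_, ?_, ?_, ?_⟩, hspan⟩
  · intro k l
    exact congrArg Subtype.val
      (LieModule.IsTrivial.trivial (coroot (k : Weight K H L)) (coroot (l : Weight K H L)))
  · exact fun k ↦ finrank_rootSpace_eq_one _ (hnz k)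
  · have : Nontrivial L := IsSimple.nontrivial K L
    rw [hspan, eq_top_iff]
    have htop := congrArg LieSubmodule.toSubmodule (iSup_genWeightSpace_eq_top' K H L)
    rw [LieSubmodule.iSup_toSubmodule, LieSubmodule.top_toSubmodule] at htop
    rw [← htop]
    refine iSup_le fun χ ↦ ?_
    by_cases hχ : χ.IsZero
    · refine le_sup_of_le_left ?_
      rw [show (χ : H → K) = 0 from hχ]
      change (rootSpace H (0 : H → K)).toSubmodule ≤ _
      rw [rootSpace_zero_eq]
      rfl
    · exact le_sup_of_le_right (le_iSup_of_le (⟨χ, by simpa using hχ⟩ : H.root) le_rfl)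
  · intro χ x hx hχ hl
    have hex : ∀ y : H, ∃ c : K, ⁅(y : L), x⁆ = c • x := by
      intro y
      have hy : y ∈ Submodule.span K (Set.range fun k : H.root ↦ coroot (k : Weight K H L)) :=
        hc ▸ Submodule.mem_top
      induction hy using Submodule.span_induction with
      | mem y hy => obtain ⟨l, rfl⟩ := hy; exact ⟨χ l, hl l⟩
      | zero => exact ⟨0, by simp⟩
      | add y z _ _ hy hz =>
        obtain ⟨a, ha⟩ := hy
        obtain ⟨b, hb⟩ := hz
        exact ⟨a + b, by rw [H.coe_add, add_lie, ha, hb, add_smul]⟩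
      | smul t y _ hy =>
        obtain ⟨a, ha⟩ := hy
        exact ⟨t * a, by rw [H.coe_smul, smul_lie, ha, mul_smul]⟩
    choose ψ hψ using hex
    have hψl : ∀ l : H.root, ψ (coroot (l : Weight K H L)) = χ l := fun l ↦
      smul_left_injective K hx ((hψ _).symm.trans (hl l))
    have hxψ : x ∈ genWeightSpace L ψ := by
      apply weightSpace_le_genWeightSpace L ψ
      rw [mem_weightSpace]
      exact hψ
    let w : Weight K H L := ⟨ψ, fun h ↦ hx (by rwa [h, LieSubmodule.mem_bot] at hxψ)⟩
    have hw : w ∈ H.root := by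
      have : w.IsNonZero := fun h0 ↦ hχ (funext fun l ↦ by
        rw [← hψl]
        exact congrFun h0 _)
      simpa using this
    refine ⟨⟨w, hw⟩, fun l ↦ ?_⟩
    rw [← hψl, ← hpair]
    rfl
  · intro k
    obtain ⟨h', e, f, ht, he, hf⟩ := exists_isSl2Triple_of_weight_isNonZero (hnz k)
    refine ⟨e, f, he, fun l ↦ ?_, ht.h_eq_coroot (hnz k) he hf ▸ ht⟩
    rw [← hpair]
    exact lie_eq_smul_of_mem_rootSpace hf (coroot (l : Weight K H L))
  · rw [hspan]
    change finrank K H = 8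
    rw [← Subspace.dual_finrank_eq, h8]

end

/-- A property of roots closed under sums that holds for the simple roots and their negatives
holds for all roots. -/
theorem IsE8Matrix.add_induction {ι : Type*} [Fintype ι] {A : ι → ι → ℤ} {α : Fin 8 → ι}
    (hA : IsE8Matrix A) (hα : IsFrame A α) {p : ι → Prop} (simple : ∀ i, p (α i))
    (simple_neg : ∀ i k, (∀ m, A k m = -A (α i) m) → p k)
    (add : ∀ k l m, p k → p l → A k l = -1 → (∀ n, A m n = A k n + A l n) → p m) (k : ι) : p k := by
  have key : ∀ k, 0 ≤ coord A α k → p k ∧ ∀ k', (∀ m, A k' m = -A k m) → p k' := by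
    refine hA.pos_induction hα (fun i ↦ ⟨simple i, simple_neg i⟩) fun k l i _ ih hki hl ↦
      ⟨add _ _ _ ih.1 (simple i) hki hl, fun l' hl' ↦ ?_⟩
    obtain ⟨k', hk'⟩ := hA.exists_neg k
    obtain ⟨j, hj⟩ := hA.exists_neg (α i)
    refine add k' j l' (ih.2 _ hk') (simple_neg i _ hj) ?_ fun n ↦ ?_
    · rw [hk', hA.symm, hj, hA.symm, hki]; rfl
    · rw [hl', hl, hk', hj]; ring
  rcases hA.coord_nonneg_or_nonpos hα k with h | h
  · exact (key k h).1
  · obtain ⟨k', hk'⟩ := hA.exists_neg k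
    refine (key k' ?_).2 k fun m ↦ by rw [hk', neg_neg]
    rw [coord_neg hk']
    exact neg_nonneg.mpr h

namespace IsE8Datum

variable {K L R : Type*} [Field K] [CharZero K] [LieRing L] [LieAlgebra K L]
  [FiniteDimensional K L] [Fintype R] {A : R → R → ℤ} {h : R → L}
  {V : R → Submodule K L}

lemma exists_ne_zero (D : IsE8Datum K A h V) (k : R) : ∃ e ∈ V k, e ≠ 0 := by
  obtain ⟨e, he, -⟩ := finrank_eq_one_iff'.mp (D.finrank_eq_one k)
  exact ⟨e, e.2, by simpa using he⟩

lemma exists_smul (D : IsE8Datum K A h V) {k : R} {x y : L} (hx : x ∈ V k) (hy : y ∈ V k)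
    (hx0 : x ≠ 0) : ∃ c : K, y = c • x := by
  obtain ⟨c, hc⟩ := exists_smul_eq_of_finrank_eq_one (D.finrank_eq_one k)
    (x := ⟨x, hx⟩) (by simpa using hx0) ⟨y, hy⟩
  exact ⟨c, (congrArg Subtype.val hc).symm⟩

lemma lie_mem (D : IsE8Datum K A h V) {k l m : R} (hm : ∀ n, A m n = A k n + A l n) {x y : L}
    (hx : x ∈ V k) (hy : y ∈ V l) : ⁅x, y⁆ ∈ V m := by
  rw [D.mem_iff] at hx hy ⊢
  intro n
  rw [leibniz_lie, hx, hy, hm, smul_lie, lie_smul, Int.cast_add, add_smul]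

lemma lie_ne_zero (D : IsE8Datum K A h V) {k l : R} (hkl : A k l = -1) {x y : L} (hx : x ∈ V k)
    (hy : y ∈ V l) (hx0 : x ≠ 0) (hy0 : y ≠ 0) : ⁅x, y⁆ ≠ 0 := by
  intro h0
  obtain ⟨e, f, he, -, ht⟩ := D.exists_triple k
  obtain ⟨c, rfl⟩ := D.exists_smul hx he hx0
  have hp : ht.HasPrimitiveVectorWith y (-1 : K) :=
    ⟨hy0, by rw [(D.mem_iff l y).mp hy k, D.isE8Matrix.symm, hkl]; norm_num,
      by rw [smul_lie, h0, smul_zero]⟩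
  obtain ⟨n, hn⟩ := hp.exists_nat
  have : ((n + 1 : ℕ) : K) = 0 := by push_cast; rw [← hn]; ring
  exact absurd (Nat.cast_eq_zero.mp this) (by omega)

lemma mem_of_lie (D : IsE8Datum K A h V) {k l m : R} (hkl : A k l = -1)
    (hm : ∀ n, A m n = A k n + A l n) {S : LieSubalgebra K L} (hk : V k ≤ S.toSubmodule)
    (hl : V l ≤ S.toSubmodule) : V m ≤ S.toSubmodule := by
  intro z hz
  obtain ⟨x, hx, hx0⟩ := D.exists_ne_zero k
  obtain ⟨y, hy, hy0⟩ := D.exists_ne_zero l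
  obtain ⟨c, rfl⟩ := D.exists_smul (D.lie_mem hm hx hy) hz (D.lie_ne_zero hkl hx hy hx0 hy0)
  exact S.smul_mem c (S.lie_mem (hk hx) (hl hy))

lemma linearIndependent (D : IsE8Datum K A h V) {α : Fin 8 → R} (hα : IsE8Matrix.IsFrame A α) :
    LinearIndependent K fun i ↦ h (α i) := by
  rw [Fintype.linearIndependent_iff]
  intro c hc
  have h1 : Matrix.vecMul c (e8Gram.map (Int.cast : ℤ → K)) = 0 := by
    ext j
    obtain ⟨e, he, he0⟩ := D.exists_ne_zero (α j)
    have h2 := congrArg (⁅·, e⁆) hc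
    simp only [_root_.sum_lie, smul_lie, (D.mem_iff _ _).mp he, smul_smul, ← Finset.sum_smul,
      zero_lie] at h2
    have h3 := (smul_eq_zero.mp h2).resolve_right he0
    refine Eq.trans ?_ h3
    change ∑ i, c i * (e8Gram i j : K) = _
    refine Finset.sum_congr rfl fun i _ ↦ ?_
    rw [hα, e8Gram_symm]
  have h4 : e8Gram.map (Int.cast : ℤ → K) * e8Inv.map (Int.cast : ℤ → K) = 1 := by
    have := congrArg (fun M ↦ M.map (Int.castRingHom K)) e8Gram_mul_e8Inv
    rw [Matrix.map_mul] at this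
    simpa using this
  have h5 : Matrix.vecMul c (e8Gram.map (Int.cast : ℤ → K) * e8Inv.map (Int.cast : ℤ → K)) = 0 := by
    rw [← Matrix.vecMul_vecMul, h1, Matrix.zero_vecMul]
  rw [h4, Matrix.vecMul_one] at h5
  exact congrFun h5

lemma span_frame (D : IsE8Datum K A h V) {α : Fin 8 → R} (hα : IsE8Matrix.IsFrame A α) :
    Submodule.span K (Set.range fun i ↦ h (α i)) = Submodule.span K (Set.range h) := by
  apply Submodule.eq_of_le_of_finrank_eq
  · refine Submodule.span_mono ?_
    rintro - ⟨i, rfl⟩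
    exact ⟨α i, rfl⟩
  · rw [finrank_span_eq_card (D.linearIndependent hα), D.finrank_span]
    rfl

/-- A triple whose positive part is a given root vector. -/
lemma exists_triple_of_mem (D : IsE8Datum K A h V) {k : R} {e : L} (he : e ∈ V k) (he0 : e ≠ 0) :
    ∃ f, (∀ l, ⁅h l, f⁆ = (-A k l : K) • f) ∧ IsSl2Triple (h k) e f := by
  obtain ⟨e', f, he', hf, ht⟩ := D.exists_triple k
  obtain ⟨c, rfl⟩ := D.exists_smul he he' he0
  have hc : c ≠ 0 := by
    rintro rfl
    exact ht.e_ne_zero (zero_smul _ _)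
  refine ⟨c • f, fun l ↦ by rw [lie_smul, hf, smul_comm], ht.h_ne_zero, ?_, ?_, ?_⟩
  · rw [lie_smul, ← smul_lie, ht.lie_e_f]
  · have := ht.lie_h_e_nsmul
    rw [lie_smul, smul_comm] at this
    exact smul_right_injective L hc this
  · rw [lie_smul, ht.lie_h_f_nsmul, smul_neg, smul_comm]

/-- A frame together with a choice of simple root vectors gives Chevalley generators. -/
theorem exists_basis (D : IsE8Datum K A h V) {α : Fin 8 → R} (hα : IsE8Matrix.IsFrame A α)
    {e : Fin 8 → L} (he : ∀ i, e i ∈ V (α i)) (he0 : ∀ i, e i ≠ 0) :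
    ∃ (H : LieSubalgebra K L) (b : LieAlgebra.Basis (Fin 8) H), b.A = e8Gram ∧
      (∀ i, b.h i = h (α i)) ∧ ∀ i, b.e i = e i := by
  choose f hf ht using fun i ↦ D.exists_triple_of_mem (he i) (he0 i)
  have hA := D.isE8Matrix
  refine ⟨_, { A := e8Gram, h := fun i ↦ h (α i), e := e, f := f, cartan_eq_lieSpan := rfl,
               span_ef := ?_, linInd := D.linearIndependent hα, nondegen := ?_, sl2 := ht,
               lie_h_h := fun i j ↦ D.lie_h_h _ _, lie_h_e := ?_, lie_h_f := ?_,
               lie_e_f_ne := ?_ }, rfl, fun _ ↦ rfl, fun _ ↦ rfl⟩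
  · set S := LieSubalgebra.lieSpan K L (Set.range e ∪ Set.range f) with hS
    have heS : ∀ i, e i ∈ S := fun i ↦ LieSubalgebra.subset_lieSpan (Or.inl ⟨i, rfl⟩)
    have hfS : ∀ i, f i ∈ S := fun i ↦ LieSubalgebra.subset_lieSpan (Or.inr ⟨i, rfl⟩)
    have hV : ∀ k, V k ≤ S.toSubmodule := by
      refine hA.add_induction hα (fun i x hx ↦ ?_) (fun i k hk x hx ↦ ?_)
        fun k l m hk hl hkl hm ↦ D.mem_of_lie hkl hm hk hl
      · obtain ⟨c, rfl⟩ := D.exists_smul (he i) hx (he0 i)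
        exact S.smul_mem c (heS i)
      · have hfk : f i ∈ V k := (D.mem_iff _ _).mpr fun l ↦ by rw [hf, hk, Int.cast_neg]
        obtain ⟨c, rfl⟩ := D.exists_smul hfk hx (ht i).f_ne_zero
        exact S.smul_mem c (hfS i)
    have hh : Submodule.span K (Set.range h) ≤ S.toSubmodule := by
      rw [← D.span_frame hα, Submodule.span_le]
      rintro - ⟨i, rfl⟩
      change h (α i) ∈ S
      rw [← (ht i).lie_e_f]
      exact S.lie_mem (heS i) (hfS i)
    rw [← LieSubalgebra.toSubmodule_inj, LieSubalgebra.top_toSubmodule, eq_top_iff, ← D.span_sup]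
    exact sup_le hh (iSup_le hV)
  · apply Matrix.nondegenerate_of_det_ne_zero
    have := congrArg Matrix.det e8Gram_mul_e8Inv
    rw [Matrix.det_mul, Matrix.det_one] at this
    exact left_ne_zero_of_mul_eq_one this
  · intro i j
    rw [(D.mem_iff _ _).mp (he i), hα, Int.cast_smul_eq_zsmul]
  · intro i j
    rw [hf, hα, neg_smul, neg_smul, Int.cast_smul_eq_zsmul]
  · intro i j hij
    by_contra h0
    have hG := e8Gram_nonpos i j hij
    have hx : ∀ l, ⁅h l, ⁅e i, f j⁆⁆ = ((A (α i) l - A (α j) l : ℤ) : K) • ⁅e i, f j⁆ := fun l ↦ by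
      rw [leibniz_lie, (D.mem_iff _ _).mp (he i), hf, smul_lie, lie_smul, ← add_smul]
      push_cast
      ring_nf
    obtain ⟨k, hk⟩ := D.exists_root (fun l ↦ ((A (α i) l - A (α j) l : ℤ) : K)) _ h0
      (fun h1 ↦ by
        have := congrFun h1 (α i)
        simp only [hA.diag, Pi.zero_apply, Int.cast_eq_zero] at this
        rw [hα, e8Gram_symm] at this
        omega) hx
    simp only [Int.cast_inj] at hk
    have h1 := hk (α i)
    have h2 := hk (α j)
    have h3 := hA.le_two k (α i)
    have h4 := hA.neg_two_le k (α j)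
    simp only [hα _ _] at h1 h2
    have h5 : ∀ i, e8Gram i i = 2 := fun i ↦ by rw [← hα, hA.diag]
    rw [h5] at h1 h2
    have h6 := e8Gram_symm i j
    have h7 : A k (α i) = 2 := by omega
    have h8 := hA.inj _ _ h7
    have h9 := hk (α j)
    rw [h8, hα, hα, h5] at h9
    omega

variable [LieAlgebra.IsSimple K L]

theorem exists_lieEquiv {R' : Type*} [Fintype R'] {A' : R' → R' → ℤ} {h' : R' → L}
    {V' : R' → Submodule K L} (D : IsE8Datum K A h V) (D' : IsE8Datum K A' h' V')
    {α : Fin 8 → R} (hα : IsE8Matrix.IsFrame A α) {α' : Fin 8 → R'}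
    (hα' : IsE8Matrix.IsFrame A' α') {e e' : Fin 8 → L} (he : ∀ i, e i ∈ V (α i))
    (he0 : ∀ i, e i ≠ 0) (he' : ∀ i, e' i ∈ V' (α' i)) (he0' : ∀ i, e' i ≠ 0) :
    ∃ φ : L ≃ₗ⁅K⁆ L, (∀ i, φ (h (α i)) = h' (α' i)) ∧ ∀ i, φ (e i) = e' i := by
  obtain ⟨H, b, hbA, hbh, hbe⟩ := D.exists_basis hα he he0
  obtain ⟨H', b', hbA', hbh', hbe'⟩ := D'.exists_basis hα' he' he0'
  obtain ⟨φ, h1, h2, -⟩ := b.exists_lieEquiv b' (hbA.trans hbA'.symm)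
  exact ⟨φ, fun i ↦ by rw [← hbh, h1, hbh'], fun i ↦ by rw [← hbe, h2, hbe']⟩

end IsE8Datum

/-- The character with values `u` on the simple roots. -/
def torusChar {M : Type*} [CommGroup M] (u : Fin 8 → M) (c : Fin 8 → ℤ) : M := ∏ i, u i ^ c i

section torusChar

variable {M : Type*} [CommGroup M] (u : Fin 8 → M) (c d : Fin 8 → ℤ)

lemma torusChar_add : torusChar u (c + d) = torusChar u c * torusChar u d := by
  simp [torusChar, zpow_add, Finset.prod_mul_distrib]

lemma torusChar_neg : torusChar u (-c) = (torusChar u c)⁻¹ := by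
  simp [torusChar, Finset.prod_inv_distrib]

lemma torusChar_single (i : Fin 8) : torusChar u (Pi.single i 1) = u i := by
  rw [torusChar, Finset.prod_eq_single i]
  · simp
  · intro j _ hj
    simp [Pi.single_eq_of_ne hj]
  · simp

lemma torusChar_vecMul (N : Matrix (Fin 8) (Fin 8) ℤ) :
    torusChar u (Matrix.vecMul c N) = torusChar (fun i ↦ torusChar u (N i)) c := by
  simp only [torusChar, Matrix.vecMul, dotProduct, ← Finset.prod_zpow, ← zpow_mul]
  rw [Finset.prod_comm]
  refine Finset.prod_congr rfl fun i _ ↦ ?_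
  simp only [mul_comm (N _ _)]
  induction (Finset.univ : Finset (Fin 8)) using Finset.cons_induction with
  | empty => simp
  | cons a s ha ih => rw [Finset.sum_cons, Finset.prod_cons, zpow_add, ih]

/-- Every character is of the form `k ↦ u (w k) / u k`, as `1 - w` divides `5`. -/
lemma exists_torusChar_e8Rot {K : Type*} [Field K] [IsAlgClosed K] (t : Fin 8 → Kˣ) :
    ∃ u : Fin 8 → Kˣ, ∀ c,
      torusChar u (Matrix.vecMul c e8Rot) = torusChar u c * torusChar t c := by
  have h5 : ∀ i, ∃ s : Kˣ, s ^ (5 : ℤ) = t i := fun i ↦ by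
    obtain ⟨s, hs⟩ := IsAlgClosed.exists_pow_nat_eq (t i : K) (n := 5) (by norm_num)
    have hs0 : s ≠ 0 := by
      rintro rfl
      exact (t i).ne_zero (by rw [← hs]; norm_num)
    refine ⟨Units.mk0 s hs0, Units.ext ?_⟩
    rw [Units.val_zpow_eq_zpow_val, Units.val_mk0]
    exact_mod_cast hs
  choose s hs using h5
  let N : Matrix (Fin 8) (Fin 8) ℤ := -(4 + 3 * e8Rot + 2 * e8Rot ^ 2 + e8Rot ^ 3)
  have hN : e8Rot * N = N + 5 := by decide +kernel
  refine ⟨fun i ↦ torusChar s (N i), fun c ↦ ?_⟩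
  rw [← torusChar_vecMul, ← torusChar_vecMul, Matrix.vecMul_vecMul, hN, Matrix.vecMul_add,
    torusChar_add, torusChar_vecMul s c 5]
  congr 2
  ext i
  rw [← hs, show (5 : Matrix (Fin 8) (Fin 8) ℤ) i = (5 : ℤ) • Pi.single i 1 from ?_]
  · have : torusChar s ((5 : ℤ) • Pi.single i 1) = s i ^ (5 : ℤ) := by
      rw [torusChar, Finset.prod_eq_single i]
      · simp
      · intro j _ hj
        simp [Pi.single_eq_of_ne hj]
      · simp
    rw [this]
  · ext j
    rw [Matrix.ofNat_apply]
    by_cases h : i = j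
    · subst h; simp
    · simp [h, Ne.symm h]

end torusChar

namespace IsE8Datum

variable {K L R : Type*} [Field K] [CharZero K] [LieRing L] [LieAlgebra K L]
  [FiniteDimensional K L] [Fintype R] {A : R → R → ℤ} {h : R → L}
  {V : R → Submodule K L}

lemma exists_smul_of_mem_span (D : IsE8Datum K A h V) {s : L}
    (hs : s ∈ Submodule.span K (Set.range h)) (k : R) : ∃ c : K, ∀ x ∈ V k, ⁅s, x⁆ = c • x := by
  induction hs using Submodule.span_induction with
  | mem s hs =>
    obtain ⟨l, rfl⟩ := hs
    exact ⟨A k l, fun x hx ↦ (D.mem_iff k x).mp hx l⟩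
  | zero => exact ⟨0, fun x _ ↦ by simp⟩
  | add s t _ _ hs ht =>
    obtain ⟨c, hc⟩ := hs
    obtain ⟨d, hd⟩ := ht
    exact ⟨c + d, fun x hx ↦ by rw [add_lie, hc x hx, hd x hx, add_smul]⟩
  | smul a s _ hs =>
    obtain ⟨c, hc⟩ := hs
    exact ⟨a * c, fun x hx ↦ by rw [smul_lie, hc x hx, mul_smul]⟩

lemma lie_mem_span (D : IsE8Datum K A h V) {s : L} (hs : s ∈ Submodule.span K (Set.range h))
    (l : R) : ⁅h l, s⁆ = 0 := by
  induction hs using Submodule.span_induction with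
  | mem s hs =>
    obtain ⟨k, rfl⟩ := hs
    exact D.lie_h_h l k
  | zero => exact lie_zero _
  | add s t _ _ hs ht => rw [lie_add, hs, ht, add_zero]
  | smul a s _ hs => rw [lie_smul, hs, smul_zero]

lemma h_ne_zero (D : IsE8Datum K A h V) (k : R) : h k ≠ 0 := by
  obtain ⟨e, f, -, -, ht⟩ := D.exists_triple k
  exact ht.h_ne_zero

/-- An isomorphism matching two Cartan subalgebras matches the roots. -/
theorem exists_map {L' R' : Type*} [LieRing L'] [LieAlgebra K L'] [FiniteDimensional K L']
    [Fintype R'] {A' : R' → R' → ℤ} {h' : R' → L'} {V' : R' → Submodule K L'}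
    (D : IsE8Datum K A h V) (D' : IsE8Datum K A' h' V') (φ : L ≃ₗ⁅K⁆ L')
    (hφ : ∀ k, φ (h k) ∈ Submodule.span K (Set.range h'))
    (hφ' : ∀ k, φ.symm (h' k) ∈ Submodule.span K (Set.range h)) :
    ∃ π : R → R', (∀ k, φ (h k) = h' (π k)) ∧ (∀ k, ∀ x ∈ V k, φ x ∈ V' (π k)) ∧
      ∀ k l, A' (π k) (π l) = A k l := by
  have hinj : ∀ x, φ x = 0 → x = 0 := fun x hx ↦ φ.injective (hx.trans (map_zero φ).symm)
  have hw : ∀ k, ∃ χ : R' → K, ∀ l, ∀ x ∈ V k, ⁅h' l, φ x⁆ = χ l • φ x := fun k ↦ by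
    choose χ hχ using fun l ↦ D.exists_smul_of_mem_span (hφ' l) k
    refine ⟨χ, fun l x hx ↦ ?_⟩
    have := congrArg φ (hχ l x hx)
    rwa [LieEquiv.map_lie, map_smul, LieEquiv.apply_symm_apply] at this
  have hπ : ∀ k, ∃ k', ∀ x ∈ V k, φ x ∈ V' k' := fun k ↦ by
    obtain ⟨χ, hχ⟩ := hw k
    obtain ⟨e, he, he0⟩ := D.exists_ne_zero k
    obtain ⟨k', hk'⟩ := D'.exists_root χ (φ e) (fun h0 ↦ he0 (hinj e h0)) (fun h0 ↦ by
      obtain ⟨s, hs, hs'⟩ : ∃ s, s ∈ Submodule.span K (Set.range h') ∧ φ (h k) = s :=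
        ⟨_, hφ k, rfl⟩
      have hz : ⁅s, φ e⁆ = 0 := by
        clear hs'
        induction hs using Submodule.span_induction with
        | mem s hs =>
          obtain ⟨l, rfl⟩ := hs
          rw [hχ l e he, h0, Pi.zero_apply, zero_smul]
        | zero => exact zero_lie _
        | add s t _ _ hs ht => rw [add_lie, hs, ht, add_zero]
        | smul a s _ hs => rw [smul_lie, hs, smul_zero]
      rw [← hs', ← LieEquiv.map_lie, (D.mem_iff k e).mp he, D.isE8Matrix.diag] at hz
      have := hinj _ hz
      simp [he0] at this) (fun l ↦ hχ l e he)
    exact ⟨k', fun x hx ↦ (D'.mem_iff _ _).mpr fun l ↦ by rw [hχ l x hx, hk']⟩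
  choose π hπ using hπ
  have hh : ∀ k, φ (h k) = h' (π k) := fun k ↦ by
    obtain ⟨e, f, he, hf, ht⟩ := D.exists_triple k
    obtain ⟨k₁, hk₁⟩ := D.isE8Matrix.exists_neg k
    have hf1 : f ∈ V k₁ := (D.mem_iff _ _).mpr fun l ↦ by rw [hf, hk₁, Int.cast_neg]
    have he0 : φ e ≠ 0 := fun h0 ↦ ht.e_ne_zero (hinj e h0)
    have hf0 : φ f ≠ 0 := fun h0 ↦ ht.f_ne_zero (hinj f h0)
    have hef : ⁅φ e, φ f⁆ = φ (h k) := by rw [← LieEquiv.map_lie, ht.lie_e_f]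
    have hopp : ∀ l, A' (π k₁) l = -A' (π k) l := fun l ↦ by
      have h1 := D'.lie_mem_span (hφ k) l
      rw [← hef, leibniz_lie, (D'.mem_iff _ _).mp (hπ k e he), (D'.mem_iff _ _).mp (hπ k₁ f hf1),
        smul_lie, lie_smul, ← add_smul, hef] at h1
      have h2 := (smul_eq_zero.mp h1).resolve_right fun h0 ↦ ht.h_ne_zero (hinj _ h0)
      have h3 : A' (π k) l + A' (π k₁) l = 0 := by exact_mod_cast h2
      omega
    obtain ⟨f', hf', ht'⟩ := D'.exists_triple_of_mem (hπ k e he) he0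
    have hf1' : f' ∈ V' (π k₁) := (D'.mem_iff _ _).mpr fun l ↦ by rw [hf', hopp, Int.cast_neg]
    obtain ⟨c, rfl⟩ := D'.exists_smul (hπ k₁ f hf1) hf1' hf0
    have h1 := ht'.lie_e_f
    rw [lie_smul, hef] at h1
    have h2 := (D'.mem_iff _ _).mp (hπ k e he) (π k)
    rw [← h1, smul_lie, ← LieEquiv.map_lie, (D.mem_iff _ _).mp he, D.isE8Matrix.diag,
      D'.isE8Matrix.diag, map_smul, smul_comm] at h2
    have h3 := smul_right_injective L' (r := ((2 : ℤ) : K)) (by norm_num) h2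
    have h4 : c = 1 := smul_left_injective K he0 (by simpa using h3)
    rw [← h1, h4, one_smul]
  refine ⟨π, hh, hπ, fun k l ↦ ?_⟩
  obtain ⟨e, he, he0⟩ := D.exists_ne_zero k
  have h1 := (D'.mem_iff _ _).mp (hπ k e he) (π l)
  rw [← hh, ← LieEquiv.map_lie, (D.mem_iff _ _).mp he, map_smul] at h1
  exact_mod_cast (smul_left_injective K (fun h0 ↦ he0 (hinj e h0)) h1).symm

lemma ext_of_eqOn (D : IsE8Datum K A h V) {φ ψ : L ≃ₗ⁅K⁆ L} (hh : ∀ k, φ (h k) = ψ (h k))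
    (hV : ∀ k, ∀ x ∈ V k, φ x = ψ x) (x : L) : φ x = ψ x := by
  have : (⊤ : Submodule K L) ≤ LinearMap.eqLocus φ.toLinearEquiv.toLinearMap
      ψ.toLinearEquiv.toLinearMap := by
    rw [← D.span_sup]
    refine sup_le (Submodule.span_le.mpr ?_) (iSup_le fun k x hx ↦ hV k x hx)
    rintro - ⟨k, rfl⟩
    exact hh k
  exact this (Submodule.mem_top (x := x))

/-- An automorphism fixing the Cartan subalgebra acts through a character of the root lattice. -/
theorem exists_torusChar (D : IsE8Datum K A h V) {α : Fin 8 → R} (hα : IsE8Matrix.IsFrame A α)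
    {φ : L ≃ₗ⁅K⁆ L} (hφ : ∀ k, φ (h k) = h k) :
    ∃ u : Fin 8 → Kˣ, ∀ k, ∀ x ∈ V k, φ x = (↑(torusChar u (IsE8Matrix.coord A α k)) : K) • x := by
  have hA := D.isE8Matrix
  have hinj : ∀ x, φ x = 0 → x = 0 := fun x hx ↦ φ.injective (hx.trans (map_zero φ).symm)
  have hρ : ∀ k, ∃ r : Kˣ, ∀ x ∈ V k, φ x = (r : K) • x := fun k ↦ by
    obtain ⟨e, he, he0⟩ := D.exists_ne_zero k
    have he' : φ e ∈ V k := (D.mem_iff k _).mpr fun l ↦ by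
      conv_lhs => rw [← hφ l]
      rw [← LieEquiv.map_lie, (D.mem_iff k e).mp he, map_smul]
    obtain ⟨c, hc⟩ := D.exists_smul he he' he0
    have hc0 : c ≠ 0 := by
      rintro rfl
      exact he0 (hinj e (by rw [hc, zero_smul]))
    refine ⟨Units.mk0 c hc0, fun x hx ↦ ?_⟩
    obtain ⟨d, rfl⟩ := D.exists_smul he hx he0
    rw [map_smul, hc, smul_comm]
    rfl
  choose ρ hρ using hρ
  refine ⟨fun i ↦ ρ (α i), fun k ↦ ?_⟩
  suffices ρ k = torusChar (fun i ↦ ρ (α i)) (IsE8Matrix.coord A α k) by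
    rw [← this]; exact hρ k
  refine hA.add_induction hα (p := fun k ↦ ρ k = torusChar (fun i ↦ ρ (α i))
    (IsE8Matrix.coord A α k)) (fun i ↦ ?_) (fun i k hk ↦ ?_) (fun k l m hk hl hkl hm ↦ ?_) k
  · rw [IsE8Matrix.coord_frame hα, torusChar_single]
  · rw [IsE8Matrix.coord_neg hk, IsE8Matrix.coord_frame hα, torusChar_neg, torusChar_single]
    obtain ⟨e, f, he, hf, ht⟩ := D.exists_triple (α i)
    have hf1 : f ∈ V k := (D.mem_iff _ _).mpr fun l ↦ by rw [hf, hk, Int.cast_neg]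
    have h1 := congrArg φ ht.lie_e_f
    rw [LieEquiv.map_lie, hφ, hρ _ _ he, hρ _ _ hf1, smul_lie, lie_smul, ht.lie_e_f,
      smul_smul] at h1
    have h2 : ((ρ (α i) : K) * ρ k) = 1 :=
      smul_left_injective K (D.h_ne_zero (α i)) (by simpa using h1)
    rw [eq_inv_iff_mul_eq_one, mul_comm]
    exact Units.ext h2
  · obtain ⟨x, hx, hx0⟩ := D.exists_ne_zero k
    obtain ⟨y, hy, hy0⟩ := D.exists_ne_zero l
    have h1 := hρ m _ (D.lie_mem hm hx hy)
    rw [LieEquiv.map_lie, hρ _ _ hx, hρ _ _ hy, smul_lie, lie_smul, smul_smul] at h1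
    have h2 := smul_left_injective K (D.lie_ne_zero hkl hx hy hx0 hy0) h1
    rw [IsE8Matrix.coord_add hm, torusChar_add, ← hk, ← hl]
    exact Units.ext h2.symm

lemma apply_h_of_frame (D : IsE8Datum K A h V) {α : Fin 8 → R} (hα : IsE8Matrix.IsFrame A α)
    {M : Type*} [AddCommGroup M] [Module K M] {f g : L →ₗ[K] M}
    (hfg : ∀ i, f (h (α i)) = g (h (α i))) (k : R) : f (h k) = g (h k) := by
  have : Submodule.span K (Set.range h) ≤ LinearMap.eqLocus f g := by
    rw [← D.span_frame hα, Submodule.span_le]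
    rintro - ⟨i, rfl⟩
    exact hfg i
  exact this (Submodule.subset_span ⟨k, rfl⟩)

variable [LieAlgebra.IsSimple K L]

/-- Every character of the root lattice comes from an automorphism. -/
theorem exists_torus (D : IsE8Datum K A h V) {α : Fin 8 → R} (hα : IsE8Matrix.IsFrame A α)
    (u : Fin 8 → Kˣ) : ∃ φ : L ≃ₗ⁅K⁆ L, (∀ k, φ (h k) = h k) ∧
      ∀ k, ∀ x ∈ V k, φ x = (↑(torusChar u (IsE8Matrix.coord A α k)) : K) • x := by
  choose e he he0 using fun i ↦ D.exists_ne_zero (α i)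
  obtain ⟨φ, h1, h2⟩ := D.exists_lieEquiv D hα hα he he0 (e' := fun i ↦ (u i : K) • e i)
    (fun i ↦ Submodule.smul_mem _ _ (he i)) (fun i ↦ smul_ne_zero (u i).ne_zero (he0 i))
  have h3 : ∀ k, φ (h k) = h k := D.apply_h_of_frame hα
    (f := φ.toLinearEquiv.toLinearMap) (g := LinearMap.id) h1
  obtain ⟨t, ht⟩ := D.exists_torusChar hα h3
  refine ⟨φ, h3, ?_⟩
  have : t = u := by
    ext i
    have h4 := ht _ _ (he i)
    rw [h2, IsE8Matrix.coord_frame hα, torusChar_single] at h4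
    exact (smul_left_injective K (he0 i) h4).symm
  exact this ▸ ht

/-- Two automorphisms inducing `e8Rot` on the roots are conjugate under the torus. -/
theorem exists_conj [IsAlgClosed K] (D : IsE8Datum K A h V) {α : Fin 8 → R}
    (hα : IsE8Matrix.IsFrame A α) {w : R → R}
    (hw : ∀ k, IsE8Matrix.coord A α (w k) = Matrix.vecMul (IsE8Matrix.coord A α k) e8Rot)
    {θ ψ : L ≃ₗ⁅K⁆ L} (hθ : ∀ k, θ (h k) = h (w k)) (hθV : ∀ k, ∀ x ∈ V k, θ x ∈ V (w k))
    (hψ : ∀ k, ψ (h k) = h (w k)) :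
    ∃ (u : Fin 8 → Kˣ) (φ : L ≃ₗ⁅K⁆ L), (∀ k, φ (h k) = h k) ∧
      (∀ k, ∀ x ∈ V k, φ x = (↑(torusChar u (IsE8Matrix.coord A α k)) : K) • x) ∧
      ∀ x, φ (θ x) = ψ (φ x) := by
  obtain ⟨t, ht⟩ := D.exists_torusChar hα (φ := ψ.trans θ.symm) fun k ↦ by
    rw [LieEquiv.trans_apply, hψ, ← hθ, LieEquiv.symm_apply_apply]
  obtain ⟨u, hu⟩ := exists_torusChar_e8Rot t
  obtain ⟨φ, h1, h2⟩ := D.exists_torus hα u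
  refine ⟨u, φ, h1, h2, fun x ↦ D.ext_of_eqOn (φ := θ.trans φ) (ψ := φ.trans ψ) ?_ ?_ x⟩
  · intro k
    rw [LieEquiv.trans_apply, LieEquiv.trans_apply, h1, hψ, hθ, h1]
  · intro k x hx
    have h3 := congrArg θ (ht k x hx)
    rw [LieEquiv.trans_apply, LieEquiv.apply_symm_apply, map_smul] at h3
    rw [LieEquiv.trans_apply, LieEquiv.trans_apply, h2 _ _ hx, h2 _ _ (hθV k x hx), hw, hu,
      map_smul, h3, smul_smul, Units.val_mul]

end IsE8Datum

namespace DirectSum.IsInternal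

variable {ι K L M : Type*} [DecidableEq ι] [Field K] [AddCommGroup L] [Module K L]
  [AddCommGroup M] [Module K M] {V : ι → Submodule K L}

lemma exists_linearMap (hV : DirectSum.IsInternal V) (f : ι → K) :
    ∃ T : L →ₗ[K] L, ∀ a, ∀ x ∈ V a, T x = f a • x := by
  let e := LinearEquiv.ofBijective (DirectSum.coeLinearMap V) hV
  refine ⟨DirectSum.toModule K ι L (fun a ↦ f a • (V a).subtype) ∘ₗ e.symm.toLinearMap,
    fun a x hx ↦ ?_⟩
  have : e.symm x = DirectSum.lof K ι (fun a ↦ V a) a ⟨x, hx⟩ := by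
    rw [LinearEquiv.symm_apply_eq]
    exact (DirectSum.coeLinearMap_lof V a ⟨x, hx⟩).symm
  rw [LinearMap.comp_apply, LinearEquiv.coe_coe, this, DirectSum.toModule_lof]
  rfl

lemma linearMap_ext (hV : DirectSum.IsInternal V) {f g : L →ₗ[K] M}
    (h : ∀ a, ∀ x ∈ V a, f x = g x) (x : L) : f x = g x := by
  have : (⊤ : Submodule K L) ≤ LinearMap.eqLocus f g := by
    rw [← hV.submodule_iSup_eq_top]
    exact iSup_le h
  exact this (Submodule.mem_top (x := x))

/-- A joint eigenvector of maps separating the summands lies in a summand. -/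
lemma mem_of_forall [Fintype ι] (hV : DirectSum.IsInternal V) {J : Type*} {T : J → L →ₗ[K] L}
    {f : J → ι → K} (hT : ∀ j a, ∀ x ∈ V a, T j x = f j a • x) {a : ι}
    (hf : ∀ b, (∀ j, f j b = f j a) → b = a) {x : L} (hx : ∀ j, T j x = f j a • x) : x ∈ V a := by
  choose p hp using fun b ↦ hV.exists_linearMap (Pi.single b (1 : K))
  have hpV : ∀ b y, p b y ∈ V b := fun b y ↦ by
    have : (⊤ : Submodule K L) ≤ (V b).comap (p b) := by
      rw [← hV.submodule_iSup_eq_top]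
      refine iSup_le fun c z hz ↦ ?_
      rw [Submodule.mem_comap, hp b c z hz]
      by_cases h : c = b
      · subst h; exact Submodule.smul_mem _ _ hz
      · rw [Pi.single_eq_of_ne h, zero_smul]; exact Submodule.zero_mem _
    exact this (Submodule.mem_top (x := y))
  have hsum : x = ∑ b, p b x := by
    have := hV.linearMap_ext (f := LinearMap.id) (g := ∑ b, p b) (fun c z hz ↦ by
      rw [LinearMap.sum_apply, Finset.sum_eq_single c, hp c c z hz, Pi.single_eq_same, one_smul]
      · rfl
      · intro b _ hb
        rw [hp b c z hz, Pi.single_eq_of_ne hb.symm, zero_smul]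
      · simp) x
    rwa [LinearMap.sum_apply] at this
  have hcomm : ∀ j b y, p b (T j y) = f j b • p b y := fun j b ↦
    hV.linearMap_ext (f := p b ∘ₗ T j) (g := f j b • p b) fun c z hz ↦ by
      rw [LinearMap.comp_apply, hT j c z hz, map_smul, LinearMap.smul_apply, hp b c z hz]
      by_cases h : c = b
      · rw [h]
      · simp [Pi.single_eq_of_ne h]
  rw [hsum, Finset.sum_eq_single a]
  · exact hpV a x
  · intro b _ hb
    by_contra h0
    refine hb (hf b fun j ↦ ?_)
    have := hcomm j b x
    rw [hx, map_smul] at this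
    exact (smul_left_injective K h0 this).symm
  · simp

end DirectSum.IsInternal

section

variable {K L : Type*} [Field K] [LieRing L] [LieAlgebra K L] {Γ : Type*} [AddCommGroup Γ]
  [DecidableEq Γ] {gr : Γ → Submodule K L}

variable (K L) in
/-- The Lie bracket as a bilinear map. -/
def lieBilin : L →ₗ[K] L →ₗ[K] L :=
  LinearMap.mk₂ K (fun x y ↦ ⁅x, y⁆) add_lie smul_lie lie_add (fun c x y ↦ lie_smul c x y)

namespace IsLieGrading

lemma lie_ext (hgr : IsLieGrading K gr) {B C : L →ₗ[K] L →ₗ[K] L}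
    (h : ∀ a b, ∀ x ∈ gr a, ∀ y ∈ gr b, B x y = C x y) (x y : L) : B x y = C x y :=
  LinearMap.congr_fun (hgr.1.linearMap_ext (fun a x hx ↦ LinearMap.ext
    (hgr.1.linearMap_ext fun b y hy ↦ h a b x hx y hy)) x) y

/-- The automorphism given by a character of the grading group. -/
lemma exists_lieEquiv (hgr : IsLieGrading K gr) (χ : AddChar Γ K) :
    ∃ σ : L ≃ₗ⁅K⁆ L, ∀ a, ∀ x ∈ gr a, σ x = χ a • x := by
  obtain ⟨S, hS⟩ := hgr.1.exists_linearMap χ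
  obtain ⟨T, hT⟩ := hgr.1.exists_linearMap (fun a ↦ χ (-a))
  have h1 : ∀ a, χ a * χ (-a) = 1 := fun a ↦ by
    rw [← AddChar.map_add_eq_mul, add_neg_cancel, AddChar.map_zero_eq_one]
  have hST : ∀ x, S (T x) = x := hgr.1.linearMap_ext (f := S ∘ₗ T) (g := LinearMap.id)
    fun a x hx ↦ by
      rw [LinearMap.comp_apply, hT a x hx, map_smul, hS a x hx, smul_smul, mul_comm, h1, one_smul]
      rfl
  have hTS : ∀ x, T (S x) = x := hgr.1.linearMap_ext (f := T ∘ₗ S) (g := LinearMap.id)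
    fun a x hx ↦ by
      rw [LinearMap.comp_apply, hS a x hx, map_smul, hT a x hx, smul_smul, h1, one_smul]
      rfl
  have hlie : ∀ x y, S ⁅x, y⁆ = ⁅S x, S y⁆ := fun x y ↦
    hgr.lie_ext (B := (lieBilin K L).compr₂ S)
      (C := (lieBilin K L).compl₁₂ S S) (fun a b x hx y hy ↦ by
        change S ⁅x, y⁆ = ⁅S x, S y⁆
        rw [hS _ _ (hgr.2 a b x hx y hy), hS a x hx, hS b y hy, smul_lie, lie_smul, smul_smul,
          AddChar.map_add_eq_mul]) x y
  exact ⟨{ S with map_lie' := fun {x y} ↦ hlie x y, invFun := T, left_inv := hTS,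
                  right_inv := hST }, hS⟩

end IsLieGrading

end

section

open LieAlgebra

variable {K L : Type*} [Field K] [CharZero K] [IsAlgClosed K] [LieRing L] [LieAlgebra K L]
  [FiniteDimensional K L] [IsSimple K L] {Γ : Type*} [AddCommGroup Γ]
  [DecidableEq Γ] {gr : Γ → Submodule K L}

lemma LieAlgebra.isInternal_maxGenEigenspace_ad (x : L) [DecidableEq K] :
    DirectSum.IsInternal (ad K L x).maxGenEigenspace :=
  (DirectSum.isInternal_submodule_iff_iSupIndep_and_iSup_eq_top _).mpr
    ⟨(ad K L x).independent_maxGenEigenspace, Module.End.iSup_maxGenEigenspace_eq_top _⟩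

/-- The semisimple part of an element. -/
lemma LieAlgebra.exists_semisimple_part (x : L) :
    ∃ s : L, ∀ c : K, ∀ y ∈ (ad K L x).maxGenEigenspace c, ⁅s, y⁆ = c • y := by
  classical
  have hV := isInternal_maxGenEigenspace_ad (K := K) x
  have hgr : IsLieGrading K (ad K L x).maxGenEigenspace :=
    ⟨hV, fun a b y hy z hz ↦ LieModule.lie_mem_maxGenEigenspace_toEnd hy hz⟩
  obtain ⟨S, hS⟩ := hV.exists_linearMap id
  have hlie : ∀ y z, S ⁅y, z⁆ = ⁅y, S z⁆ - ⁅z, S y⁆ := fun y z ↦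
    hgr.lie_ext (B := (lieBilin K L).compr₂ S)
      (C := (lieBilin K L).compl₁₂ LinearMap.id S -
        ((lieBilin K L).compl₁₂ LinearMap.id S).flip)
      (fun a b y hy z hz ↦ by
        change S ⁅y, z⁆ = ⁅y, S z⁆ - ⁅z, S y⁆
        rw [hS _ _ (hgr.2 a b y hy z hz), hS a y hy, hS b z hz, lie_smul, lie_smul, id, id, id,
          ← lie_skew y z, add_smul]
        simp only [smul_neg]
        abel) y z
  obtain ⟨s, hs⟩ := LieDerivation.IsKilling.exists_eq_ad (R := K) (L := L) ⟨S, hlie⟩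
  refine ⟨s, fun c y hy ↦ ?_⟩
  have := congrArg (fun D : LieDerivation K L L ↦ D y) hs
  rw [← LieAlgebra.ad_apply (R := K), ← LieDerivation.coe_ad_apply_eq_ad_apply]
  exact this.trans (hS c y hy)

lemma LieAlgebra.isNilpotent_ad_sub {x s : L}
    (hs : ∀ c : K, ∀ y ∈ (ad K L x).maxGenEigenspace c, ⁅s, y⁆ = c • y) :
    IsNilpotent (ad K L (x - s)) := by
  classical
  refine ⟨finrank K L, LinearMap.ext ((isInternal_maxGenEigenspace_ad x).linearMap_ext
    fun c y hy ↦ ?_)⟩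
  set f := ad K L x with hf
  set g := ad K L (x - s) with hg
  have h1 : ∀ y ∈ f.maxGenEigenspace c, g y = (f - c • 1) y := fun y hy ↦ by
    rw [hg, hf, ad_apply, sub_lie, hs c y hy]
    rfl
  have hT : ∀ k, ∀ y ∈ f.maxGenEigenspace c, (g ^ k) y = ((f - c • 1) ^ k) y := by
    intro k
    induction k with
    | zero => intro y _; rfl
    | succ k ih =>
      intro y hy
      have h2 : (f - c • 1) y ∈ f.maxGenEigenspace c :=
        Module.End.mapsTo_maxGenEigenspace_of_comm
          ((Commute.refl f).sub_right ((Commute.one_right f).smul_right c)) c hy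
      rw [pow_succ, Module.End.mul_apply, h1 y hy, ih _ h2, pow_succ, Module.End.mul_apply]
  rw [hT _ y hy, LinearMap.zero_apply]
  rw [Module.End.maxGenEigenspace_eq_genEigenspace_finrank] at hy
  exact Module.End.mem_genEigenspace_nat.mp hy

namespace IsLieGrading

/-- If the identity component vanishes, homogeneous elements are semisimple. -/
theorem lie_eq_smul [Fintype Γ] (hgr : IsLieGrading K gr)
    (hΓ : ∀ c : Γ, c ≠ 0 → ∃ χ : AddChar Γ K, χ c ≠ 1)
    (h0 : gr 0 = ⊥) {a : Γ} {x : L} (hx : x ∈ gr a) (c : K) (y : L)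
    (hy : y ∈ (ad K L x).maxGenEigenspace c) : ⁅x, y⁆ = c • y := by
  classical
  obtain ⟨s, hs⟩ := exists_semisimple_part (K := K) x
  have hV := isInternal_maxGenEigenspace_ad (K := K) x
  choose σ hσ using hgr.exists_lieEquiv
  have hχ0 : ∀ (χ : AddChar Γ K) a, χ a ≠ 0 := fun χ a h ↦ by
    have h1 : χ a * χ (-a) = 1 := by
      rw [← AddChar.map_add_eq_mul, add_neg_cancel, AddChar.map_zero_eq_one]
    rw [h, zero_mul] at h1
    exact zero_ne_one h1
  have hmem : ∀ b z, (∀ χ, σ χ z = χ b • z) → z ∈ gr b := fun b z hz ↦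
    hgr.1.mem_of_forall (T := fun χ ↦ (σ χ).toLinearEquiv.toLinearMap) (f := fun χ ↦ χ)
      (fun χ a x hx ↦ hσ χ a x hx) (fun d hd ↦ by
        by_contra hne
        obtain ⟨χ, hχ⟩ := hΓ (d - b) (sub_ne_zero.mpr hne)
        apply hχ
        rw [AddChar.map_sub_eq_div, hd, div_self (hχ0 _ _)]) hz
  have hsa : s ∈ gr a := by
    refine hmem a s fun χ ↦ ?_
    have key : ∀ z : L, ⁅σ χ s, z⁆ = ⁅χ a • s, z⁆ := by
      refine hV.linearMap_ext (f := ad K L (σ χ s)) (g := ad K L (χ a • s)) fun d z hz ↦ ?_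
      have h1 : (σ χ).symm z ∈ (ad K L x).maxGenEigenspace (χ a * d) := by
        obtain ⟨k, hk⟩ := (Module.End.mem_maxGenEigenspace _ _ _).mp hz
        refine (Module.End.mem_maxGenEigenspace _ _ _).mpr ⟨k, ?_⟩
        have h2 : ∀ (k : ℕ) (z : L), σ χ (((ad K L x - (χ a * d) • 1) ^ k) ((σ χ).symm z)) =
            ((χ a) ^ k • (ad K L x - d • 1) ^ k) z := by
          intro k
          induction k with
          | zero => intro z; simp
          | succ k ih =>
            intro z
            have h3 : (ad K L x - (χ a * d) • 1) ((σ χ).symm z) =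
                (σ χ).symm (χ a • (ad K L x - d • 1) z) := by
              apply (σ χ).injective
              change σ χ _ = σ χ ((σ χ).symm _)
              rw [LieEquiv.apply_symm_apply]
              simp only [LinearMap.sub_apply, ad_apply, LinearMap.smul_apply, Module.End.one_apply,
                map_sub, LieEquiv.map_lie, hσ χ a x hx, map_smul, LieEquiv.apply_symm_apply,
                smul_sub, smul_lie, smul_smul]
            rw [pow_succ, Module.End.mul_apply, h3, ih, pow_succ, pow_succ]
            simp only [LinearMap.smul_apply, map_smul, Module.End.mul_apply, smul_smul, mul_comm]
        apply (σ χ).injective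
        exact (h2 k z).trans (by rw [LinearMap.smul_apply, hk, smul_zero, map_zero])
      have h2 := congrArg (σ χ) (hs _ _ h1)
      rw [LieEquiv.map_lie, LieEquiv.apply_symm_apply, map_smul, LieEquiv.apply_symm_apply] at h2
      rw [ad_apply, ad_apply, h2, smul_lie, hs d z hz, smul_smul]
    have h3 : σ χ s - χ a • s = 0 := by
      have h4 : σ χ s - χ a • s ∈ center K L := by
        rw [LieModule.mem_maxTrivSubmodule]
        intro z
        rw [← lie_skew, sub_lie, key, sub_self, neg_zero]
      rwa [center_eq_bot, LieSubmodule.mem_bot] at h4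
    exact sub_eq_zero.mp h3
  have hna : x - s ∈ gr a := Submodule.sub_mem _ hx hsa
  have hnil := isNilpotent_ad_sub hs
  have hn : x - s = 0 := by
    refine (LieAlgebra.IsKilling.killingForm_nondegenerate K L).1 _ fun y ↦ ?_
    refine hgr.1.linearMap_ext (f := killingForm K L (x - s)) (g := 0) (fun b y hy ↦ ?_) y
    rw [LinearMap.zero_apply]
    by_cases hab : a + b = 0
    · have hz : ⁅x - s, y⁆ = 0 := by
        have := hgr.2 a b _ hna y hy
        rwa [hab, h0, Submodule.mem_bot] at this
      have hcomm : Commute (ad K L (x - s)) (ad K L y) := by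
        refine LinearMap.ext fun z ↦ ?_
        simp only [Module.End.mul_apply, ad_apply]
        rw [leibniz_lie, hz, zero_lie, zero_add]
      rw [killingForm_apply_apply]
      exact (LinearMap.isNilpotent_trace_of_isNilpotent (hcomm.isNilpotent_mul_right hnil)).eq_zero
    · obtain ⟨χ, hχ⟩ := hΓ _ hab
      have h1 := killingForm_of_equiv_apply (R := K) (σ χ) (x - s) y
      rw [hσ χ a _ hna, hσ χ b y hy, map_smul, map_smul, LinearMap.smul_apply, smul_smul, mul_comm,
        ← AddChar.map_add_eq_mul, smul_eq_mul] at h1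
      by_contra hne
      exact hχ (mul_right_cancel₀ hne (by rw [h1, one_mul]))
  rw [sub_eq_zero.mp hn]
  exact hs c y hy

theorem lie_eq_zero_of_pow [Fintype Γ] (hgr : IsLieGrading K gr)
    (hΓ : ∀ c : Γ, c ≠ 0 → ∃ χ : AddChar Γ K, χ c ≠ 1)
    (h0 : gr 0 = ⊥) {a : Γ} {x y : L} (hx : x ∈ gr a) {k : ℕ}
    (hy : ((ad K L x) ^ k) y = 0) : ⁅x, y⁆ = 0 := by
  rw [hgr.lie_eq_smul hΓ h0 hx 0 y, zero_smul]
  exact (Module.End.mem_maxGenEigenspace _ _ _).mpr ⟨k, by simpa using hy⟩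

/-- Elements whose degrees lie in a common cyclic subgroup commute. -/
theorem lie_eq_zero [Fintype Γ] (hgr : IsLieGrading K gr)
    (hΓ : ∀ c : Γ, c ≠ 0 → ∃ χ : AddChar Γ K, χ c ≠ 1)
    (h0 : gr 0 = ⊥) {a b : Γ} {x y : L} (hx : x ∈ gr a) (hy : y ∈ gr b) {k : ℕ}
    (hk : b + k • a = 0) : ⁅x, y⁆ = 0 := by
  refine hgr.lie_eq_zero_of_pow hΓ h0 hx (k := k) ?_
  have : ∀ k : ℕ, ((ad K L x) ^ k) y ∈ gr (b + k • a) := by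
    intro k
    induction k with
    | zero => simpa using hy
    | succ k ih =>
      rw [pow_succ', Module.End.mul_apply, ad_apply,
        show b + (k + 1) • a = a + (b + k • a) by rw [add_smul, one_smul]; abel]
      exact hgr.2 _ _ _ hx _ ih
  have h1 := this k
  rwa [hk, h0, Submodule.mem_bot] at h1

end IsLieGrading

end

section

open LieAlgebra

variable {K L : Type*} [Field K] [CharZero K] [LieRing L] [LieAlgebra K L]
  [FiniteDimensional K L]

/-- An abelian set of elements acting without nontrivial nilpotent blocks at zero lies in a
Cartan subalgebra. -/
lemma LieAlgebra.exists_isCartanSubalgebra_of_subset (S : Set L)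
    (habel : ∀ x ∈ S, ∀ y ∈ S, ⁅x, y⁆ = 0)
    (hss : ∀ x ∈ S, ∀ y : L, ⁅x, ⁅x, y⁆⁆ = 0 → ⁅x, y⁆ = 0) :
    ∃ H : LieSubalgebra K L, H.IsCartanSubalgebra ∧ S ⊆ H := by
  let C : LieSubalgebra K L :=
    { carrier := {y | ∀ x ∈ S, ⁅x, y⁆ = 0}
      zero_mem' := fun x _ ↦ lie_zero x
      add_mem' := fun {y z} hy hz x hx ↦ by rw [lie_add, hy x hx, hz x hx, add_zero]
      smul_mem' := fun c y hy x hx ↦ by rw [lie_smul, hy x hx, smul_zero]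
      lie_mem' := fun {y z} hy hz x hx ↦ by
        rw [leibniz_lie, hy x hx, hz x hx, zero_lie, lie_zero, add_zero] }
  have hC : ∀ y, y ∈ C ↔ ∀ x ∈ S, ⁅x, y⁆ = 0 := fun y ↦ Iff.rfl
  obtain ⟨x₀, hx₀⟩ := exists_isCartanSubalgebra_engel K C
  set N : LieSubalgebra K C := LieSubalgebra.engel K x₀
  have hmem : ∀ y : L, y ∈ N.map C.incl ↔ ∃ hy : y ∈ C, (⟨y, hy⟩ : C) ∈ N := fun y ↦ by
    rw [LieSubalgebra.mem_map]
    constructor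
    · rintro ⟨z, hz, rfl⟩
      exact ⟨z.2, hz⟩
    · rintro ⟨hy, h⟩
      exact ⟨_, h, rfl⟩
  have hSN : ∀ s ∈ S, s ∈ N.map C.incl := fun s hs ↦ by
    have hsC : s ∈ C := fun x hx ↦ habel x hx s hs
    refine (hmem s).mpr ⟨hsC, ?_⟩
    rw [← hx₀.self_normalizing, LieSubalgebra.mem_normalizer_iff]
    intro y _
    have : ⁅(⟨s, hsC⟩ : C), y⁆ = 0 := Subtype.ext (y.2 s hs)
    rw [this]
    exact N.zero_mem
  refine ⟨N.map C.incl, ⟨?_, ?_⟩, hSN⟩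
  · have e := LieSubalgebra.equivMapOfInjective (K := N) (f := C.incl) Subtype.val_injective
    have := hx₀.nilpotent
    exact (LieEquiv.nilpotent_iff_equiv_nilpotent e).mp this
  · refine le_antisymm (fun y hy ↦ ?_) (LieSubalgebra.le_normalizer _)
    rw [LieSubalgebra.mem_normalizer_iff'] at hy
    have hyC : y ∈ C := fun s hs ↦ hss s hs y (((hmem _).mp (hy s (hSN s hs))).1 s hs)
    refine (hmem y).mpr ⟨hyC, ?_⟩
    rw [← hx₀.self_normalizing, LieSubalgebra.mem_normalizer_iff']
    intro z hz
    exact ((hmem _).mp (hy z ((hmem _).mpr ⟨z.2, hz⟩))).2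

end

/-- The character of `(ℤ/5)³` given by a fifth root of unity and a linear form. -/
noncomputable def dotChar {K : Type*} [Field K] {ζ : K} (hζ : IsPrimitiveRoot ζ 5)
    (v : Fin 3 → ZMod 5) : AddChar (Fin 3 → ZMod 5) K :=
  (AddChar.zmodChar 5 hζ.pow_eq_one).compAddMonoidHom
    (AddMonoidHom.mk' (fun a ↦ v ⬝ᵥ a) (dotProduct_add v))

lemma dotChar_apply {K : Type*} [Field K] {ζ : K} (hζ : IsPrimitiveRoot ζ 5)
    (v a : Fin 3 → ZMod 5) : dotChar hζ v a = ζ ^ (v ⬝ᵥ a).val := by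
  rw [← AddChar.zmodChar_apply hζ.pow_eq_one]; rfl

lemma pow_val_injective {K : Type*} [Field K] {ζ : K} (hζ : IsPrimitiveRoot ζ 5) {a b : ZMod 5}
    (h : ζ ^ a.val = ζ ^ b.val) : a = b :=
  ZMod.val_injective 5 (hζ.pow_inj (ZMod.val_lt a) (ZMod.val_lt b) h)

lemma exists_addChar_ne_one {K : Type*} [Field K] {ζ : K} (hζ : IsPrimitiveRoot ζ 5)
    (c : Fin 3 → ZMod 5) (hc : c ≠ 0) :
    ∃ χ : AddChar (Fin 3 → ZMod 5) K, χ c ≠ 1 := by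
  obtain ⟨i, hi⟩ := Function.ne_iff.mp hc
  refine ⟨dotChar hζ (Pi.single i 1), fun h ↦ hi (pow_val_injective hζ (b := 0) ?_)⟩
  rw [← one_mul (c i), ← single_dotProduct, ← dotChar_apply hζ, h, ZMod.val_zero, pow_zero]

namespace IsLieGrading

open LieAlgebra

variable {K L : Type*} [Field K] [CharZero K] [IsAlgClosed K] [LieRing L] [LieAlgebra K L]
  [FiniteDimensional K L] [IsSimple K L]
  {gr : (Fin 3 → ZMod 5) → Submodule K L}

lemma zero_eq_bot (hgr : IsLieGrading K gr) (hdim : ∀ a, a ≠ 0 → finrank K (gr a) = 2)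
    (hL : finrank K L = 248) : gr 0 = ⊥ := by
  have h1 := Submodule.finrank_eq_sum_of_isInternal hgr.1
  rw [hL, ← Finset.add_sum_erase _ _ (Finset.mem_univ 0),
    Finset.sum_congr rfl (fun a ha ↦ hdim a (Finset.ne_of_mem_erase ha)), Finset.sum_const,
    Finset.card_erase_of_mem (Finset.mem_univ _), Finset.card_univ, Fintype.card_fun, ZMod.card,
    Fintype.card_fin, smul_eq_mul] at h1
  exact Submodule.finrank_eq_zero.mp (by omega)

theorem exists_isCartanSubalgebra (hgr : IsLieGrading K gr)
    (hdim : ∀ a, a ≠ 0 → finrank K (gr a) = 2) (hL : finrank K L = 248) {ζ : K}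
    (hζ : IsPrimitiveRoot ζ 5) :
    ∃ H : LieSubalgebra K L, H.IsCartanSubalgebra ∧
      H.toSubmodule = ⨆ j : ZMod 5, gr ![0, 0, j] := by
  have h0 := hgr.zero_eq_bot hdim hL
  have hΓ := exists_addChar_ne_one hζ
  have hsub : ∀ j : ZMod 5, j ≠ 0 → (![0, 0, j] : Fin 3 → ZMod 5) ≠ 0 := fun j hj h ↦
    hj (congrFun h 2)
  obtain ⟨H, hH, hSH⟩ := exists_isCartanSubalgebra_of_subset (K := K)
    {x : L | ∃ j, x ∈ gr ![0, 0, j]} (by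
      rintro x ⟨i, hx⟩ y ⟨j, hy⟩
      by_cases hi : i = 0
      · have : (![0, 0, i] : Fin 3 → ZMod 5) = 0 := by rw [hi]; decide
        rw [this, h0, Submodule.mem_bot] at hx
        rw [hx, zero_lie]
      · refine hgr.lie_eq_zero hΓ h0 hx hy (k := (-j * i⁻¹).val) ?_
        have : Fact (Nat.Prime 5) := ⟨by norm_num⟩
        ext k
        fin_cases k
        · simp
        · simp
        · simp [hi]) (by
      rintro x ⟨i, hx⟩ y hy
      exact hgr.lie_eq_zero_of_pow hΓ h0 hx (k := 2) (by
        rw [pow_two, Module.End.mul_apply]; exact hy))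
  refine ⟨H, hH, (Submodule.eq_of_le_of_finrank_eq (iSup_le fun j x hx ↦ hSH ⟨j, hx⟩) ?_).symm⟩
  obtain ⟨A, h, V, D, hD⟩ := exists_isE8Datum (H := H) hL
  rw [← hD, D.finrank_span]
  have hind : iSupIndep fun j : ZMod 5 ↦ gr ![0, 0, j] :=
    hgr.1.submodule_iSupIndep.comp (f := fun j : ZMod 5 ↦ (![0, 0, j] : Fin 3 → ZMod 5))
      fun i j hij ↦ congrFun hij 2
  rw [Submodule.iSup_eq_range_dfinsupp_lsum, LinearMap.finrank_range_of_inj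
    hind.dfinsupp_lsum_injective]
  have h2 := Module.finrank_directSum K (fun j : ZMod 5 ↦ gr ![0, 0, j])
  refine h2.trans ?_
  rw [← Finset.add_sum_erase _ _ (Finset.mem_univ 0),
    Finset.sum_congr rfl (fun a ha ↦ hdim _ (hsub a (Finset.ne_of_mem_erase ha))),
    Finset.sum_const, Finset.card_erase_of_mem (Finset.mem_univ _), Finset.card_univ, ZMod.card,
    show (![0, 0, 0] : Fin 3 → ZMod 5) = 0 by decide, h0, finrank_bot]
  rfl

end IsLieGrading

/-- Two linear forms spanning the invariants modulo five of `e8Rot`. -/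
def gradVec : Fin 2 → Fin 8 → ℤ := ![![1, 1, 1, 1, 0, 3, 3, 3], ![0, 0, 0, 0, 1, 0, 0, 0]]

lemma torusChar_eq_of_invariant {M : Type*} [CommGroup M] {u : Fin 8 → M} (h5 : ∀ i, u i ^ 5 = 1)
    (hu : ∀ i, torusChar u (e8Rot i) = u i) (c : Fin 8 → ℤ) :
    torusChar u c = u 0 ^ (gradVec 0 ⬝ᵥ c) * u 4 ^ (gradVec 1 ⬝ᵥ c) := by
  have h0 := hu 0
  have h1 := hu 1
  have h2 := hu 2
  have h4 := hu 4
  have h5' := hu 5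
  have h6 := hu 6
  simp [torusChar, Fin.prod_univ_eight, e8Rot] at h0 h1 h2 h4 h5' h6
  have h50 : u 5 = u 0 ^ (3 : ℤ) := by
    have : u 0 * u 0 * u 5 = 1 := by
      have h := h4
      rw [h0, mul_right_comm, mul_eq_right] at h
      exact h
    have h7 : u 0 * u 0 * u 0 ^ 3 = 1 := by rw [← h5 0]; group
    rw [← this] at h7
    exact_mod_cast (mul_left_cancel h7).symm
  rw [h5'] at h6
  simp only [torusChar, Fin.prod_univ_eight, gradVec, dotProduct, Fin.sum_univ_eight]
  simp only [Matrix.cons_val, h6, h5', h2, h1, h0, h50, one_mul, zero_mul, add_zero, zero_add,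
    zpow_add, zpow_mul]
  simp only [mul_assoc, mul_comm, mul_left_comm]

namespace IsE8Datum

variable {K L R : Type*} [Field K] [CharZero K] [LieRing L] [LieAlgebra K L]
  [FiniteDimensional K L] [Fintype R] {A : R → R → ℤ} {h : R → L}
  {V : R → Submodule K L}

lemma h_injective (D : IsE8Datum K A h V) : Function.Injective h := fun k m hkm ↦
  D.isE8Matrix.ext_left fun l ↦ by
    obtain ⟨x, hx, hx0⟩ := D.exists_ne_zero l
    have h1 := (D.mem_iff l x).mp hx k
    rw [hkm, (D.mem_iff l x).mp hx m] at h1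
    rw [D.isE8Matrix.symm, D.isE8Matrix.symm m]
    exact_mod_cast (smul_left_injective K hx0 h1).symm

lemma sum_eq_zero_of_sum_h (D : IsE8Datum K A h V) {m : ℕ} {r : Fin m → R}
    (hr : ∑ i, h (r i) = 0) (k : R) : ∑ i, A (r i) k = 0 := by
  obtain ⟨x, hx, hx0⟩ := D.exists_ne_zero k
  have h1 : ((∑ i, A (r i) k : ℤ) : K) • x = 0 := by
    rw [Int.cast_sum, Finset.sum_smul, ← zero_lie (L := L) x, ← hr, sum_lie]
    exact Finset.sum_congr rfl fun i _ ↦ by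
      rw [(D.mem_iff k x).mp hx, D.isE8Matrix.symm]
  exact_mod_cast (smul_eq_zero.mp h1).resolve_right hx0

/-- An automorphism with `1 + θ + θ² + θ³ + θ⁴ = 0` on the Cartan subalgebra is in normal form for
some frame. -/
theorem exists_isFrame_of_lieEquiv (D : IsE8Datum K A h V) {θ : L ≃ₗ⁅K⁆ L}
    (hθ : ∀ k, θ (h k) ∈ Submodule.span K (Set.range h))
    (hθ' : ∀ k, θ.symm (h k) ∈ Submodule.span K (Set.range h))
    (hsum : ∀ k, h k + θ (h k) + θ (θ (h k)) + θ (θ (θ (h k))) + θ (θ (θ (θ (h k)))) = 0) :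
    ∃ (w : R → R) (α : Fin 8 → R), IsE8Matrix.IsFrame A α ∧
      (∀ k, IsE8Matrix.coord A α (w k) = Matrix.vecMul (IsE8Matrix.coord A α k) e8Rot) ∧
      (∀ k, θ (h k) = h (w k)) ∧ ∀ k, ∀ x ∈ V k, θ x ∈ V (w k) := by
  have hA := D.isE8Matrix
  obtain ⟨w, h1, h2, h3⟩ := D.exists_map D θ hθ hθ'
  have h4 : ∀ i k, A i k + A (w i) k + A (w (w i)) k + A (w (w (w i))) k +
      A (w (w (w (w i)))) k = 0 := fun i k ↦ by
    have := D.sum_eq_zero_of_sum_h (r := ![i, w i, w (w i), w (w (w i)), w (w (w (w i)))])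
      (by rw [← hsum i]; simp [Fin.sum_univ_five, h1]) k
    simpa [Fin.sum_univ_five] using this
  obtain ⟨α, hα, hw⟩ := hA.exists_isFrame_of_isometry h3 h4
  refine ⟨w, α, hα, fun k ↦ IsE8Matrix.coord_eq_of_sum hα fun l ↦ ?_, h1, h2⟩
  have hinj : Function.Injective w := fun i j hij ↦ hA.ext_left fun k ↦ by
    rw [← h3, hij, h3]
  obtain ⟨m, rfl⟩ := (Finite.injective_iff_surjective.mp hinj) l
  rw [h3, hA.eq_sum_coord hα]
  simp_rw [← h3 (α _) m, hw, Matrix.vecMul, dotProduct, Finset.sum_mul, Finset.mul_sum]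
  rw [Finset.sum_comm]
  simp_rw [mul_assoc]

lemma exists_zmod_of_commute (D : IsE8Datum K A h V) {α : Fin 8 → R}
    (hα : IsE8Matrix.IsFrame A α) {w : R → R} {θ σ : L ≃ₗ⁅K⁆ L}
    (hw : ∀ k, IsE8Matrix.coord A α (w k) = Matrix.vecMul (IsE8Matrix.coord A α k) e8Rot)
    (hθV : ∀ k, ∀ x ∈ V k, θ x ∈ V (w k)) (hσ : ∀ k, σ (h k) = h k)
    (hcomm : ∀ x, σ (θ x) = θ (σ x)) (h5 : ∀ x, σ (σ (σ (σ (σ x)))) = x) {z : Kˣ}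
    (hz : IsPrimitiveRoot z 5) :
    ∃ b : Fin 2 → ZMod 5, ∀ k, ∀ x ∈ V k, σ x = (↑(
      (z ^ (gradVec 0 ⬝ᵥ IsE8Matrix.coord A α k)) ^ (b 0).val *
      (z ^ (gradVec 1 ⬝ᵥ IsE8Matrix.coord A α k)) ^ (b 1).val) : K) • x := by
  obtain ⟨u, hu⟩ := D.exists_torusChar hα hσ
  have hu5 : ∀ i, u i ^ 5 = 1 := fun i ↦ by
    obtain ⟨x, hx, hx0⟩ := D.exists_ne_zero (α i)
    have h1 : ∀ y ∈ V (α i), σ y = (u i : K) • y := fun y hy ↦ by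
      rw [hu _ y hy, IsE8Matrix.coord_frame hα, torusChar_single]
    have h2 := h5 x
    simp only [h1 x hx, map_smul, smul_smul] at h2
    have h3 := smul_left_injective K hx0 (h2.trans (one_smul K x).symm)
    ext
    rw [Units.val_pow_eq_pow_val, Units.val_one, ← h3]
    ring
  have hrot : ∀ i, torusChar u (e8Rot i) = u i := fun i ↦ by
    obtain ⟨x, hx, hx0⟩ := D.exists_ne_zero (α i)
    have h1 := hcomm x
    rw [hu _ _ (hθV _ x hx), hu _ x hx, map_smul, hw, IsE8Matrix.coord_frame hα,
      torusChar_single, Matrix.single_one_vecMul] at h1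
    have h2 : θ x ≠ 0 := fun h0 ↦ hx0 (θ.injective (h0.trans (map_zero θ).symm))
    exact Units.ext (smul_left_injective K h2 h1)
  have hb : ∀ i, ∃ b : ZMod 5, u i = z ^ b.val := fun i ↦ by
    obtain ⟨n, hn, hn'⟩ := (IsPrimitiveRoot.coe_units_iff.mpr hz).eq_pow_of_pow_eq_one
      (ξ := (u i : K)) (by rw [← Units.val_pow_eq_pow_val, hu5, Units.val_one])
    exact ⟨n, Units.ext (by
      rw [ZMod.val_natCast, Nat.mod_eq_of_lt hn, Units.val_pow_eq_pow_val, hn'])⟩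
  choose b hb using hb
  refine ⟨![b 0, b 4], fun k x hx ↦ ?_⟩
  rw [hu k x hx, torusChar_eq_of_invariant hu5 hrot, hb, hb 4]
  congr 2
  simp only [Matrix.cons_val]
  congr 1 <;> rw [← zpow_natCast, ← zpow_natCast, zpow_comm]

end IsE8Datum

/-- The standard position of a Jordan grading relative to a Cartan subalgebra: the characters of
the grading group are generated by two elements of the torus and a lift of `e8Rot`. -/
structure IsJordanDatum {K L R : Type*} [Field K] [LieRing L] [LieAlgebra K L] [Fintype R]
    (z : Kˣ) (gr : (Fin 3 → ZMod 5) → Submodule K L) (A : R → R → ℤ) (h : R → L)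
    (V : R → Submodule K L) (α : Fin 8 → R) (w : R → R) (T : Fin 3 → L ≃ₗ⁅K⁆ L)
    (e : (Fin 3 → ZMod 5) ≃ (Fin 3 → ZMod 5)) : Prop where
  isE8Datum : IsE8Datum K A h V
  isFrame : IsE8Matrix.IsFrame A α
  coord_w : ∀ k, IsE8Matrix.coord A α (w k) = Matrix.vecMul (IsE8Matrix.coord A α k) e8Rot
  rot_h : ∀ k, T 2 (h k) = h (w k)
  rot_mem : ∀ k, ∀ x ∈ V k, T 2 x ∈ V (w k)
  torus_h : ∀ (j : Fin 2) k, T j.castSucc (h k) = h k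
  torus_apply : ∀ (j : Fin 2) k, ∀ x ∈ V k,
    T j.castSucc x = (↑(z ^ (gradVec j ⬝ᵥ IsE8Matrix.coord A α k)) : K) • x
  apply_of_mem : ∀ a, ∀ x ∈ gr a, ∀ j, T j x = (z : K) ^ (e a j).val • x

lemma Module.End.pow_apply_eq_smul {K M : Type*} [CommRing K] [AddCommGroup M] [Module K M]
    {f : Module.End K M} {c : K} {x : M} (hx : f x = c • x) (n : ℕ) : (f ^ n) x = c ^ n • x := by
  induction n with
  | zero => simp
  | succ n ih => rw [pow_succ, Module.End.mul_apply, hx, map_smul, ih, smul_smul, pow_succ']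

namespace IsLieGrading

open LieAlgebra

variable {K : Type u} {L : Type v} [Field K] [CharZero K] [IsAlgClosed K] [LieRing L]
  [LieAlgebra K L] [FiniteDimensional K L] [IsSimple K L]
  {gr : (Fin 3 → ZMod 5) → Submodule K L}

theorem exists_isJordanDatum (hgr : IsLieGrading K gr)
    (hdim : ∀ a, a ≠ 0 → finrank K (gr a) = 2) (hL : finrank K L = 248) {z : Kˣ}
    (hz : IsPrimitiveRoot z 5) :
    ∃ (R : Type (max u v)) (_ : Fintype R) (A : R → R → ℤ) (h : R → L) (V : R → Submodule K L)
      (α : Fin 8 → R) (w : R → R) (T : Fin 3 → L ≃ₗ⁅K⁆ L)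
      (e : (Fin 3 → ZMod 5) ≃ (Fin 3 → ZMod 5)), IsJordanDatum z gr A h V α w T e := by
  have hζ : IsPrimitiveRoot (z : K) 5 := IsPrimitiveRoot.coe_units_iff.mpr hz
  obtain ⟨H, hH, hHgr⟩ := hgr.exists_isCartanSubalgebra hdim hL hζ
  obtain ⟨A, h, V, D, hD⟩ := exists_isE8Datum (H := H) hL
  have hspan : Submodule.span K (Set.range h) = ⨆ j : ZMod 5, gr ![0, 0, j] := hD.trans hHgr
  have hh : ∀ k, h k ∈ ⨆ j : ZMod 5, gr ![0, 0, j] := fun k ↦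
    hspan ▸ Submodule.subset_span ⟨k, rfl⟩
  choose σ hσ using fun v ↦ hgr.exists_lieEquiv (dotChar hζ v)
  simp only [dotChar_apply] at hσ
  have hexp : ∀ n : ℕ, ((z : K) ^ n) ^ 5 = 1 := fun n ↦ by
    rw [← pow_mul, mul_comm, pow_mul, hζ.pow_eq_one, one_pow]
  have hcomm : ∀ v v' x, σ v (σ v' x) = σ v' (σ v x) := fun v v' ↦
    hgr.1.linearMap_ext (f := ((σ v').trans (σ v)).toLinearEquiv.toLinearMap)
      (g := ((σ v).trans (σ v')).toLinearEquiv.toLinearMap) fun a x hx ↦ by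
        change σ v (σ v' x) = σ v' (σ v x)
        simp only [hσ _ a x hx, map_smul, smul_smul, mul_comm]
  have h5 : ∀ v x, σ v (σ v (σ v (σ v (σ v x)))) = x := fun v ↦
    hgr.1.linearMap_ext (f := ((((σ v).trans (σ v)).trans ((σ v).trans (σ v))).trans
      (σ v)).toLinearEquiv.toLinearMap) (g := LinearMap.id) fun a x hx ↦ by
        change σ v (σ v (σ v (σ v (σ v x)))) = x
        simp only [hσ _ a x hx, map_smul, smul_smul]
        rw [← pow_two, ← pow_succ, ← pow_succ, ← pow_succ, hexp, one_smul]
  have hfix : ∀ p q, ∀ x ∈ ⨆ j : ZMod 5, gr ![0, 0, j], σ ![p, q, 0] x = x := fun p q x hx ↦ by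
    have : (⨆ j : ZMod 5, gr ![0, 0, j]) ≤
        LinearMap.eqLocus (σ ![p, q, 0]).toLinearEquiv.toLinearMap LinearMap.id :=
      iSup_le fun j x hx ↦ by
        change σ ![p, q, 0] x = x
        simp [hσ _ _ x hx]
    exact this hx
  have hrot : ∀ x ∈ ⨆ j : ZMod 5, gr ![0, 0, j],
      σ ![0, 0, 1] x ∈ ⨆ j : ZMod 5, gr ![0, 0, j] := fun x hx ↦ by
    have : (⨆ j : ZMod 5, gr ![0, 0, j]) ≤ (⨆ j : ZMod 5, gr ![0, 0, j]).comap
        (σ ![0, 0, 1]).toLinearEquiv.toLinearMap := iSup_le fun j x hx ↦ by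
      change σ ![0, 0, 1] x ∈ ⨆ j : ZMod 5, gr ![0, 0, j]
      rw [hσ _ _ x hx]
      exact Submodule.smul_mem _ _ (Submodule.mem_iSup_of_mem j hx)
    exact this hx
  have hrot' : ∀ x ∈ ⨆ j : ZMod 5, gr ![0, 0, j],
      (σ ![0, 0, 1]).symm x ∈ ⨆ j : ZMod 5, gr ![0, 0, j] := fun x hx ↦ by
    have : (σ ![0, 0, 1]).symm x =
        σ ![0, 0, 1] (σ ![0, 0, 1] (σ ![0, 0, 1] (σ ![0, 0, 1] x))) := by
      apply (σ ![0, 0, 1]).injective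
      change σ ![0, 0, 1] ((σ ![0, 0, 1]).symm x) = σ ![0, 0, 1] _
      rw [h5, LieEquiv.apply_symm_apply]
    rw [this]
    exact hrot _ (hrot _ (hrot _ (hrot _ hx)))
  have hsum : ∀ x ∈ ⨆ j : ZMod 5, gr ![0, 0, j], x + σ ![0, 0, 1] x +
      σ ![0, 0, 1] (σ ![0, 0, 1] x) + σ ![0, 0, 1] (σ ![0, 0, 1] (σ ![0, 0, 1] x)) +
      σ ![0, 0, 1] (σ ![0, 0, 1] (σ ![0, 0, 1] (σ ![0, 0, 1] x))) = 0 := fun x hx ↦ by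
    let f := (σ ![0, 0, 1]).toLinearEquiv.toLinearMap
    have : (⨆ j : ZMod 5, gr ![0, 0, j]) ≤
        LinearMap.ker (LinearMap.id + f + f ∘ₗ f + f ∘ₗ f ∘ₗ f + f ∘ₗ f ∘ₗ f ∘ₗ f) :=
      iSup_le fun j x hx ↦ by
        rw [LinearMap.mem_ker]
        by_cases hj : j = 0
        · have h0 : (![0, 0, j] : Fin 3 → ZMod 5) = 0 := by rw [hj]; decide
          rw [h0, hgr.zero_eq_bot hdim hL, Submodule.mem_bot] at hx
          rw [hx, map_zero]
        · have h1 : f x = (z : K) ^ j.val • x := by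
            refine (hσ _ _ x hx).trans ?_
            simp
          simp only [LinearMap.add_apply, LinearMap.comp_apply, h1, map_smul, smul_smul,
            LinearMap.id_apply]
          nth_rw 1 [← one_smul K x]
          rw [← add_smul, ← add_smul, ← add_smul, ← add_smul]
          have h2 : (z : K) ^ j.val - 1 ≠ 0 := sub_ne_zero.mpr fun h3 ↦
            hj (pow_val_injective hζ (b := 0) (by rw [h3, ZMod.val_zero, pow_zero]))
          refine smul_eq_zero_of_left (mul_left_cancel₀ h2 ?_) _
          linear_combination hexp j.val
    exact this hx
  obtain ⟨w, α, hα, hw, hθh, hθV⟩ := D.exists_isFrame_of_lieEquiv (θ := σ ![0, 0, 1])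
    (fun k ↦ by rw [hspan]; exact hrot _ (hh k)) (fun k ↦ by rw [hspan]; exact hrot' _ (hh k))
    fun k ↦ hsum _ (hh k)
  choose b hb using fun p : Fin 2 → ZMod 5 ↦ D.exists_zmod_of_commute hα hw hθV
    (σ := σ ![p 0, p 1, 0]) (fun k ↦ hfix _ _ _ (hh k)) (hcomm _ _) (h5 _) hz
  have hne : ∀ a ≠ 0, ∃ x ∈ gr a, x ≠ 0 := fun a ha ↦ by
    refine (Submodule.ne_bot_iff _).mp fun h0 ↦ ?_
    have := hdim a ha
    rw [h0, finrank_bot] at this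
    exact absurd this (by norm_num)
  have hσinj : ∀ v v', (∀ x, σ v x = σ v' x) → v = v' := fun v v' hvv ↦ by
    ext i
    have ha : (Pi.single i 1 : Fin 3 → ZMod 5) ≠ 0 := by
      rw [Ne, Pi.single_eq_zero_iff]; decide
    obtain ⟨x, hx, hx0⟩ := hne _ ha
    have h1 := hvv x
    rw [hσ _ _ x hx, hσ _ _ x hx] at h1
    have h2 := pow_val_injective hζ (smul_left_injective K hx0 h1)
    simpa using h2
  have hb_inj : Function.Injective b := fun p q hpq ↦ by
    have h1 := hσinj _ _ (D.ext_of_eqOn (φ := σ ![p 0, p 1, 0]) (ψ := σ ![q 0, q 1, 0])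
      (fun k ↦ by rw [hfix _ _ _ (hh k), hfix _ _ _ (hh k)])
      (fun k x hx ↦ by rw [hb p k x hx, hb q k x hx, hpq]))
    ext i
    fin_cases i
    · exact congrFun h1 0
    · exact congrFun h1 1
  have hb_surj := Finite.injective_iff_surjective.mp hb_inj
  choose p hp using fun j : Fin 2 ↦ hb_surj (Pi.single j 1)
  let v : Fin 3 → Fin 3 → ZMod 5 := ![![p 0 0, p 0 1, 0], ![p 1 0, p 1 1, 0], ![0, 0, 1]]
  have hTV : ∀ (j : Fin 2) k, ∀ x ∈ V k,
      σ (v j.castSucc) x = (↑(z ^ (gradVec j ⬝ᵥ IsE8Matrix.coord A α k)) : K) • x := by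
    intro j k x hx
    have h1 : (1 : ZMod 5).val = 1 := rfl
    have h2 := hb (p j) k x hx
    rw [hp j] at h2
    rw [show v j.castSucc = ![p j 0, p j 1, 0] by fin_cases j <;> rfl, h2]
    fin_cases j <;> simp [h1]
  have hTh : ∀ (j : Fin 2) k, σ (v j.castSucc) (h k) = h k := by
    intro j k
    fin_cases j
    · exact hfix _ _ _ (hh k)
    · exact hfix _ _ _ (hh k)
  have he : Function.Injective fun a j ↦ v j ⬝ᵥ a := by
    intro a a' haa
    by_contra hne'
    obtain ⟨x, hx, hx0⟩ := hne (a - a') (sub_ne_zero.mpr hne')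
    have h1 : ∀ j, σ (v j) x = x := fun j ↦ by
      rw [hσ _ _ x hx, dotProduct_sub, show v j ⬝ᵥ a = v j ⬝ᵥ a' from congrFun haa j, sub_self,
        ZMod.val_zero, pow_zero, one_smul]
    have h2 : ∀ q : Fin 2 → ZMod 5, σ ![q 0, q 1, 0] x = x := fun q ↦ by
      let f (j : Fin 2) : Module.End K L := (σ (v j.castSucc)).toLinearEquiv.toLinearMap
      have h3 : (⊤ : Submodule K L) ≤ LinearMap.eqLocus
          (σ ![q 0, q 1, 0]).toLinearEquiv.toLinearMap
          (f 0 ^ (b q 0).val * f 1 ^ (b q 1).val) := by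
        rw [← D.span_sup]
        refine sup_le (Submodule.span_le.mpr ?_) (iSup_le fun k y hy ↦ ?_)
        · rintro - ⟨k, rfl⟩
          change σ ![q 0, q 1, 0] (h k) = _
          have h4 : ∀ j, f j (h k) = (1 : K) • h k := fun j ↦ by
            rw [one_smul]; exact hTh j k
          rw [hfix _ _ _ (hh k), Module.End.mul_apply, Module.End.pow_apply_eq_smul (h4 1),
            map_smul, Module.End.pow_apply_eq_smul (h4 0), one_pow, one_pow, one_smul, one_smul]
        · change σ ![q 0, q 1, 0] y = _
          rw [hb q k y hy, Module.End.mul_apply,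
            Module.End.pow_apply_eq_smul (f := f 1) (hTV 1 k y hy),
            map_smul, Module.End.pow_apply_eq_smul (f := f 0) (hTV 0 k y hy), smul_smul, mul_comm]
          simp only [Units.val_mul, Units.val_pow_eq_pow_val]
      have h4 : ∀ j, f j x = (1 : K) • x := fun j ↦ by rw [one_smul]; exact h1 j.castSucc
      have h5 := h3 (Submodule.mem_top (x := x))
      refine h5.trans ?_
      rw [Module.End.mul_apply, Module.End.pow_apply_eq_smul (h4 1), map_smul,
        Module.End.pow_apply_eq_smul (h4 0), one_pow, one_pow, one_smul, one_smul]
    have h3 : ∀ u, σ u x = x → u ⬝ᵥ (a - a') = 0 := fun u hu ↦ by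
      refine pow_val_injective hζ (smul_left_injective K hx0 ?_)
      change _ • x = _ • x
      rw [← hσ _ _ x hx, hu, ZMod.val_zero, pow_zero, one_smul]
    refine hne' (sub_eq_zero.mp (funext fun i ↦ ?_))
    fin_cases i
    · simpa [dotProduct, Fin.sum_univ_three] using h3 _ (h2 ![1, 0])
    · simpa [dotProduct, Fin.sum_univ_three] using h3 _ (h2 ![0, 1])
    · simpa [dotProduct, Fin.sum_univ_three] using h3 ![0, 0, 1] (h1 2)
  exact ⟨H.root, inferInstance, A, h, V, α, w, fun j ↦ σ (v j),
    Equiv.ofBijective _ (Finite.injective_iff_bijective.mp he), D, hα, hw, hθh, hθV, hTh, hTV,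
    fun a x hx j ↦ hσ _ _ x hx⟩

end IsLieGrading

namespace IsE8Datum

variable {K L R R' : Type*} [Field K] [CharZero K] [LieRing L] [LieAlgebra K L]
  [FiniteDimensional K L] [LieAlgebra.IsSimple K L] [Fintype R] {A : R → R → ℤ} {h : R → L}
  {V : R → Submodule K L}
  [Fintype R'] {A' : R' → R' → ℤ} {h' : R' → L} {V' : R' → Submodule K L}

/-- Frames determine an isomorphism matching the roots and their coordinates. -/
theorem exists_lieEquiv_coord (D : IsE8Datum K A h V) (D' : IsE8Datum K A' h' V')
    {α : Fin 8 → R} (hα : IsE8Matrix.IsFrame A α) {α' : Fin 8 → R'}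
    (hα' : IsE8Matrix.IsFrame A' α') :
    ∃ (φ : L ≃ₗ⁅K⁆ L) (π : R → R'), (∀ k, φ (h k) = h' (π k)) ∧
      (∀ k, ∀ x ∈ V k, φ x ∈ V' (π k)) ∧
      ∀ k, IsE8Matrix.coord A' α' (π k) = IsE8Matrix.coord A α k := by
  choose e he he0 using fun i ↦ D.exists_ne_zero (α i)
  choose e' he' he0' using fun i ↦ D'.exists_ne_zero (α' i)
  obtain ⟨φ, h1, -⟩ := D.exists_lieEquiv D' hα hα' he he0 he' he0'
  have hle : ∀ k, φ (h k) ∈ Submodule.span K (Set.range h') := by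
    have : Submodule.span K (Set.range h) ≤
        (Submodule.span K (Set.range h')).comap φ.toLinearEquiv.toLinearMap := by
      rw [← D.span_frame hα, Submodule.span_le]
      rintro - ⟨i, rfl⟩
      change φ (h (α i)) ∈ Submodule.span K (Set.range h')
      rw [h1]
      exact Submodule.subset_span ⟨_, rfl⟩
    exact fun k ↦ this (Submodule.subset_span ⟨k, rfl⟩)
  have hle' : ∀ k, φ.symm (h' k) ∈ Submodule.span K (Set.range h) := by
    have : Submodule.span K (Set.range h') ≤
        (Submodule.span K (Set.range h)).comap φ.symm.toLinearEquiv.toLinearMap := by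
      rw [← D'.span_frame hα', Submodule.span_le]
      rintro - ⟨i, rfl⟩
      change φ.symm (h' (α' i)) ∈ Submodule.span K (Set.range h)
      rw [← h1, LieEquiv.symm_apply_apply]
      exact Submodule.subset_span ⟨_, rfl⟩
    exact fun k ↦ this (Submodule.subset_span ⟨k, rfl⟩)
  obtain ⟨π, h2, h3, h4⟩ := D.exists_map D' φ hle hle'
  refine ⟨φ, π, h2, h3, fun k ↦ ?_⟩
  have h5 : ∀ i, π (α i) = α' i := fun i ↦ D'.h_injective (by rw [← h2, h1])
  ext i
  simp only [IsE8Matrix.coord, ← h5, h4]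

end IsE8Datum

namespace IsJordanDatum

variable {K L R R' : Type*} [Field K] [CharZero K] [IsAlgClosed K] [LieRing L] [LieAlgebra K L]
  [FiniteDimensional K L] [LieAlgebra.IsSimple K L] [Fintype R] {A : R → R → ℤ} {h : R → L}
  {V : R → Submodule K L}
  [Fintype R'] {A' : R' → R' → ℤ} {h' : R' → L} {V' : R' → Submodule K L} {z : Kˣ}
  {gr gr' : (Fin 3 → ZMod 5) → Submodule K L} {α : Fin 8 → R} {w : R → R}
  {T : Fin 3 → L ≃ₗ⁅K⁆ L} {e : (Fin 3 → ZMod 5) ≃ (Fin 3 → ZMod 5)}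
  {α' : Fin 8 → R'} {w' : R' → R'}
  {T' : Fin 3 → L ≃ₗ⁅K⁆ L} {e' : (Fin 3 → ZMod 5) ≃ (Fin 3 → ZMod 5)}

theorem exists_lieEquiv (J : IsJordanDatum z gr A h V α w T e)
    (J' : IsJordanDatum z gr' A' h' V' α' w' T' e') :
    ∃ φ : L ≃ₗ⁅K⁆ L, ∀ j x, φ (T j x) = T' j (φ x) := by
  have D := J.isE8Datum
  have D' := J'.isE8Datum
  obtain ⟨φ₀, π, h1, h2, h3⟩ := D.exists_lieEquiv_coord D' J.isFrame J'.isFrame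
  have h4 : ∀ k, π (w k) = w' (π k) := fun k ↦
    IsE8Matrix.coord_injective D'.isE8Matrix J'.isFrame (by rw [h3, J.coord_w, J'.coord_w, h3])
  obtain ⟨u, φ₁, h5, h6, h7⟩ := D.exists_conj J.isFrame J.coord_w J.rot_h J.rot_mem
    (ψ := (φ₀.trans (T' 2)).trans φ₀.symm) fun k ↦ by
      rw [LieEquiv.trans_apply, LieEquiv.trans_apply, h1, J'.rot_h, ← h4, ← h1,
        LieEquiv.symm_apply_apply]
  refine ⟨φ₁.trans φ₀, fun j x ↦ ?_⟩
  refine j.lastCases ?_ (fun j ↦ ?_)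
  · change φ₀ (φ₁ (T 2 x)) = T' 2 (φ₀ (φ₁ x))
    rw [h7]
    exact LieEquiv.apply_symm_apply φ₀ _
  · refine D.ext_of_eqOn (φ := (T j.castSucc).trans (φ₁.trans φ₀))
      (ψ := (φ₁.trans φ₀).trans (T' j.castSucc)) (fun k ↦ ?_) (fun k x hx ↦ ?_) x
    · simp only [LieEquiv.trans_apply, J.torus_h, h5, h1, J'.torus_h]
    · simp only [LieEquiv.trans_apply, J.torus_apply j k x hx, h6 k x hx, map_smul,
        J'.torus_apply j _ _ (h2 k x hx), h3]
      rw [smul_comm]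

theorem gradingsEquiv (J : IsJordanDatum z gr A h V α w T e)
    (J' : IsJordanDatum z gr' A' h' V' α' w' T' e') (hz : IsPrimitiveRoot z 5)
    (hgr' : IsLieGrading K gr') (h0 : gr 0 = ⊥) (h0' : gr' 0 = ⊥)
    (hdim : ∀ a, a ≠ 0 → finrank K (gr a) = 2) (hdim' : ∀ a, a ≠ 0 → finrank K (gr' a) = 2) :
    GradingsEquiv K gr gr' := by
  obtain ⟨φ, hφ⟩ := J.exists_lieEquiv J'
  have hζ : IsPrimitiveRoot (z : K) 5 := IsPrimitiveRoot.coe_units_iff.mpr hz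
  refine ⟨φ, fun a ha ↦ ⟨e'.symm (e a), ?_⟩⟩
  have hle : (gr a).map φ.toLinearEquiv.toLinearMap ≤ gr' (e'.symm (e a)) := by
    rintro - ⟨x, hx, rfl⟩
    refine hgr'.1.mem_of_forall (T := fun j ↦ (T' j).toLinearEquiv.toLinearMap)
      (f := fun j a ↦ (z : K) ^ (e' a j).val) (fun j a x hx ↦ J'.apply_of_mem a x hx j)
      (fun b hb ↦ ?_) fun j ↦ ?_
    · refine (Equiv.eq_symm_apply _).mpr (funext fun j ↦ ?_)
      have := pow_val_injective hζ (hb j)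
      rwa [Equiv.apply_symm_apply] at this
    · change T' j (φ x) = _ • φ x
      rw [← hφ, J.apply_of_mem a x hx, map_smul, Equiv.apply_symm_apply]
  have hrank : finrank K ((gr a).map φ.toLinearEquiv.toLinearMap) = finrank K (gr a) :=
    LinearEquiv.finrank_map_eq φ.toLinearEquiv (gr a)
  have ha0 : a ≠ 0 := fun h ↦ ha (h ▸ h0)
  rw [hdim a ha0] at hrank
  refine Submodule.eq_of_le_of_finrank_eq hle ?_
  rw [hrank, hdim']
  intro hb
  rw [hb, h0', le_bot_iff] at hle
  rw [hle, finrank_bot] at hrank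
  exact absurd hrank (by norm_num)

end IsJordanDatum

open LieAlgebra in
theorem IsLieGrading.gradingsEquiv {K L : Type*} [Field K] [CharZero K] [IsAlgClosed K] [LieRing L]
    [LieAlgebra K L] [FiniteDimensional K L] [IsSimple K L]
    {gr gr' : (Fin 3 → ZMod 5) → Submodule K L} (hL : finrank K L = 248) (hgr : IsLieGrading K gr)
    (hgr' : IsLieGrading K gr') (hdim : ∀ a, a ≠ 0 → finrank K (gr a) = 2)
    (hdim' : ∀ a, a ≠ 0 → finrank K (gr' a) = 2) : GradingsEquiv K gr gr' := by
  obtain ⟨ζ, hζ⟩ := HasEnoughRootsOfUnity.exists_primitiveRoot K 5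
  obtain ⟨z, rfl⟩ := hζ.isUnit (by norm_num)
  have hz : IsPrimitiveRoot z 5 := IsPrimitiveRoot.coe_units_iff.mp hζ
  obtain ⟨R, _, A, h, V, α, w, T, e, J⟩ := hgr.exists_isJordanDatum hdim hL hz
  obtain ⟨R', _, A', h', V', α', w', T', e', J'⟩ := hgr'.exists_isJordanDatum hdim' hL hz
  exact J.gradingsEquiv J' hz hgr' (hgr.zero_eq_bot hdim hL) (hgr'.zero_eq_bot hdim' hL) hdim hdim'

/-- The orbits of `e8Rot` on the coordinate vectors of the roots, with entries shifted by `6`. -/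
def e8Table : List (List (List ℕ)) := [
  [[6, 6, 6, 6, 7, 6, 6, 6], [7, 7, 6, 6, 7, 7, 6, 6], [7, 8, 7, 6, 7, 7, 7, 6],
    [7, 8, 8, 7, 7, 7, 7, 7], [3, 1, 3, 5, 2, 3, 4, 5]],
  [[6, 7, 7, 6, 7, 7, 6, 6], [7, 7, 7, 7, 7, 7, 7, 6], [6, 7, 6, 6, 7, 7, 7, 7],
    [4, 1, 3, 4, 2, 3, 4, 5], [7, 8, 7, 7, 7, 6, 6, 6]],
  [[7, 8, 7, 6, 8, 7, 7, 6], [8, 9, 8, 7, 8, 8, 7, 7], [4, 3, 4, 5, 3, 4, 5, 5],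
    [7, 8, 8, 7, 8, 7, 7, 7], [4, 2, 3, 5, 3, 4, 4, 5]],
  [[7, 9, 8, 7, 8, 7, 6, 6], [7, 8, 8, 7, 8, 8, 7, 6], [7, 8, 7, 7, 8, 8, 8, 7],
    [4, 2, 3, 4, 3, 4, 5, 6], [5, 3, 4, 5, 3, 3, 4, 5]],
  [[5, 4, 5, 6, 4, 5, 5, 6], [4, 3, 4, 5, 4, 4, 5, 5], [8, 9, 8, 7, 9, 8, 7, 7],
    [5, 4, 4, 5, 4, 5, 5, 5], [8, 10, 9, 7, 9, 8, 8, 7]],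
  [[5, 3, 4, 5, 4, 5, 6, 6], [5, 4, 4, 5, 4, 4, 5, 6], [5, 4, 5, 5, 4, 4, 4, 5],
    [8, 10, 9, 8, 9, 8, 7, 6], [7, 9, 8, 7, 9, 9, 8, 7]],
  [[6, 6, 6, 6, 5, 6, 6, 6], [5, 5, 6, 6, 5, 5, 6, 6], [5, 4, 5, 6, 5, 5, 5, 6],
    [5, 4, 4, 5, 5, 5, 5, 5], [9, 11, 9, 7, 10, 9, 8, 7]],
  [[6, 5, 5, 6, 5, 5, 6, 6], [5, 5, 5, 5, 5, 5, 5, 6], [6, 5, 6, 6, 5, 5, 5, 5],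
    [8, 11, 9, 8, 10, 9, 8, 7], [5, 4, 5, 5, 5, 6, 6, 6]],
  [[6, 6, 6, 6, 6, 7, 7, 6], [6, 6, 6, 6, 6, 6, 7, 7], [3, 0, 2, 4, 1, 2, 3, 5],
    [6, 6, 6, 6, 6, 5, 5, 5], [9, 12, 10, 8, 11, 10, 8, 7]],
  [[7, 6, 6, 6, 6, 6, 6, 6], [6, 7, 6, 6, 6, 6, 6, 6], [6, 6, 7, 6, 6, 6, 6, 6],
    [6, 6, 6, 7, 6, 6, 6, 6], [5, 5, 5, 5, 6, 6, 6, 6]],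
  [[6, 6, 6, 6, 7, 7, 7, 6], [7, 7, 6, 6, 7, 7, 7, 7], [4, 2, 3, 4, 2, 3, 4, 5],
    [7, 8, 8, 7, 7, 6, 6, 6], [6, 7, 7, 7, 7, 7, 6, 6]],
  [[6, 7, 6, 6, 7, 6, 6, 6], [7, 7, 7, 6, 7, 7, 6, 6], [7, 8, 7, 7, 7, 7, 7, 6],
    [6, 7, 7, 6, 7, 7, 7, 7], [4, 1, 3, 5, 2, 3, 4, 5]],
  [[7, 8, 7, 7, 8, 7, 7, 6], [7, 8, 7, 6, 8, 8, 7, 7], [5, 3, 4, 5, 3, 4, 5, 5],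
    [7, 9, 8, 7, 8, 7, 7, 7], [4, 2, 4, 5, 3, 4, 4, 5]],
  [[8, 9, 8, 7, 8, 7, 6, 6], [7, 9, 8, 7, 8, 8, 7, 6], [7, 8, 8, 7, 8, 8, 8, 7],
    [4, 2, 3, 5, 3, 4, 5, 6], [4, 2, 3, 4, 3, 3, 4, 5]],
  [[5, 4, 4, 5, 4, 5, 6, 6], [5, 4, 5, 5, 4, 4, 5, 6], [5, 4, 5, 6, 4, 4, 4, 5],
    [7, 9, 8, 7, 9, 8, 7, 6], [8, 9, 8, 7, 9, 9, 8, 7]],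
  [[5, 4, 5, 5, 4, 5, 5, 5], [8, 10, 9, 8, 9, 8, 8, 7], [4, 3, 4, 5, 4, 5, 5, 6],
    [5, 3, 4, 5, 4, 4, 5, 5], [8, 10, 8, 7, 9, 8, 7, 7]],
  [[6, 6, 6, 6, 5, 5, 5, 5], [8, 11, 10, 8, 10, 9, 8, 7], [5, 4, 5, 6, 5, 6, 6, 6],
    [5, 4, 4, 5, 5, 5, 6, 6], [6, 5, 5, 5, 5, 5, 5, 6]],
  [[6, 5, 6, 6, 5, 5, 6, 6], [5, 5, 5, 6, 5, 5, 5, 6], [5, 4, 5, 5, 5, 5, 5, 5],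
    [9, 11, 9, 8, 10, 9, 8, 7], [5, 5, 5, 5, 5, 6, 6, 6]],
  [[6, 6, 6, 6, 6, 6, 6, 5], [9, 12, 10, 8, 11, 10, 9, 8], [3, 0, 2, 4, 1, 3, 4, 5],
    [6, 6, 6, 6, 6, 5, 6, 6], [6, 6, 6, 6, 6, 6, 5, 6]],
  [[7, 7, 6, 6, 6, 6, 6, 6], [6, 7, 7, 6, 6, 6, 6, 6], [6, 6, 7, 7, 6, 6, 6, 6],
    [5, 5, 5, 6, 6, 6, 6, 6], [6, 5, 5, 5, 6, 6, 6, 6]],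
  [[6, 7, 7, 6, 7, 6, 6, 6], [7, 7, 7, 7, 7, 7, 6, 6], [6, 7, 6, 6, 7, 7, 7, 6],
    [7, 7, 7, 6, 7, 7, 7, 7], [4, 2, 3, 5, 2, 3, 4, 5]],
  [[7, 7, 6, 6, 7, 6, 6, 6], [7, 8, 7, 6, 7, 7, 6, 6], [7, 8, 8, 7, 7, 7, 7, 6],
    [6, 7, 7, 7, 7, 7, 7, 7], [3, 0, 2, 4, 2, 3, 4, 5]],
  [[7, 8, 7, 6, 8, 7, 6, 6], [8, 9, 8, 7, 8, 8, 7, 6], [7, 9, 8, 7, 8, 8, 8, 7],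
    [4, 2, 4, 5, 3, 4, 5, 6], [4, 2, 3, 5, 3, 3, 4, 5]],
  [[7, 8, 8, 7, 8, 7, 7, 6], [7, 8, 7, 7, 8, 8, 7, 7], [4, 2, 3, 4, 3, 4, 5, 5],
    [8, 9, 8, 7, 8, 7, 7, 7], [4, 3, 4, 5, 3, 4, 4, 5]],
  [[5, 4, 5, 6, 4, 5, 5, 5], [7, 9, 8, 7, 9, 8, 8, 7], [5, 3, 4, 5, 4, 5, 5, 6],
    [5, 4, 4, 5, 4, 4, 5, 5], [8, 10, 9, 7, 9, 8, 7, 7]],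
  [[5, 4, 5, 5, 4, 5, 6, 6], [5, 4, 5, 6, 4, 4, 5, 6], [4, 3, 4, 5, 4, 4, 4, 5],
    [8, 9, 8, 7, 9, 8, 7, 6], [8, 10, 8, 7, 9, 9, 8, 7]],
  [[6, 6, 6, 6, 5, 5, 6, 6], [5, 5, 6, 6, 5, 5, 5, 6], [5, 4, 5, 6, 5, 5, 5, 5],
    [8, 10, 8, 7, 10, 9, 8, 7], [6, 5, 5, 5, 5, 6, 6, 6]],
  [[5, 5, 5, 6, 5, 6, 6, 6], [5, 4, 5, 5, 5, 5, 6, 6], [6, 5, 5, 6, 5, 5, 5, 6],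
    [5, 5, 5, 5, 5, 5, 5, 5], [9, 11, 10, 8, 10, 9, 8, 7]],
  [[6, 6, 6, 6, 6, 7, 6, 6], [6, 6, 6, 6, 6, 6, 7, 6], [6, 6, 6, 6, 6, 6, 6, 7],
    [3, 0, 2, 4, 1, 2, 3, 4], [9, 12, 10, 8, 11, 9, 8, 7]],
  [[6, 6, 5, 5, 6, 6, 6, 6], [7, 7, 7, 6, 6, 6, 6, 6], [6, 7, 7, 7, 6, 6, 6, 6],
    [5, 5, 6, 6, 6, 6, 6, 6], [6, 5, 5, 6, 6, 6, 6, 6]],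
  [[6, 6, 6, 6, 7, 7, 6, 6], [7, 7, 6, 6, 7, 7, 7, 6], [7, 8, 7, 6, 7, 7, 7, 7],
    [4, 2, 4, 5, 2, 3, 4, 5], [6, 7, 7, 7, 7, 6, 6, 6]],
  [[7, 7, 7, 6, 7, 6, 6, 6], [7, 8, 7, 7, 7, 7, 6, 6], [6, 7, 7, 6, 7, 7, 7, 6],
    [7, 7, 7, 7, 7, 7, 7, 7], [3, 1, 2, 4, 2, 3, 4, 5]],
  [[7, 8, 7, 6, 8, 7, 7, 7], [5, 3, 4, 5, 3, 4, 4, 5], [7, 9, 8, 7, 8, 7, 7, 6],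
    [7, 8, 8, 7, 8, 8, 7, 7], [4, 2, 3, 5, 3, 4, 5, 5]],
  [[7, 8, 7, 7, 8, 7, 6, 6], [7, 8, 7, 6, 8, 8, 7, 6], [8, 9, 8, 7, 8, 8, 8, 7],
    [4, 3, 4, 5, 3, 4, 5, 6], [4, 2, 4, 5, 3, 3, 4, 5]],
  [[5, 4, 5, 6, 4, 5, 6, 6], [4, 3, 4, 5, 4, 4, 5, 6], [5, 3, 4, 5, 4, 4, 4, 5],
    [8, 10, 8, 7, 9, 8, 7, 6], [8, 10, 9, 7, 9, 9, 8, 7]],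
  [[5, 4, 4, 5, 4, 5, 5, 6], [5, 4, 5, 5, 4, 4, 5, 5], [8, 10, 9, 8, 9, 8, 7, 7],
    [4, 3, 4, 5, 4, 5, 5, 5], [8, 9, 8, 7, 9, 8, 8, 7]],
  [[6, 5, 5, 6, 5, 6, 6, 6], [5, 5, 5, 5, 5, 5, 6, 6], [6, 5, 6, 6, 5, 5, 5, 6],
    [5, 5, 5, 6, 5, 5, 5, 5], [8, 10, 9, 7, 10, 9, 8, 7]],
  [[5, 5, 6, 6, 5, 6, 6, 6], [5, 4, 5, 6, 5, 5, 6, 6], [5, 4, 4, 5, 5, 5, 5, 6],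
    [6, 5, 5, 5, 5, 5, 5, 5], [9, 12, 10, 8, 10, 9, 8, 7]],
  [[6, 6, 6, 6, 6, 6, 5, 5], [9, 12, 10, 8, 11, 10, 9, 7], [6, 6, 6, 6, 6, 7, 7, 7],
    [3, 0, 2, 4, 1, 2, 4, 5], [6, 6, 6, 6, 6, 5, 5, 6]],
  [[6, 6, 6, 5, 6, 6, 6, 6], [7, 7, 7, 7, 6, 6, 6, 6], [5, 6, 6, 6, 6, 6, 6, 6],
    [6, 5, 6, 6, 6, 6, 6, 6], [6, 6, 5, 6, 6, 6, 6, 6]],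
  [[6, 6, 6, 6, 7, 7, 7, 7], [4, 1, 2, 4, 2, 3, 4, 5], [7, 8, 7, 6, 7, 6, 6, 6],
    [7, 8, 8, 7, 7, 7, 6, 6], [6, 7, 7, 7, 7, 7, 7, 6]],
  [[6, 7, 6, 6, 7, 7, 6, 6], [7, 7, 7, 6, 7, 7, 7, 6], [7, 8, 7, 7, 7, 7, 7, 7],
    [3, 1, 3, 4, 2, 3, 4, 5], [7, 7, 7, 7, 7, 6, 6, 6]],
  [[7, 8, 8, 7, 8, 7, 6, 6], [7, 8, 7, 7, 8, 8, 7, 6], [7, 8, 7, 6, 8, 8, 8, 7],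
    [5, 3, 4, 5, 3, 4, 5, 6], [4, 3, 4, 5, 3, 3, 4, 5]],
  [[7, 8, 7, 7, 8, 7, 7, 7], [4, 2, 3, 4, 3, 4, 4, 5], [8, 9, 8, 7, 8, 7, 7, 6],
    [7, 9, 8, 7, 8, 8, 7, 7], [4, 2, 4, 5, 3, 4, 5, 5]],
  [[5, 4, 5, 5, 4, 5, 5, 6], [5, 4, 5, 6, 4, 4, 5, 5], [7, 9, 8, 7, 9, 8, 7, 7],
    [5, 3, 4, 5, 4, 5, 5, 5], [8, 10, 8, 7, 9, 8, 8, 7]],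
  [[4, 3, 4, 5, 4, 5, 6, 6], [5, 3, 4, 5, 4, 4, 5, 6], [5, 4, 4, 5, 4, 4, 4, 5],
    [8, 10, 9, 7, 9, 8, 7, 6], [8, 10, 9, 8, 9, 9, 8, 7]],
  [[6, 6, 6, 6, 5, 5, 5, 6], [5, 5, 6, 6, 5, 5, 5, 5], [8, 10, 9, 8, 10, 9, 8, 7],
    [5, 4, 4, 5, 5, 6, 6, 6], [6, 5, 5, 5, 5, 5, 6, 6]],
  [[6, 5, 6, 6, 5, 6, 6, 6], [5, 5, 5, 6, 5, 5, 6, 6], [5, 4, 5, 5, 5, 5, 5, 6],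
    [6, 5, 5, 6, 5, 5, 5, 5], [8, 11, 9, 7, 10, 9, 8, 7]]]

/-- The orbits of `e8Rot` on the coordinate vectors of the roots. -/
def e8Orbits : List (List (List ℤ)) := e8Table.map (List.map (List.map fun n : ℕ ↦ (n : ℤ) - 6))

/-- The coordinate vector given by a list. -/
def e8Vec (l : List ℤ) (i : Fin 8) : ℤ := l.getD i 0

lemma e8Orbits_succ : ∀ o ∈ e8Orbits, ∀ r : Fin 4, ∀ i,
    e8Vec (o.getD (r + 1 : ℕ) []) i = Matrix.vecMul (e8Vec (o.getD r [])) e8Rot i := by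
  decide +kernel

lemma length_of_mem_e8Orbits : ∀ o ∈ e8Orbits, o.length = 5 := by decide +kernel

lemma e8Orbits_closed : ∀ l ∈ e8Orbits.flatten, ∀ i, Matrix.vecMul (e8Vec l) e8Gram i = -1 →
    List.ofFn (e8Vec l + Pi.single i 1) ∈ e8Orbits.flatten := by
  decide +kernel

lemma neg_mem_flatten_e8Orbits : ∀ l ∈ e8Orbits.flatten,
    List.ofFn (-e8Vec l) ∈ e8Orbits.flatten := by
  decide +kernel

lemma single_mem_flatten_e8Orbits : ∀ i : Fin 8,
    List.ofFn (Pi.single i 1 : Fin 8 → ℤ) ∈ e8Orbits.flatten := by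
  decide +kernel

lemma e8Rot_mem_flatten_e8Orbits : ∀ i : Fin 8,
    List.ofFn (fun j ↦ e8Rot i j) ∈ e8Orbits.flatten := by
  decide +kernel

lemma length_flatten_e8Orbits : e8Orbits.flatten.length = 240 := by decide +kernel

/-- The class of a coordinate vector. -/
def e8Class (c : Fin 8 → ℤ) (j : Fin 2) : ZMod 5 := ((gradVec j ⬝ᵥ c : ℤ) : ZMod 5)

lemma length_filter_e8Class : ∀ m : Fin 2 → ZMod 5, m ≠ 0 →
    (e8Orbits.filter fun o ↦ e8Class (e8Vec (o.getD 0 [])) = m).length ≤ 2 := by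
  decide +kernel

lemma e8Class_ne_zero : ∀ o ∈ e8Orbits, e8Class (e8Vec (o.getD 0 [])) ≠ 0 := by
  decide +kernel

lemma e8Vec_ofFn (c : Fin 8 → ℤ) : e8Vec (List.ofFn c) = c := by
  ext i
  rw [e8Vec, List.getD_eq_getElem _ _ (by rw [List.length_ofFn]; exact i.isLt), List.getElem_ofFn]

namespace IsE8Matrix

variable {ι : Type*} [Fintype ι] {A : ι → ι → ℤ} {α : Fin 8 → ι}

theorem ofFn_coord_mem (hA : IsE8Matrix A) (hα : IsFrame A α) (k : ι) :
    List.ofFn (coord A α k) ∈ e8Orbits.flatten := by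
  have hpos : ∀ k, 0 ≤ coord A α k → List.ofFn (coord A α k) ∈ e8Orbits.flatten := by
    refine hA.pos_induction hα (fun i ↦ ?_) fun k l i _ hk hki hl ↦ ?_
    · rw [coord_frame hα]
      exact single_mem_flatten_e8Orbits i
    · rw [coord_add (A := A) (α := α) (i := k) (j := α i) (k := l) hl, coord_frame hα]
      have := e8Orbits_closed _ hk i
      rw [e8Vec_ofFn] at this
      refine this ?_
      rw [← hki, ← sum_coord_mul_e8Gram (A := A) (α := α)]
      rfl
  rcases hA.coord_nonneg_or_nonpos hα k with hk | hk
  · exact hpos k hk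
  · obtain ⟨l, hl⟩ := hA.exists_neg k
    have h1 := coord_neg (α := α) hl
    have h2 := neg_mem_flatten_e8Orbits _ (hpos l (by rw [h1]; exact neg_nonneg.mpr hk))
    rwa [e8Vec_ofFn, h1, neg_neg] at h2

theorem exists_coord_eq (hA : IsE8Matrix A) (hα : IsFrame A α) {l : List ℤ}
    (hl : l ∈ e8Orbits.flatten) : ∃ k, coord A α k = e8Vec l := by
  classical
  have h1 : Finset.univ.image (fun k ↦ List.ofFn (coord A α k)) ⊆ e8Orbits.flatten.toFinset :=
    Finset.image_subset_iff.mpr fun k _ ↦ List.mem_toFinset.mpr (hA.ofFn_coord_mem hα k)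
  have h2 := Finset.eq_of_subset_of_card_le h1 <| by
    rw [Finset.card_image_of_injective _ (f := fun k ↦ List.ofFn (coord A α k))
      (List.ofFn_injective.comp (coord_injective hA hα)),
      Finset.card_univ, hA.card, ← length_flatten_e8Orbits]
    exact List.toFinset_card_le _
  rw [← List.mem_toFinset, ← h2, Finset.mem_image] at hl
  obtain ⟨k, -, rfl⟩ := hl
  exact ⟨k, (e8Vec_ofFn _).symm⟩

/-- The images of the simple roots under the rotation `e8Rot` form a frame. -/
theorem exists_isFrame_e8Rot (hA : IsE8Matrix A) (hα : IsFrame A α) :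
    ∃ β, IsFrame A β ∧ ∀ i, coord A α (β i) = e8Rot i := by
  choose β hβ using fun i ↦ hA.exists_coord_eq hα (e8Rot_mem_flatten_e8Orbits i)
  have hβ' : ∀ i, coord A α (β i) = e8Rot i := fun i ↦ by rw [hβ, e8Vec_ofFn]
  have hG : e8Rot * e8Gram * e8Rot.transpose = e8Gram := by decide +kernel
  refine ⟨β, fun i j ↦ ?_, hβ'⟩
  rw [← e8Form_coord hA hα, hβ', hβ', ← hG]
  simp only [e8Form, Matrix.mul_apply, Matrix.transpose_apply, Finset.sum_mul]
  rw [Finset.sum_comm]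
  refine Finset.sum_congr rfl fun a _ ↦ Finset.sum_congr rfl fun b _ ↦ by ring

/-- The opposites of the simple roots form a frame. -/
theorem exists_isFrame_neg (hA : IsE8Matrix A) (hα : IsFrame A α) :
    ∃ β, IsFrame A β ∧ ∀ k, coord A β k = -coord A α k := by
  choose ν hν using hA.exists_neg
  have h1 : ∀ k l, A k (ν l) = -A k l := fun k l ↦ by rw [hA.symm, hν, hA.symm]
  refine ⟨fun i ↦ ν (α i), fun i j ↦ by rw [hν, h1, neg_neg, hα], fun k ↦ ?_⟩
  ext i
  simp [coord, h1]

end IsE8Matrix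

lemma vecMul_e8Rot_five (c : Fin 8 → ℤ) : Matrix.vecMul (Matrix.vecMul (Matrix.vecMul
    (Matrix.vecMul (Matrix.vecMul c e8Rot) e8Rot) e8Rot) e8Rot) e8Rot = c := by
  have h : e8Rot * e8Rot * e8Rot * e8Rot * e8Rot = 1 := by decide +kernel
  rw [Matrix.vecMul_vecMul, Matrix.vecMul_vecMul, Matrix.vecMul_vecMul, Matrix.vecMul_vecMul,
    ← Matrix.mul_assoc, ← Matrix.mul_assoc, ← Matrix.mul_assoc, h, Matrix.vecMul_one]

lemma add_vecMul_e8Rot (c : Fin 8 → ℤ) : c + Matrix.vecMul c e8Rot +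
    Matrix.vecMul (Matrix.vecMul c e8Rot) e8Rot +
    Matrix.vecMul (Matrix.vecMul (Matrix.vecMul c e8Rot) e8Rot) e8Rot +
    Matrix.vecMul (Matrix.vecMul (Matrix.vecMul (Matrix.vecMul c e8Rot) e8Rot) e8Rot) e8Rot =
      0 := by
  have h : 1 + e8Rot + e8Rot * e8Rot + e8Rot * (e8Rot * e8Rot) +
      e8Rot * (e8Rot * (e8Rot * e8Rot)) = 0 := by decide +kernel
  have h2 := congrArg (Matrix.vecMul c) h
  simpa only [Matrix.vecMul_add, Matrix.vecMul_one, Matrix.vecMul_zero,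
    ← Matrix.vecMul_vecMul] using h2

lemma torusChar_pow_five_of_invariant {M : Type*} [CommGroup M] {v : Fin 8 → M}
    (hv : ∀ c, torusChar v (Matrix.vecMul c e8Rot) = torusChar v c) (c : Fin 8 → ℤ) :
    torusChar v c ^ 5 = 1 := by
  have h1 : torusChar v 0 = 1 := by simp [torusChar]
  rw [← h1, ← add_vecMul_e8Rot c]
  simp only [torusChar_add, hv, pow_succ, pow_zero, one_mul]

namespace IsE8Datum

variable {K L R : Type*} [Field K] [CharZero K] [IsAlgClosed K] [LieRing L] [LieAlgebra K L]
  [FiniteDimensional K L] [LieAlgebra.IsSimple K L] [Fintype R] {A : R → R → ℤ} {h : R → L}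
  {V : R → Submodule K L}

/-- There is an automorphism inducing `e8Rot` on the roots. -/
theorem exists_lift_e8Rot (D : IsE8Datum K A h V) {α : Fin 8 → R} (hα : IsE8Matrix.IsFrame A α) :
    ∃ (θ : L ≃ₗ⁅K⁆ L) (w : R → R), (∀ k, θ (h k) = h (w k)) ∧ (∀ k, ∀ x ∈ V k, θ x ∈ V (w k)) ∧
      ∀ k, IsE8Matrix.coord A α (w k) = Matrix.vecMul (IsE8Matrix.coord A α k) e8Rot := by
  obtain ⟨β, hβ, hβα⟩ := D.isE8Matrix.exists_isFrame_e8Rot hα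
  obtain ⟨θ, w, h1, h2, h3⟩ := D.exists_lieEquiv_coord D hα hβ
  refine ⟨θ, w, h1, h2, fun k ↦ IsE8Matrix.coord_eq_of_sum hα fun l ↦ ?_⟩
  rw [D.isE8Matrix.eq_sum_coord hβ, ← h3]
  simp_rw [D.isE8Matrix.eq_sum_coord hα (β _), hβα, Matrix.vecMul, dotProduct, Finset.sum_mul,
    Finset.mul_sum]
  rw [Finset.sum_comm]
  simp only [mul_assoc]

/-- A lift of `e8Rot` has order five. -/
theorem lift_e8Rot_five (D : IsE8Datum K A h V) {α : Fin 8 → R} (hα : IsE8Matrix.IsFrame A α)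
    {θ : L ≃ₗ⁅K⁆ L} {w : R → R} (hθ : ∀ k, θ (h k) = h (w k))
    (hθV : ∀ k, ∀ x ∈ V k, θ x ∈ V (w k))
    (hw : ∀ k, IsE8Matrix.coord A α (w k) = Matrix.vecMul (IsE8Matrix.coord A α k) e8Rot) (x : L) :
    θ (θ (θ (θ (θ x)))) = x := by
  have hA := D.isE8Matrix
  have hw5 : ∀ k, w (w (w (w (w k)))) = k := fun k ↦ IsE8Matrix.coord_injective hA hα <| by
    simp only [hw, vecMul_e8Rot_five]
  let θ₅ := (((θ.trans θ).trans θ).trans θ).trans θ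
  have hθ₅ : ∀ x, θ₅ x = θ (θ (θ (θ (θ x)))) := fun x ↦ rfl
  have hfix : ∀ k, θ₅ (h k) = h k := fun k ↦ by simp only [hθ₅, hθ, hw5]
  obtain ⟨v, hv⟩ := D.exists_torusChar hα hfix
  have hinv : ∀ k, torusChar v (IsE8Matrix.coord A α (w k)) =
      torusChar v (IsE8Matrix.coord A α k) := fun k ↦ by
    obtain ⟨y, hy, hy0⟩ := D.exists_ne_zero k
    have h1 := hv _ _ (hθV k y hy)
    rw [show θ₅ (θ y) = θ (θ₅ y) from rfl, hv k y hy, map_smul] at h1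
    exact Units.ext (smul_left_injective K (fun h ↦ hy0 (θ.injective (h.trans (map_zero θ).symm)))
      h1).symm
  have hinv' : ∀ c, torusChar v (Matrix.vecMul c e8Rot) = torusChar v c := fun c ↦ by
    rw [torusChar_vecMul]
    congr 1
    funext i
    have := hinv (α i)
    rwa [hw, IsE8Matrix.coord_frame hα, torusChar_single, Matrix.single_one_vecMul] at this
  obtain ⟨β, hβ, hβα⟩ := hA.exists_isFrame_neg hα
  obtain ⟨ν, π, h1, h2, h3⟩ := D.exists_lieEquiv_coord D hα hβ
  simp only [hβα] at h3
  have hπ : ∀ k, IsE8Matrix.coord A α (π k) = -IsE8Matrix.coord A α k := fun k ↦ by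
    rw [← h3 k, neg_neg]
  have hππ : ∀ k, π (π k) = k := fun k ↦ IsE8Matrix.coord_injective hA hα <| by
    rw [hπ, hπ, neg_neg]
  have hν : ∀ k, ν.symm (h k) = h (π k) := fun k ↦ by
    rw [← ν.symm_apply_apply (h (π k)), h1, hππ]
  obtain ⟨u, φ, -, hφV, hφ⟩ := D.exists_conj hα hw hθ hθV (ψ := (ν.symm.trans θ).trans ν)
    fun k ↦ by
      rw [LieEquiv.trans_apply, LieEquiv.trans_apply, hν, hθ, h1]
      congr 1
      exact IsE8Matrix.coord_injective hA hα <| by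
        rw [hπ, hw, hπ, hw, Matrix.neg_vecMul, neg_neg]
  have hφ₅ : ∀ x, φ (θ₅ x) = ν (θ₅ (ν.symm (φ x))) := fun x ↦ by
    simp only [hθ₅, hφ, LieEquiv.trans_apply, LieEquiv.symm_apply_apply]
  have hone : ∀ k, torusChar v (IsE8Matrix.coord A α k) = 1 := fun k ↦ by
    obtain ⟨y, hy, hy0⟩ := D.exists_ne_zero (π k)
    have hνy : ν y ∈ V k := by simpa only [hππ] using h2 _ _ hy
    have h4 := hφ₅ (ν y)
    rw [hv k _ hνy, map_smul, hφV k _ hνy, map_smul, LieEquiv.symm_apply_apply, map_smul, hv _ _ hy,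
      map_smul, map_smul, hπ, torusChar_neg, smul_comm] at h4
    have h5 : torusChar v (IsE8Matrix.coord A α k) = (torusChar v (IsE8Matrix.coord A α k))⁻¹ :=
      Units.ext (smul_left_injective K (fun h ↦ hy0 (ν.injective (h.trans (map_zero ν).symm)))
        ((smul_right_injective L (Units.ne_zero _)) h4))
    have h6 := torusChar_pow_five_of_invariant hinv' (IsE8Matrix.coord A α k)
    rwa [pow_succ, pow_mul _ 2 2, sq (torusChar _ _), mul_eq_one_iff_eq_inv.mpr h5, one_pow,
      one_mul] at h6
  exact D.ext_of_eqOn (φ := θ₅) (ψ := LieEquiv.refl) hfix (fun k y hy ↦ by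
    rw [hv k y hy, hone, Units.val_one, one_smul]
    rfl) x

end IsE8Datum

/-- Commuting endomorphisms of order five decompose the space into common eigenspaces. -/
theorem Module.End.isInternal_iInf_eigenspace {ι K M : Type*} [Fintype ι] [DecidableEq ι] [Field K]
    [CharZero K] [IsAlgClosed K] [AddCommGroup M] [Module K M] [FiniteDimensional K M] {ζ : K}
    (hζ : IsPrimitiveRoot ζ 5) {T : ι → Module.End K M} (hcomm : ∀ i j, Commute (T i) (T j))
    (h5 : ∀ i, T i ^ 5 = 1) :
    DirectSum.IsInternal fun a : ι → ZMod 5 ↦ ⨅ j, (T j).eigenspace (ζ ^ (a j).val) := by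
  have hss : ∀ i μ, (T i).maxGenEigenspace μ = (T i).eigenspace μ := fun i μ ↦ by
    refine (IsSemisimple.isFinitelySemisimple ?_).maxGenEigenspace_eq_eigenspace μ
    have hsep : (Polynomial.X ^ 5 - 1 : Polynomial K).Separable :=
      Polynomial.X_pow_sub_one_separable_iff.mpr (by norm_num)
    exact isSemisimple_of_squarefree_aeval_eq_zero hsep.squarefree (by simp [h5])
  have hmaps : ∀ i j φ, Set.MapsTo (T i) ((T j).maxGenEigenspace φ) ((T j).maxGenEigenspace φ) :=
    fun i j φ ↦ mapsTo_maxGenEigenspace_of_comm (hcomm j i) φ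
  have hinj : Function.Injective fun (a : ι → ZMod 5) j ↦ ζ ^ (a j).val := fun a b hab ↦
    funext fun j ↦ pow_val_injective hζ (congrFun hab j)
  refine DirectSum.isInternal_submodule_of_iSupIndep_of_iSup_eq_top ?_ ?_
  · simpa only [hss, Function.comp_def] using
      (independent_iInf_maxGenEigenspace_of_forall_mapsTo T hmaps).comp hinj
  · have htop := iSup_iInf_maxGenEigenspace_eq_top_of_forall_mapsTo T hmaps fun i ↦
      iSup_maxGenEigenspace_eq_top (T i)
    simp only [hss] at htop
    rw [eq_top_iff, ← htop]
    refine iSup_le fun χ x hx ↦ ?_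
    rcases eq_or_ne x 0 with rfl | hx0
    · exact zero_mem _
    have hχ : ∀ j, ∃ n < 5, ζ ^ n = χ j := fun j ↦ by
      have h1 : T j x = χ j • x := mem_eigenspace_iff.mp (Submodule.mem_iInf _ |>.mp hx j)
      have h2 := pow_apply_eq_smul h1 5
      rw [h5, one_apply] at h2
      exact hζ.eq_pow_of_pow_eq_one (smul_left_injective K hx0 ((one_smul K x).trans h2).symm)
    choose n hn hnχ using hχ
    refine Submodule.mem_iSup_of_mem (fun j ↦ (n j : ZMod 5)) ?_
    simpa only [ZMod.val_natCast_of_lt (hn _), hnχ] using hx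

/-- Commuting automorphisms of order five define a grading. -/
theorem isLieGrading_iInf_eigenspace {ι K L : Type*} [Fintype ι] [DecidableEq ι] [Field K]
    [CharZero K] [IsAlgClosed K] [LieRing L] [LieAlgebra K L] [FiniteDimensional K L] {ζ : K}
    (hζ : IsPrimitiveRoot ζ 5) {T : ι → L ≃ₗ⁅K⁆ L} (hcomm : ∀ i j x, T i (T j x) = T j (T i x))
    (h5 : ∀ i x, T i (T i (T i (T i (T i x)))) = x) :
    IsLieGrading K fun a : ι → ZMod 5 ↦
      ⨅ j, Module.End.eigenspace (T j).toLinearEquiv.toLinearMap (ζ ^ (a j).val) := by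
  refine ⟨Module.End.isInternal_iInf_eigenspace hζ (fun i j ↦ LinearMap.ext (hcomm i j))
    fun i ↦ LinearMap.ext (h5 i), fun a b x hx y hy ↦ ?_⟩
  simp only [Submodule.mem_iInf, Module.End.mem_eigenspace_iff] at hx hy ⊢
  intro j
  have hx' : T j x = _ • x := hx j
  have hy' : T j y = _ • y := hy j
  change T j ⁅x, y⁆ = _ • ⁅x, y⁆
  rw [LieEquiv.map_lie, hx', hy', smul_lie, lie_smul, smul_smul, ← pow_add, Pi.add_apply,
    ZMod.val_add, ← pow_eq_pow_mod _ hζ.pow_eq_one]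

namespace IsE8Datum

variable {K L R : Type*} [Field K] [CharZero K] [LieRing L] [LieAlgebra K L]
  [FiniteDimensional K L] [LieAlgebra.IsSimple K L] [Fintype R] {A : R → R → ℤ} {h : R → L}
  {V : R → Submodule K L}

lemma eq_zero_of_mem_span (D : IsE8Datum K A h V) {s : L} (hs : s ∈ Submodule.span K (Set.range h))
    (h0 : ∀ k, ∀ x ∈ V k, ⁅s, x⁆ = 0) : s = 0 := by
  have hker : ⊤ ≤ LinearMap.ker (LieAlgebra.ad K L s : L →ₗ[K] L) := by
    rw [← D.span_sup]
    refine sup_le (Submodule.span_le.mpr ?_) (iSup_le fun k x hx ↦ h0 k x hx)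
    rintro - ⟨k, rfl⟩
    change ⁅s, h k⁆ = 0
    rw [← lie_skew, D.lie_mem_span hs, neg_zero]
  have hc : s ∈ LieAlgebra.center K L := (LieModule.mem_maxTrivSubmodule K L L s).mpr fun x ↦ by
    have hx : ⁅s, x⁆ = 0 := hker (Submodule.mem_top (x := x))
    rw [← lie_skew, hx, neg_zero]
  rwa [LieAlgebra.center_eq_bot, LieSubmodule.mem_bot] at hc

lemma sum_h_eq_zero (D : IsE8Datum K A h V) {α : Fin 8 → R} (hα : IsE8Matrix.IsFrame A α)
    {ι : Type*} [Fintype ι] {c : ι → ℤ} {r : ι → R}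
    (hc : ∑ i, c i • IsE8Matrix.coord A α (r i) = 0) : ∑ i, (c i : K) • h (r i) = 0 := by
  refine D.eq_zero_of_mem_span (Submodule.sum_mem _ fun i _ ↦ Submodule.smul_mem _ _
    (Submodule.subset_span ⟨_, rfl⟩)) fun k x hx ↦ ?_
  have h1 : ∑ i, c i * A (r i) k = 0 := by
    have h2 := congrArg (fun n : Fin 8 → ℤ ↦ ∑ j, n j * A (α j) k) hc
    simp only [Finset.sum_apply, Pi.smul_apply, smul_eq_mul, Pi.zero_apply, zero_mul,
      Finset.sum_const_zero, Finset.sum_mul] at h2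
    rw [← h2, Finset.sum_comm]
    refine Finset.sum_congr rfl fun i _ ↦ ?_
    rw [D.isE8Matrix.eq_sum_coord hα, Finset.mul_sum]
    simp only [mul_assoc]
  rw [sum_lie]
  simp only [smul_lie, (D.mem_iff k x).mp hx, smul_smul, D.isE8Matrix.symm k]
  rw [← Finset.sum_smul]
  exact_mod_cast congrArg (fun n : ℤ ↦ (n : K) • x) h1 |>.trans (by simp)

end IsE8Datum

namespace Module.End

variable {K M : Type*} [Field K] [AddCommGroup M] [Module K M] {f : Module.End K M} {μ ν : K}
  {x : M}

/-- Five times the projection to an eigenspace of an endomorphism of order five. -/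
def eigenSum (f : Module.End K M) (μ : K) : Module.End K M := ∑ r ∈ Finset.range 5, μ⁻¹ ^ r • f ^ r

lemma eigenSum_apply_of_smul (hx : f x = ν • x) :
    eigenSum f μ x = (∑ r ∈ Finset.range 5, (μ⁻¹ * ν) ^ r) • x := by
  simp only [eigenSum, LinearMap.sum_apply, LinearMap.smul_apply, pow_apply_eq_smul hx, smul_smul,
    Finset.sum_smul, mul_pow]

lemma eigenSum_apply_of_eq (hμ : μ ≠ 0) (hx : f x = μ • x) : eigenSum f μ x = (5 : K) • x := by
  rw [eigenSum_apply_of_smul hx, inv_mul_cancel₀ hμ]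
  simp

lemma eigenSum_apply_of_ne (hμ : μ ^ 5 = 1) (hν : ν ^ 5 = 1) (h : ν ≠ μ) (hx : f x = ν • x) :
    eigenSum f μ x = 0 := by
  have hμ0 : μ ≠ 0 := fun h ↦ by simp [h] at hμ
  have h1 : μ⁻¹ * ν - 1 ≠ 0 := fun h2 ↦ h <| by
    rw [sub_eq_zero, inv_mul_eq_one₀ hμ0] at h2
    exact h2.symm
  have h2 := mul_geom_sum (μ⁻¹ * ν) 5
  rw [mul_pow, hν, inv_pow, hμ, inv_one, one_mul, sub_self] at h2
  rw [eigenSum_apply_of_smul hx, (mul_eq_zero.mp h2).resolve_left h1, zero_smul]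

lemma eigenSum_apply_apply (h5 : f ^ 5 = 1) (hμ : μ ^ 5 = 1) (x : M) :
    eigenSum f μ (f x) = μ • eigenSum f μ x := by
  have hμ0 : μ ≠ 0 := fun h ↦ by simp [h] at hμ
  have hx : f (f (f (f (f x)))) = x := LinearMap.congr_fun h5 x
  have h4 : μ⁻¹ ^ 4 = μ := by
    rw [inv_pow]
    exact inv_eq_of_mul_eq_one_right (by rw [← hμ]; ring)
  have h3 : μ⁻¹ * μ⁻¹ * μ⁻¹ = μ * μ := by
    rw [← mul_inv, ← mul_inv]
    exact inv_eq_of_mul_eq_one_right (by rw [← hμ]; ring)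
  have h1 : μ * μ⁻¹ = 1 := mul_inv_cancel₀ hμ0
  simp only [pow_succ, pow_zero, one_mul] at h4
  simp only [eigenSum, Finset.sum_range_succ, Finset.sum_range_zero, LinearMap.add_apply,
    LinearMap.smul_apply, pow_succ, pow_zero, one_apply, mul_apply, hx,
    smul_add, smul_smul, one_mul, h4, zero_add, ← mul_assoc, h1, one_smul]
  rw [h3]
  abel

end Module.End

lemma e8Class_vecMul_e8Rot (c : Fin 8 → ℤ) : e8Class (Matrix.vecMul c e8Rot) = e8Class c := by
  have h : ∀ j i, ((∑ a, e8Rot i a * gradVec j a : ℤ) : ZMod 5) = (gradVec j i : ℤ) := by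
    decide +kernel
  ext j
  simp only [e8Class, dotProduct, Matrix.vecMul, Finset.mul_sum]
  rw [Finset.sum_comm, Int.cast_sum, Int.cast_sum]
  refine Finset.sum_congr rfl fun i _ ↦ ?_
  rw [Int.cast_mul, ← h, ← Int.cast_mul, Finset.sum_mul]
  congr 1
  exact Finset.sum_congr rfl fun a _ ↦ by ring

lemma zpow_eq_pow_val {K : Type*} [Field K] {z : Kˣ} (hz : z ^ 5 = 1) (n : ℤ) :
    (↑(z ^ n) : K) = (z : K) ^ ((n : ZMod 5)).val := by
  rw [← Units.val_pow_eq_pow_val, ← zpow_natCast, ZMod.val_intCast, Units.val_inj]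
  conv_lhs => rw [← Int.emod_add_mul_ediv n 5]
  rw [zpow_add, zpow_mul, show z ^ (5 : ℤ) = 1 from mod_cast hz, one_zpow, mul_one]
  rfl

namespace IsE8Matrix

variable {ι : Type*} [Fintype ι] {A : ι → ι → ℤ} {α : Fin 8 → ι} {w : ι → ι}

/-- Representatives of the orbits on the roots of an isometry in normal form. -/
theorem exists_orbit_representatives (hA : IsE8Matrix A) (hα : IsFrame A α)
    (hw : ∀ k, coord A α (w k) = Matrix.vecMul (coord A α k) e8Rot) :
    ∃ κ : List (List ℤ) → ι, (∀ o ∈ e8Orbits, coord A α (κ o) = e8Vec (o.getD 0 [])) ∧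
      ∀ k, ∃ o ∈ e8Orbits, ∃ n, k = w^[n] (κ o) := by
  have hlen := length_of_mem_e8Orbits
  have h1 : ∀ o, ∃ k, o ∈ e8Orbits → coord A α k = e8Vec (o.getD 0 []) := fun o ↦ by
    by_cases ho : o ∈ e8Orbits
    · have h0 : 0 < o.length := by rw [hlen o ho]; norm_num
      obtain ⟨k, hk⟩ := hA.exists_coord_eq hα (l := o.getD 0 []) <|
        List.mem_flatten.mpr ⟨o, ho, by rw [List.getD_eq_getElem _ _ h0]; exact List.getElem_mem h0⟩
      exact ⟨k, fun _ ↦ hk⟩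
    · exact ⟨α 0, fun h ↦ absurd h ho⟩
  choose κ hκ using h1
  refine ⟨κ, hκ, fun k ↦ ?_⟩
  obtain ⟨o, ho, hk⟩ := List.mem_flatten.mp (hA.ofFn_coord_mem hα k)
  obtain ⟨n, hn, hno⟩ := List.getElem_of_mem hk
  have h2 : ∀ m < 5, coord A α (w^[m] (κ o)) = e8Vec (o.getD m []) := fun m hm ↦ by
    induction m with
    | zero => exact hκ o ho
    | succ m ih =>
      rw [Function.iterate_succ_apply', hw, ih (by lia)]
      exact (funext (e8Orbits_succ o ho ⟨m, by lia⟩)).symm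
  refine ⟨o, ho, n, coord_injective hA hα ?_⟩
  rw [h2 n (hlen o ho ▸ hn), List.getD_eq_getElem _ _ hn, hno, e8Vec_ofFn]

lemma e8Class_coord_iterate (hw : ∀ k, coord A α (w k) = Matrix.vecMul (coord A α k) e8Rot)
    (n : ℕ) (k : ι) : e8Class (coord A α (w^[n] k)) = e8Class (coord A α k) := by
  induction n with
  | zero => rfl
  | succ n ih => rw [Function.iterate_succ_apply', hw, e8Class_vecMul_e8Rot, ih]

end IsE8Matrix

namespace IsJordanDatum

open Module.End

variable {K L R : Type*} [Field K] [CharZero K] [IsAlgClosed K] [LieRing L] [LieAlgebra K L]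
  [FiniteDimensional K L] [LieAlgebra.IsSimple K L] [Fintype R] {A : R → R → ℤ} {h : R → L}
  {V : R → Submodule K L} {z : Kˣ} {gr : (Fin 3 → ZMod 5) → Submodule K L} {α : Fin 8 → R}
  {w : R → R} {T : Fin 3 → L ≃ₗ⁅K⁆ L} {e : (Fin 3 → ZMod 5) ≃ (Fin 3 → ZMod 5)}

/-- A multiple of the projection to a homogeneous component. -/
noncomputable def proj (z : Kˣ) (T : Fin 3 → L ≃ₗ⁅K⁆ L) (b : Fin 3 → ZMod 5) : Module.End K L :=
  eigenSum (T 2).toLinearEquiv.toLinearMap ((z : K) ^ (b 2).val) *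
    (eigenSum (T 1).toLinearEquiv.toLinearMap ((z : K) ^ (b 1).val) *
      eigenSum (T 0).toLinearEquiv.toLinearMap ((z : K) ^ (b 0).val))

lemma proj_apply_of_eq {b : Fin 3 → ZMod 5} {x : L}
    (hx : ∀ j : Fin 2, T j.castSucc x = (z : K) ^ (b j.castSucc).val • x) :
    proj z T b x = (25 : K) •
      eigenSum (T 2).toLinearEquiv.toLinearMap ((z : K) ^ (b 2).val) x := by
  have h0 : eigenSum (T 0).toLinearEquiv.toLinearMap ((z : K) ^ (b 0).val) x = (5 : K) • x :=
    eigenSum_apply_of_eq (pow_ne_zero _ z.ne_zero) (hx 0)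
  have h1 : eigenSum (T 1).toLinearEquiv.toLinearMap ((z : K) ^ (b 1).val) x = (5 : K) • x :=
    eigenSum_apply_of_eq (pow_ne_zero _ z.ne_zero) (hx 1)
  rw [proj, mul_apply, mul_apply, h0, map_smul, h1, map_smul, map_smul, smul_smul]
  norm_num

lemma proj_apply_of_ne (hz : IsPrimitiveRoot (z : K) 5) {b : Fin 3 → ZMod 5} {m : Fin 2 → ZMod 5}
    {x : L} (hx : ∀ j : Fin 2, T j.castSucc x = (z : K) ^ (m j).val • x)
    (hm : m ≠ fun j ↦ b j.castSucc) : proj z T b x = 0 := by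
  have h5 : ∀ n, ((z : K) ^ n) ^ 5 = 1 := fun n ↦ by
    rw [← pow_mul, mul_comm, pow_mul, hz.pow_eq_one, one_pow]
  have hne : ∀ {a b : ZMod 5}, a ≠ b → (z : K) ^ a.val ≠ (z : K) ^ b.val := fun hab h ↦
    hab (pow_val_injective hz h)
  by_cases h0 : m 0 = b 0
  · have h1 : m 1 ≠ b 1 := fun h1 ↦ hm <| by
      ext j
      fin_cases j
      exacts [h0, h1]
    have hx0 : eigenSum (T 0).toLinearEquiv.toLinearMap ((z : K) ^ (b 0).val) x = (5 : K) • x :=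
      eigenSum_apply_of_eq (pow_ne_zero _ z.ne_zero) (h0 ▸ hx 0)
    have hx1 : eigenSum (T 1).toLinearEquiv.toLinearMap ((z : K) ^ (b 1).val) x = 0 :=
      eigenSum_apply_of_ne (h5 _) (h5 _) (hne h1) (hx 1)
    rw [proj, mul_apply, mul_apply, hx0, map_smul, hx1, smul_zero, map_zero]
  · have hx0 : eigenSum (T 0).toLinearEquiv.toLinearMap ((z : K) ^ (b 0).val) x = 0 :=
      eigenSum_apply_of_ne (h5 _) (h5 _) (hne h0) (hx 0)
    rw [proj, mul_apply, mul_apply, hx0, map_zero, map_zero]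

lemma torus_apply_val (J : IsJordanDatum z gr A h V α w T e) (hz : IsPrimitiveRoot z 5) {k : R}
    {x : L} (hx : x ∈ V k) (j : Fin 2) :
    T j.castSucc x = (z : K) ^ (e8Class (IsE8Matrix.coord A α k) j).val • x := by
  rw [J.torus_apply j k x hx, zpow_eq_pow_val hz.pow_eq_one]
  rfl

lemma torus_h_val (J : IsJordanDatum z gr A h V α w T e) (k : R) (j : Fin 2) :
    T j.castSucc (h k) = (z : K) ^ ((0 : Fin 2 → ZMod 5) j).val • h k := by
  rw [J.torus_h, Pi.zero_apply, ZMod.val_zero, pow_zero, one_smul]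

lemma le_map_proj (J : IsJordanDatum z gr A h V α w T e) (a : Fin 3 → ZMod 5) :
    gr a ≤ Submodule.span K (Set.range fun k ↦ proj z T (e a) (h k)) ⊔
      ⨆ k, (V k).map (proj z T (e a)) := by
  have D := J.isE8Datum
  rw [← Submodule.map_iSup, show (fun k ↦ proj z T (e a) (h k)) = proj z T (e a) ∘ h from rfl,
    Set.range_comp, ← Submodule.map_span, ← Submodule.map_sup, D.span_sup]
  intro x hx
  have h1 := J.apply_of_mem a x hx
  have h2 : eigenSum (T 2).toLinearEquiv.toLinearMap ((z : K) ^ (e a 2).val) x = (5 : K) • x :=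
    eigenSum_apply_of_eq (pow_ne_zero _ z.ne_zero) (h1 2)
  refine ⟨(125 : K)⁻¹ • x, Submodule.mem_top, ?_⟩
  rw [map_smul, proj_apply_of_eq fun j ↦ h1 _, h2, smul_smul, smul_smul]
  norm_num

lemma eigenSum_rot (J : IsJordanDatum z gr A h V α w T e) (hz : IsPrimitiveRoot z 5) (b : ZMod 5)
    (x : L) : eigenSum (T 2).toLinearEquiv.toLinearMap ((z : K) ^ b.val) (T 2 x) =
      (z : K) ^ b.val • eigenSum (T 2).toLinearEquiv.toLinearMap ((z : K) ^ b.val) x := by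
  refine eigenSum_apply_apply (LinearMap.ext fun x ↦
    J.isE8Datum.lift_e8Rot_five J.isFrame J.rot_h J.rot_mem J.coord_w x) ?_ x
  rw [← pow_mul, mul_comm, pow_mul, (IsPrimitiveRoot.coe_units_iff.mpr hz).pow_eq_one, one_pow]

theorem finrank_le_of_ne (J : IsJordanDatum z gr A h V α w T e) (hz : IsPrimitiveRoot z 5)
    {a : Fin 3 → ZMod 5} (ha : (fun j : Fin 2 ↦ e a j.castSucc) ≠ 0) : finrank K (gr a) ≤ 2 := by
  classical
  have D := J.isE8Datum
  have hz' : IsPrimitiveRoot (z : K) 5 := IsPrimitiveRoot.coe_units_iff.mpr hz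
  set m : Fin 2 → ZMod 5 := fun j ↦ e a j.castSucc with hm
  obtain ⟨κ, hκ, hκw⟩ := D.isE8Matrix.exists_orbit_representatives J.isFrame J.coord_w
  choose y hy hy0 using D.exists_ne_zero
  let F := e8Orbits.filter fun o ↦ e8Class (e8Vec (o.getD 0 [])) = m
  let B := F.toFinset.image fun o ↦ proj z T (e a) (y (κ o))
  have hmem : ∀ k, ∀ x ∈ V k, e8Class (IsE8Matrix.coord A α k) = m → proj z T (e a) x =
      (25 : K) • eigenSum (T 2).toLinearEquiv.toLinearMap ((z : K) ^ (e a 2).val) x :=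
    fun k x hx hk ↦ proj_apply_of_eq fun j ↦ by rw [J.torus_apply_val hz hx, hk]
  have hle : gr a ≤ Submodule.span K (B : Set L) := by
    refine (J.le_map_proj a).trans (sup_le ?_ (iSup_le fun k ↦ ?_))
    · rw [Submodule.span_le]
      rintro - ⟨k, rfl⟩
      change proj z T (e a) (h k) ∈ _
      rw [proj_apply_of_ne hz' (J.torus_h_val k) ha.symm]
      exact zero_mem _
    · obtain ⟨o, ho, n, rfl⟩ := hκw k
      by_cases hom : e8Class (e8Vec (o.getD 0 [])) = m
      · have hcl : ∀ n, e8Class (IsE8Matrix.coord A α (w^[n] (κ o))) = m := fun n ↦ by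
          rw [IsE8Matrix.e8Class_coord_iterate J.coord_w, hκ o ho, hom]
        have hgen : ∀ n, ∀ v ∈ V (w^[n] (κ o)), v ≠ 0 →
            proj z T (e a) v ∈ Submodule.span K (B : Set L) →
            (V (w^[n] (κ o))).map (proj z T (e a)) ≤ Submodule.span K (B : Set L) := by
          rintro n v hv hv0 hB - ⟨x, hx, rfl⟩
          obtain ⟨c, rfl⟩ := D.exists_smul hv hx hv0
          rw [map_smul]
          exact Submodule.smul_mem _ _ hB
        induction n with
        | zero =>
          refine hgen 0 _ (hy _) (hy0 _) (Submodule.subset_span ?_)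
          refine Finset.mem_coe.mpr (Finset.mem_image_of_mem _ (List.mem_toFinset.mpr ?_))
          exact List.mem_filter.mpr ⟨ho, by simpa using hom⟩
        | succ n ih =>
          have hy' := J.rot_mem _ _ (hy (w^[n] (κ o)))
          rw [← Function.iterate_succ_apply' w] at hy'
          refine hgen (n + 1) _ hy'
            (fun h ↦ hy0 _ ((T 2).injective (h.trans (map_zero (T 2)).symm))) ?_
          rw [hmem _ _ hy' (hcl _), J.eigenSum_rot hz, smul_comm, ← hmem _ _ (hy _) (hcl n)]
          exact Submodule.smul_mem _ _ (ih ⟨_, hy _, rfl⟩)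
      · rintro - ⟨x, hx, rfl⟩
        rw [proj_apply_of_ne hz' (J.torus_apply_val hz hx)]
        · exact zero_mem _
        · rwa [IsE8Matrix.e8Class_coord_iterate J.coord_w, hκ o ho]
  calc finrank K (gr a) ≤ finrank K (Submodule.span K (B : Set L)) := Submodule.finrank_mono hle
    _ ≤ B.card := finrank_span_finset_le_card B
    _ ≤ F.toFinset.card := Finset.card_image_le
    _ ≤ F.length := List.toFinset_card_le F
    _ ≤ 2 := length_filter_e8Class m ha

/-- The components of trivial class lie in the Cartan subalgebra. -/
lemma le_span_of_eq_zero (J : IsJordanDatum z gr A h V α w T e) (hz : IsPrimitiveRoot z 5)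
    {a : Fin 3 → ZMod 5} (ha : (fun j : Fin 2 ↦ e a j.castSucc) = 0) :
    gr a ≤ Submodule.span K (Set.range fun k ↦
      eigenSum (T 2).toLinearEquiv.toLinearMap ((z : K) ^ (e a 2).val) (h k)) := by
  have D := J.isE8Datum
  have hz' : IsPrimitiveRoot (z : K) 5 := IsPrimitiveRoot.coe_units_iff.mpr hz
  obtain ⟨κ, hκ, hκw⟩ := D.isE8Matrix.exists_orbit_representatives J.isFrame J.coord_w
  refine (J.le_map_proj a).trans (sup_le (Submodule.span_le.mpr ?_) (iSup_le fun k ↦ ?_))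
  · rintro - ⟨k, rfl⟩
    change proj z T (e a) (h k) ∈ _
    rw [proj_apply_of_eq fun j ↦ by rw [J.torus_h_val, ← ha]]
    exact Submodule.smul_mem _ _ (Submodule.subset_span ⟨k, rfl⟩)
  · rintro - ⟨x, hx, rfl⟩
    obtain ⟨o, ho, n, rfl⟩ := hκw k
    rw [proj_apply_of_ne hz' (J.torus_apply_val hz hx)]
    · exact zero_mem _
    · rw [IsE8Matrix.e8Class_coord_iterate J.coord_w, hκ o ho, ha]
      exact e8Class_ne_zero o ho

lemma eq_bot_of_eq_zero (J : IsJordanDatum z gr A h V α w T e) (hz : IsPrimitiveRoot z 5)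
    {a : Fin 3 → ZMod 5} (ha : e a = 0) : gr a = ⊥ := by
  refine le_bot_iff.mp ((J.le_span_of_eq_zero hz (by rw [ha]; rfl)).trans ?_)
  rw [Submodule.span_le]
  rintro - ⟨k, rfl⟩
  have h1 := J.isE8Datum.sum_h_eq_zero J.isFrame (c := fun _ ↦ 1)
    (r := ![k, w k, w (w k), w (w (w k)), w (w (w (w k)))]) <| by
      rw [← add_vecMul_e8Rot (IsE8Matrix.coord A α k)]
      simp [Fin.sum_univ_five, J.coord_w]
  simp only [Int.cast_one, one_smul, Fin.sum_univ_five, Matrix.cons_val, ← J.rot_h] at h1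
  refine Eq.trans ?_ h1
  simp [eigenSum, Finset.sum_range_succ, ha, pow_succ]

theorem finrank_le (J : IsJordanDatum z gr A h V α w T e) (hz : IsPrimitiveRoot z 5)
    (a : Fin 3 → ZMod 5) : finrank K (gr a) ≤ 2 := by
  classical
  by_cases ha : (fun j : Fin 2 ↦ e a j.castSucc) = 0
  swap
  · exact J.finrank_le_of_ne hz ha
  by_cases ha2 : e a 2 = 0
  · rw [J.eq_bot_of_eq_zero hz (a := a), finrank_bot]
    · norm_num
    · ext j
      refine j.lastCases ha2 fun j ↦ congrFun ha j
  have hz' : IsPrimitiveRoot (z : K) 5 := IsPrimitiveRoot.coe_units_iff.mpr hz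
  have D := J.isE8Datum
  set μ := (z : K) ^ (e a 2).val with hμ
  have hμ1 : μ - 1 ≠ 0 := fun h ↦ ha2 <| pow_val_injective hz' <| by
    rw [← hμ, sub_eq_zero.mp h, ZMod.val_zero, pow_zero]
  let P := eigenSum (T 2).toLinearEquiv.toLinearMap μ
  have hP : ∀ k, P (h (w k)) = μ • P (h k) := fun k ↦ by
    rw [← J.rot_h]
    exact J.eigenSum_rot hz _ _
  let B : Finset L := {P (h (α 0)), P (h (α 5))}
  let N := Submodule.span K (B : Set L)
  have hw : ∀ i j, e8Rot i = Pi.single j 1 → w (α i) = α j := fun i j hij ↦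
    IsE8Matrix.coord_injective D.isE8Matrix J.isFrame <| by
      rw [J.coord_w, IsE8Matrix.coord_frame J.isFrame, IsE8Matrix.coord_frame J.isFrame,
        Matrix.single_one_vecMul]
      exact hij
  have hNw : ∀ i j, e8Rot i = Pi.single j 1 → P (h (α i)) ∈ N → P (h (α j)) ∈ N :=
    fun i j hij hi ↦ by
      rw [← hw i j hij, hP]
      exact N.smul_mem _ hi
  have h0 : P (h (α 0)) ∈ N := Submodule.subset_span (by simp [B])
  have h5 : P (h (α 5)) ∈ N := Submodule.subset_span (by simp [B])
  have h1 : P (h (α 1)) ∈ N := hNw 0 1 (by decide +kernel) h0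
  have h4 : P (h (α 4)) ∈ N := by
    have h2 := D.sum_h_eq_zero J.isFrame (c := ![1, -1, -1, -1, -1])
      (r := ![w (α 4), α 0, α 1, α 4, α 5]) <| by
        simp only [Fin.sum_univ_five, Matrix.cons_val, J.coord_w,
          IsE8Matrix.coord_frame J.isFrame, Matrix.single_one_vecMul]
        decide +kernel
    simp only [Fin.sum_univ_five, Matrix.cons_val, Int.cast_one, Int.cast_neg] at h2
    have h3 := congrArg P h2
    simp only [map_add, map_smul, map_zero, hP] at h3
    have h4 : (μ - 1) • P (h (α 4)) = P (h (α 0)) + P (h (α 1)) + P (h (α 5)) := by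
      rw [← sub_eq_zero, ← h3]
      module
    rw [← inv_smul_smul₀ hμ1 (P (h (α 4))), h4]
    exact N.smul_mem _ (N.add_mem (N.add_mem h0 h1) h5)
  have hN : ∀ i, P (h (α i)) ∈ N := by
    have h2 := hNw 1 2 (by decide +kernel) h1
    have h3 := hNw 2 3 (by decide +kernel) h2
    have h6 := hNw 5 6 (by decide +kernel) h5
    have h7 := hNw 6 7 (by decide +kernel) h6
    intro i
    fin_cases i
    exacts [h0, h1, h2, h3, h4, h5, h6, h7]
  have hle : gr a ≤ N := by
    refine (J.le_span_of_eq_zero hz ha).trans ?_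
    rw [show (fun k ↦ eigenSum (T 2).toLinearEquiv.toLinearMap ((z : K) ^ (e a 2).val) (h k)) =
      P ∘ h from rfl, Set.range_comp, ← Submodule.map_span, ← D.span_frame J.isFrame,
      Submodule.map_span, ← Set.range_comp, Submodule.span_le]
    rintro - ⟨i, rfl⟩
    exact hN i
  exact (Submodule.finrank_mono hle).trans ((finrank_span_finset_le_card B).trans
    Finset.card_le_two)

end IsJordanDatum

lemma torusChar_zpow {M : Type*} [CommGroup M] (z : M) (g c : Fin 8 → ℤ) :
    torusChar (fun i ↦ z ^ g i) c = z ^ (g ⬝ᵥ c) := by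
  simp only [torusChar, ← zpow_mul, dotProduct, Fin.prod_univ_eight, Fin.sum_univ_eight, zpow_add]

open LieAlgebra in
/-- The Jordan grading exists. -/
theorem exists_isLieGrading_of_finrank {K L : Type*} [Field K] [CharZero K] [IsAlgClosed K]
    [LieRing L] [LieAlgebra K L] [FiniteDimensional K L] [IsSimple K L] (hL : finrank K L = 248) :
    ∃ gr : (Fin 3 → ZMod 5) → Submodule K L, IsLieGrading K gr ∧
      ∀ a, a ≠ 0 → finrank K (gr a) = 2 := by
  classical
  obtain ⟨ζ, hζ⟩ := HasEnoughRootsOfUnity.exists_primitiveRoot K 5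
  obtain ⟨z, rfl⟩ := hζ.isUnit (by norm_num)
  have hz : IsPrimitiveRoot z 5 := IsPrimitiveRoot.coe_units_iff.mp hζ
  have : Infinite K := IsAlgClosed.instInfinite
  obtain ⟨x₀, hx₀⟩ := exists_isCartanSubalgebra_engel K L
  obtain ⟨A, h, V, D, -⟩ := exists_isE8Datum (H := LieSubalgebra.engel K x₀) hL
  obtain ⟨α, hα⟩ := D.isE8Matrix.exists_isFrame
  obtain ⟨θ, w, hθ, hθV, hw⟩ := D.exists_lift_e8Rot hα
  choose S hSh hS using fun j ↦ D.exists_torus hα fun i ↦ z ^ gradVec j i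
  simp only [torusChar_zpow] at hS
  have hSθ : ∀ j x, S j (θ x) = θ (S j x) := fun j ↦
    D.ext_of_eqOn (φ := θ.trans (S j)) (ψ := (S j).trans θ)
      (fun k ↦ by simp only [LieEquiv.trans_apply, hθ, hSh]) fun k x hx ↦ by
        simp only [LieEquiv.trans_apply, hS j _ _ (hθV k x hx), hS j k x hx, map_smul, hw]
        rw [zpow_eq_pow_val hz.pow_eq_one, zpow_eq_pow_val hz.pow_eq_one]
        exact congrArg (fun c : Fin 2 → ZMod 5 ↦ (z : K) ^ (c j).val • θ x)
          (e8Class_vecMul_e8Rot _)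
  have hSS : ∀ i j x, S i (S j x) = S j (S i x) := fun i j ↦
    D.ext_of_eqOn (φ := (S j).trans (S i)) (ψ := (S i).trans (S j))
      (fun k ↦ by simp only [LieEquiv.trans_apply, hSh]) fun k x hx ↦ by
        simp only [LieEquiv.trans_apply, hS _ k x hx, map_smul]
        rw [smul_comm]
  have hS5 : ∀ j x, S j (S j (S j (S j (S j x)))) = x := fun j ↦
    D.ext_of_eqOn (φ := ((((S j).trans (S j)).trans (S j)).trans (S j)).trans (S j))
      (ψ := LieEquiv.refl) (fun k ↦ by simp only [LieEquiv.trans_apply, hSh]; rfl) fun k x hx ↦ by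
        simp only [LieEquiv.trans_apply, hS _ k x hx, map_smul, smul_smul]
        rw [← pow_two, ← pow_succ, ← pow_succ, ← pow_succ, zpow_eq_pow_val hz.pow_eq_one, ← pow_mul,
          mul_comm, pow_mul, hζ.pow_eq_one, one_pow, one_smul]
        rfl
  let T : Fin 3 → L ≃ₗ⁅K⁆ L := Fin.snoc (α := fun _ ↦ L ≃ₗ⁅K⁆ L) S θ
  have hT : ∀ j : Fin 2, T j.castSucc = S j := fun j ↦ Fin.snoc_castSucc ..
  have hT2 : T 2 = θ := Fin.snoc_last (α := fun _ ↦ L ≃ₗ⁅K⁆ L) θ S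
  have hTc : ∀ i j x, T i (T j x) = T j (T i x) := fun i j x ↦ by
    refine i.lastCases ?_ fun i ↦ ?_ <;> refine j.lastCases ?_ fun j ↦ ?_
    · rfl
    · rw [hT, show T (Fin.last 2) = θ from hT2, hSθ]
    · rw [hT, show T (Fin.last 2) = θ from hT2, hSθ]
    · rw [hT, hT, hSS]
  have hT5 : ∀ i x, T i (T i (T i (T i (T i x)))) = x := fun i x ↦ by
    refine i.lastCases ?_ fun i ↦ ?_
    · rw [show T (Fin.last 2) = θ from hT2, D.lift_e8Rot_five hα hθ hθV hw]
    · rw [hT, hS5]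
  have hgr := isLieGrading_iInf_eigenspace hζ hTc hT5
  set gr : (Fin 3 → ZMod 5) → Submodule K L := fun a ↦
    ⨅ j, Module.End.eigenspace (T j).toLinearEquiv.toLinearMap ((z : K) ^ (a j).val)
  have J : IsJordanDatum z gr A h V α w T (Equiv.refl _) :=
    { isE8Datum := D
      isFrame := hα
      coord_w := hw
      rot_h := fun k ↦ by rw [hT2, hθ]
      rot_mem := fun k x hx ↦ by rw [hT2]; exact hθV k x hx
      torus_h := fun j k ↦ by rw [hT, hSh]
      torus_apply := fun j k x hx ↦ by rw [hT, hS j k x hx]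
      apply_of_mem := fun a x hx j ↦
        Module.End.mem_eigenspace_iff.mp (Submodule.mem_iInf _ |>.mp hx j) }
  have h0 : gr 0 = ⊥ := J.eq_bot_of_eq_zero hz rfl
  have hsum := Submodule.finrank_eq_sum_of_isInternal hgr.1
  rw [hL, ← Finset.sum_erase_add _ _ (Finset.mem_univ 0), h0, finrank_bot, add_zero] at hsum
  have hcard : ((Finset.univ : Finset (Fin 3 → ZMod 5)).erase 0).card = 124 := by
    rw [Finset.card_erase_of_mem (Finset.mem_univ 0), Finset.card_univ, Fintype.card_fun,
      ZMod.card, Fintype.card_fin]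
    norm_num
  have heq : ∀ a ∈ (Finset.univ : Finset (Fin 3 → ZMod 5)).erase 0, finrank K (gr a) = 2 :=
    (Finset.sum_eq_sum_iff_of_le fun a _ ↦ J.finrank_le hz a).mp <| by
      rw [← hsum, Finset.sum_const, hcard]
      rfl
  exact ⟨gr, hgr, fun a ha ↦ heq a (Finset.mem_erase.mpr ⟨ha, Finset.mem_univ a⟩)⟩

theorem jordan_grading_E8_Z5 (F : Type*) [Field F] [IsAlgClosed F] [CharZero F]
    (L : Type*) [LieRing L] [LieAlgebra F L] [FiniteDimensional F L]
    [LieAlgebra.IsSimple F L] (hdim : finrank F L = 248) :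
    (∃ gr : (Fin 3 → ZMod 5) → Submodule F L, IsLieGrading F gr ∧
      ∀ a : Fin 3 → ZMod 5, a ≠ 0 → finrank F (gr a) = 2) ∧
    ∀ gr gr' : (Fin 3 → ZMod 5) → Submodule F L,
      IsLieGrading F gr → (∀ a : Fin 3 → ZMod 5, a ≠ 0 → finrank F (gr a) = 2) →
      IsLieGrading F gr' → (∀ a : Fin 3 → ZMod 5, a ≠ 0 → finrank F (gr' a) = 2) →
      GradingsEquiv F gr gr' :=
  ⟨exists_isLieGrading_of_finrank hdim,
    fun _ _ hgr hd hgr' hd' ↦ hgr.gradingsEquiv hdim hgr' hd hd'⟩
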